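/- There exist absolute constants C, c > 0 such that the following holds. Let q ≤ N be positive integers, δ > 0, and let f : ℤ → ℂ be a 1-bounded function supported in [N]. Suppose that ‖f‖♭_{q,N} ≥ δ. Then either N ≤ C (q/δ)^C, or there exists a 1-bounded local function φ of resolution at least c (δ/q)^C N^{1/2} and modulus qq' for some positive integer q' ≤ C δ^{-C}, such that ∑_{x∈[N]} f(x) φ(x) ≥ c δ^C N. -/

import Mathlib

/-- The counting operator `Λ_{q,N}(f₀,f₁,f₂) = 𝔼_{x∈[N]} 𝔼_{y∈[M]} f₀(x) f₁(x+y) f₂(x+qy²)`,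
where `M = ⌊√(N/q)⌋`. -/
noncomputable def cntOp (q N : ℕ) (f₀ f₁ f₂ : ℤ → ℂ) : ℂ :=
  (∑ x ∈ Finset.Icc (1 : ℤ) (N : ℤ), ∑ y ∈ Finset.Icc (1 : ℤ) ((Nat.sqrt (N / q) : ℕ) : ℤ),
      f₀ x * f₁ (x + y) * f₂ (x + (q : ℤ) * y ^ 2)) /
    ((N : ℂ) * ((Nat.sqrt (N / q) : ℕ) : ℂ))

/-- The partial cut norm `‖f‖♭_{q,N}`: the supremum of `|Λ_{q,N}(f,g₁,g₂)|` and
`|Λ_{q,N}(g₁,f,g₂)|` over 1-bounded `g₁, g₂` supported in `[N]`. -/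
noncomputable def partialCutNorm (q N : ℕ) (f : ℤ → ℂ) : ℝ :=
  sSup {r : ℝ | ∃ g₁ g₂ : ℤ → ℂ,
    (∀ x, ‖g₁ x‖ ≤ 1) ∧ (∀ x, ‖g₂ x‖ ≤ 1) ∧
    (∀ x, g₁ x ≠ 0 → x ∈ Finset.Icc (1 : ℤ) (N : ℤ)) ∧
    (∀ x, g₂ x ≠ 0 → x ∈ Finset.Icc (1 : ℤ) (N : ℤ)) ∧
    (r = ‖cntOp q N f g₁ g₂‖ ∨ r = ‖cntOp q N g₁ f g₂‖)}

/-- `φ : ℤ → ℂ` is a *local function of resolution `M` and modulus `q`*. -/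
def IsLocalFunction (φ : ℤ → ℂ) (M : ℝ) (q : ℕ) : Prop :=
  ∃ r : ℝ, ∀ x y : ℤ,
    ⌊((x : ℝ) - r) / M⌋ = ⌊((y : ℝ) - r) / M⌋ → x % (q : ℤ) = y % (q : ℤ) → φ x = φ y

namespace PCN
open Finset ComplexConjugate
open scoped BigOperators
set_option linter.unusedSectionVars false
set_option linter.style.haveILetI false

section
section basics
variable {ι κ : Type*} [Fintype ι] [Fintype κ]
lemma E_norm_le (f : ι → ℂ) : ‖𝔼 i, f i‖ ≤ 𝔼 i, ‖f i‖ := RCLike.norm_expect_le (K := ℂ)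
lemma E_mono {f g : ι → ℝ} (h : ∀ i, f i ≤ g i) : 𝔼 i, f i ≤ 𝔼 i, g i :=
  expect_le_expect fun i _ => h i
lemma E_nonneg {f : ι → ℝ} (h : ∀ i, 0 ≤ f i) : 0 ≤ 𝔼 i, f i := expect_nonneg fun i _ => h i
lemma E_le_const {f : ι → ℝ} {c : ℝ} (hc : 0 ≤ c) (h : ∀ i, f i ≤ c) : 𝔼 i, f i ≤ c := by
  rcases isEmpty_or_nonempty ι with hι | hι
  · simp [Finset.univ_eq_empty, hc]
  · exact expect_le univ_nonempty fun i _ => h i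
lemma E_norm_le_const {f : ι → ℂ} {c : ℝ} (hc : 0 ≤ c) (h : ∀ i, ‖f i‖ ≤ c) : ‖𝔼 i, f i‖ ≤ c :=
  (E_norm_le f).trans (E_le_const hc h)
lemma E_norm_le_one {f : ι → ℂ} (h : ∀ i, ‖f i‖ ≤ 1) : ‖𝔼 i, f i‖ ≤ 1 :=
  E_norm_le_const zero_le_one h
lemma E_sq_le (f : ι → ℝ) : (𝔼 i, f i) ^ 2 ≤ 𝔼 i, f i ^ 2 := by
  rcases isEmpty_or_nonempty ι with hι | hι
  · simp [Finset.univ_eq_empty]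
  · have := expect_mul_sq_le_sq_mul_sq univ f (fun _ => 1)
    simpa using this
lemma E_normsq_le (f : ι → ℂ) : ‖𝔼 i, f i‖ ^ 2 ≤ 𝔼 i, ‖f i‖ ^ 2 :=
  (pow_le_pow_left₀ (norm_nonneg _) (E_norm_le f) 2).trans (E_sq_le _)
lemma E_pow_le {f : ι → ℝ} (hf : ∀ i, 0 ≤ f i) (k : ℕ) :
    (𝔼 i, f i) ^ (2 ^ k) ≤ 𝔼 i, f i ^ (2 ^ k) := by
  induction k with
  | zero => simp
  | succ k ih =>
    rw [pow_succ, pow_mul]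
    refine (pow_le_pow_left₀ (pow_nonneg (E_nonneg hf) _) ih 2).trans ((E_sq_le _).trans ?_)
    simp only [← pow_mul]; exact le_rfl
lemma E_conj (f : ι → ℂ) : conj (𝔼 i, f i) = 𝔼 i, conj (f i) := by
  rw [Fintype.expect_eq_sum_div_card, Fintype.expect_eq_sum_div_card]; simp
lemma E_re (f : ι → ℂ) : (𝔼 i, f i).re = 𝔼 i, (f i).re := by
  rw [Fintype.expect_eq_sum_div_card, Fintype.expect_eq_sum_div_card]
  rw [← Complex.ofReal_natCast, Complex.div_ofReal_re]; simp
lemma E_ofReal (f : ι → ℝ) : ((𝔼 i, f i : ℝ) : ℂ) = 𝔼 i, (f i : ℂ) := by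
  rw [Fintype.expect_eq_sum_div_card, Fintype.expect_eq_sum_div_card]; simp
lemma E_prod {M : Type*} [AddCommMonoid M] [Module ℚ≥0 M] (f : ι × κ → M) :
    𝔼 p, f p = 𝔼 a, 𝔼 b, f (a, b) := by
  rw [← expect_product]; rfl
lemma E_comm {M : Type*} [AddCommMonoid M] [Module ℚ≥0 M] (f : ι → κ → M) :
    𝔼 a, 𝔼 b, f a b = 𝔼 b, 𝔼 a, f a b := expect_comm _ _ _
lemma E_const [Nonempty ι] {M : Type*} [AddCommMonoid M] [Module ℚ≥0 M] (a : M) :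
    𝔼 _i : ι, a = a := Fintype.expect_const a
lemma E_mul_conj (b : ι → ℂ) :
    (𝔼 j, b j) * conj (𝔼 j, b j) = 𝔼 j, 𝔼 j', b j * conj (b j') := by
  rw [E_conj, expect_mul_expect]
lemma normsq_eq (z : ℂ) : ((‖z‖ ^ 2 : ℝ) : ℂ) = z * conj z := by
  rw [Complex.mul_conj, Complex.normSq_eq_norm_sq]
lemma E_normsq_eq (b : ι → ℂ) :
    ((‖𝔼 j, b j‖ ^ 2 : ℝ) : ℂ) = 𝔼 j, 𝔼 j', b j * conj (b j') := by
  rw [normsq_eq, E_mul_conj]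
lemma E_mul_normsq_le {a b : ι → ℂ} (ha : ∀ i, ‖a i‖ ≤ 1) :
    ‖𝔼 i, a i * b i‖ ^ 2 ≤ 𝔼 i, ‖b i‖ ^ 2 := by
  refine (E_normsq_le _).trans (E_mono fun i => ?_)
  rw [norm_mul, mul_pow]
  exact mul_le_of_le_one_left (by positivity) (pow_le_one₀ (norm_nonneg _) (ha i))
lemma kill {a : ι → ℂ} {b : ι → κ → ℂ} (ha : ∀ i, ‖a i‖ ≤ 1) :
    ‖𝔼 i, a i * 𝔼 j, b i j‖ ^ 2 ≤ ‖𝔼 j, 𝔼 j', 𝔼 i, b i j * conj (b i j')‖ := by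
  refine (E_mul_normsq_le ha).trans ?_
  have : ((𝔼 i, ‖𝔼 j, b i j‖ ^ 2 : ℝ) : ℂ) = 𝔼 j, 𝔼 j', 𝔼 i, b i j * conj (b i j') := by
    rw [E_ofReal]; simp_rw [E_normsq_eq]
    rw [E_comm]; congr 1; ext j; rw [E_comm]
  rw [← this, Complex.norm_real]; exact le_abs_self _
lemma E_ge_of_ind {f : ι → ℝ} {c : ℝ} {p : ι → Prop} [DecidablePred p]
    (h0 : ∀ i, 0 ≤ f i) (h : ∀ i, p i → c ≤ f i) :
    c * 𝔼 i, (if p i then (1:ℝ) else 0) ≤ 𝔼 i, f i := by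
  rw [mul_expect]; refine E_mono fun i => ?_
  split_ifs with hp
  · simpa using h i hp
  · simpa using h0 i
lemma ind_ge_of_E [Nonempty ι] {f : ι → ℝ} {c : ℝ} {p : ι → Prop} [DecidablePred p]
    (h1 : ∀ i, f i ≤ 1) (h : ∀ i, ¬ p i → f i ≤ c) (hc : 0 ≤ c) :
    (𝔼 i, f i) - c ≤ 𝔼 i, (if p i then (1:ℝ) else 0) := by
  have : 𝔼 i, f i ≤ 𝔼 i, ((if p i then (1:ℝ) else 0) + c) := E_mono fun i => by
    split_ifs with hp
    · linarith [h1 i]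
    · simpa using h i hp
  rw [expect_add_distrib, E_const] at this; linarith
lemma E_exists [Nonempty ι] {f : ι → ℝ} {c : ℝ} (h : c ≤ 𝔼 i, f i) : ∃ i, c ≤ f i := by
  obtain ⟨i, _, hi⟩ := exists_le_of_le_expect univ_nonempty h; exact ⟨i, hi⟩
end basics
section grp
variable {G : Type*} [AddCommGroup G] [Fintype G] {M : Type*} [AddCommMonoid M] [Module ℚ≥0 M]
lemma E_shift (f : G → M) (a : G) : 𝔼 x, f (x + a) = 𝔼 x, f x :=
  Fintype.expect_equiv (Equiv.addRight a) _ _ fun _ => rfl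
lemma E_shift_sub (f : G → M) (a : G) : 𝔼 x, f (x - a) = 𝔼 x, f x :=
  Fintype.expect_equiv (Equiv.subRight a) _ _ fun _ => rfl
lemma E_neg (f : G → M) : 𝔼 x, f (-x) = 𝔼 x, f x :=
  Fintype.expect_equiv (Equiv.neg G) _ _ fun _ => rfl
end grp
lemma E_interval_shift {M : ℕ} (u : ℕ → ℂ) (hu : ∀ y, ‖u y‖ ≤ 1) (s : ℕ) :
    ‖𝔼 y : Fin M, u y - 𝔼 y : Fin M, u (y + s)‖ ≤ 2 * s / M := by
  rcases Nat.eq_zero_or_pos M with rfl | hM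
  · simp [Finset.univ_eq_empty]
  have h1 : ∑ y : Fin M, u y = ∑ y ∈ range M, u y := Fin.sum_univ_eq_sum_range u M
  have h2 : ∑ y : Fin M, u (y + s) = ∑ y ∈ range M, u (y + s) :=
    Fin.sum_univ_eq_sum_range (fun y => u (y + s)) M
  rw [Fintype.expect_eq_sum_div_card, Fintype.expect_eq_sum_div_card, h1, h2, ← sub_div, norm_div]
  simp only [Fintype.card_fin, Complex.norm_natCast]
  gcongr
  have key : ∑ y ∈ range M, u y - ∑ y ∈ range M, u (y + s)
      = ∑ y ∈ range s, u y - ∑ y ∈ range s, u (M + y) := by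
    have e1 := sum_range_add u M s
    have e2 := sum_range_add u s M
    rw [add_comm s M, e1] at e2
    have : ∑ y ∈ range M, u (y + s) = ∑ y ∈ range M, u (s + y) := by simp_rw [add_comm]
    rw [this]; linear_combination e2
  rw [key]
  have b1 : ‖∑ y ∈ range s, u y‖ ≤ s := by
    simpa using norm_sum_le_of_le (range s) (f := u) (n := fun _ => 1) fun y _ => hu y
  have b2 : ‖∑ y ∈ range s, u (M + y)‖ ≤ s := by
    simpa using norm_sum_le_of_le (range s) (f := fun y => u (M + y)) (n := fun _ => 1)
      fun y _ => hu _
  linarith [norm_sub_le (∑ y ∈ range s, u y) (∑ y ∈ range s, u (M + y))]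
lemma E_interval_shift_avg {M H : ℕ} (hH : 0 < H) (u : ℕ → ℂ) (hu : ∀ y, ‖u y‖ ≤ 1) :
    ‖𝔼 y : Fin M, u y - 𝔼 s : Fin H, 𝔼 y : Fin M, u (y + s)‖ ≤ 2 * H / M := by
  haveI : NeZero H := ⟨hH.ne'⟩
  have : 𝔼 y : Fin M, u y - 𝔼 s : Fin H, 𝔼 y : Fin M, u (y + s)
      = 𝔼 s : Fin H, (𝔼 y : Fin M, u y - 𝔼 y : Fin M, u (y + s)) := by
    rw [expect_sub_distrib, E_const]
  rw [this]
  refine E_norm_le_const (by positivity) fun s => (E_interval_shift u hu s).trans ?_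
  gcongr; exact_mod_cast s.2.le
end
section
section gowers
variable {G Z : Type} [AddCommGroup G] [Fintype G] [AddCommGroup Z] [Fintype Z]
def Dl (a : G) (K : G → ℂ) : G → ℂ := fun x => K (x + a) * conj (K x)
lemma Dl_comm (a b : G) (K : G → ℂ) : Dl a (Dl b K) = Dl b (Dl a K) := by
  funext x; simp only [Dl, map_mul, Complex.conj_conj]
  rw [add_right_comm x a b]; ring
lemma Dl_bdd {K : G → ℂ} (hK : ∀ x, ‖K x‖ ≤ 1) (a x : G) : ‖Dl a K x‖ ≤ 1 := by
  simp only [Dl, norm_mul, RCLike.norm_conj]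
  exact mul_le_one₀ (hK _) (norm_nonneg _) (hK _)
lemma Dl_mul (a : G) (K L : G → ℂ) : Dl a (fun x => K x * L x) = fun x => Dl a K x * Dl a L x := by
  funext x; simp only [Dl, map_mul]; ring
noncomputable def V (i : Z →+ G) : ℕ → (G → ℂ) → ℝ
  | 0, F => 𝔼 x, ‖𝔼 z, F (x + i z)‖ ^ 2
  | s + 1, F => 𝔼 z, V i s (Dl (i z) F)
noncomputable def W (i : Z →+ G) : ℕ → (G → ℂ) → ℂ
  | 0, F => 𝔼 x, F x
  | s + 1, F => 𝔼 z, W i s (Dl (i z) F)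
lemma V_nonneg (i : Z →+ G) (s : ℕ) (F : G → ℂ) : 0 ≤ V i s F := by
  induction s generalizing F with
  | zero => exact E_nonneg fun x => by positivity
  | succ s ih => exact E_nonneg fun z => ih _
lemma V_le_one (i : Z →+ G) (s : ℕ) {F : G → ℂ} (hF : ∀ x, ‖F x‖ ≤ 1) : V i s F ≤ 1 := by
  induction s generalizing F with
  | zero => exact E_le_const zero_le_one fun x =>
      pow_le_one₀ (norm_nonneg _) (E_norm_le_one fun z => hF _)
  | succ s ih => exact E_le_const zero_le_one fun z => ih (Dl_bdd hF _)
lemma V0_eq (i : Z →+ G) (F : G → ℂ) : (V i 0 F : ℂ) = 𝔼 z, 𝔼 x, Dl (i z) F x := by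
  simp only [V]
  rw [E_ofReal]; simp_rw [E_normsq_eq]
  have : ∀ z', 𝔼 x, 𝔼 z, F (x + i z) * conj (F (x + i z')) = 𝔼 z, 𝔼 x, Dl (i z) F x := by
    intro z'
    rw [E_comm, ← E_shift (fun z => 𝔼 x, F (x + i z) * conj (F (x + i z'))) z']
    congr 1; ext z
    rw [← E_shift_sub _ (i z')]
    simp only [Dl, sub_add_cancel, map_add]
    congr 1; ext x; congr 2; abel
  calc _ = 𝔼 z', 𝔼 x, 𝔼 z, F (x + i z) * conj (F (x + i z')) := by
        refine Eq.trans ?_ (E_comm _); congr 1; ext x; exact E_comm _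
    _ = _ := by simp_rw [this]; rw [E_const]
lemma W_succ (i : Z →+ G) (s : ℕ) (F : G → ℂ) : W i (s + 1) F = (V i s F : ℂ) := by
  induction s generalizing F with
  | zero => rw [V0_eq]; rfl
  | succ s ih =>
    rw [W, V, E_ofReal]; congr 1; ext z; exact ih _
lemma normsq_le_V0 (i : Z →+ G) (K : G → ℂ) : ‖𝔼 x, K x‖ ^ 2 ≤ V i 0 K := by
  have : 𝔼 x, K x = 𝔼 x, 𝔼 z, K (x + i z) := by
    rw [E_comm]; simp_rw [E_shift]; rw [E_const]
  rw [this]; exact E_normsq_le _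
lemma Dl_conj (a : G) (F : G → ℂ) : Dl a (fun x => conj (F x)) = fun x => conj (Dl a F x) := by
  funext x; simp [Dl]
lemma V_conj (i : Z →+ G) (s : ℕ) (F : G → ℂ) : V i s (fun x => conj (F x)) = V i s F := by
  induction s generalizing F with
  | zero => simp only [V]; congr 1; ext x; rw [← E_conj, RCLike.norm_conj]
  | succ s ih => simp only [V]; congr 1; ext z; rw [Dl_conj, ih]
lemma V_translate (i : Z →+ G) (s : ℕ) (F : G → ℂ) (c : G) :
    V i s (fun x => F (x + c)) = V i s F := by
  induction s generalizing F with
  | zero =>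
    simp only [V]; rw [← E_shift (fun x => ‖𝔼 z, F (x + i z)‖ ^ 2) c]
    congr 1; ext x; congr 3; ext z; congr 1; abel
  | succ s ih =>
    simp only [V]; congr 1; ext z; rw [← ih (Dl (i z) F)]; congr 1; funext x; simp only [Dl]
    rw [add_right_comm]
lemma W_C1 {J : Type*} [Fintype J] (i : Z →+ G) (s : ℕ) {D : G → ℂ} (hD : ∀ x, ‖D x‖ ≤ 1)
    (e : J → G) :
    ‖𝔼 j, W i s (Dl (e j) D)‖ ^ 2 ≤ (𝔼 j, 𝔼 j', W i s (Dl (e j - e j') D)).re := by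
  induction s generalizing D with
  | zero =>
    simp only [W]
    have h1 : 𝔼 j, 𝔼 x, Dl (e j) D x = 𝔼 x, conj (D x) * 𝔼 j, D (x + e j) := by
      rw [E_comm]; congr 1; ext x; rw [mul_expect]; congr 1; ext j; simp only [Dl]; ring
    rw [h1]
    refine (E_mul_normsq_le fun x => by simpa using hD x).trans ?_
    rw [← Complex.ofReal_re (𝔼 x, ‖𝔼 j, D (x + e j)‖ ^ 2), E_ofReal]
    simp_rw [E_normsq_eq]
    apply le_of_eq; congr 1
    rw [E_comm]; congr 1; ext j; rw [E_comm]; congr 1; ext j'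
    rw [← E_shift_sub _ (e j')]; congr 1; ext x; simp only [Dl]
    rw [sub_add_cancel, show x - e j' + e j = x + (e j - e j') by abel]
  | succ s ih =>
    simp only [W]
    rw [E_comm]
    refine (E_normsq_le _).trans ?_
    have h2 : 𝔼 j, 𝔼 j', 𝔼 z, W i s (Dl (i z) (Dl (e j - e j') D))
      = 𝔼 z, 𝔼 j, 𝔼 j', W i s (Dl (e j - e j') (Dl (i z) D)) := by
      rw [E_comm (ι := Z)]; congr 1; ext j; rw [E_comm]; simp_rw [Dl_comm]
    rw [h2, E_re]
    refine E_mono fun z => ?_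
    simp_rw [Dl_comm (i z)]
    exact ih (Dl_bdd hD _)
lemma V_C1 {J : Type*} [Fintype J] (i : Z →+ G) (s : ℕ) {D : G → ℂ} (hD : ∀ x, ‖D x‖ ≤ 1)
    (e : J → G) :
    (𝔼 j, V i s (Dl (e j) D)) ^ 2 ≤ 𝔼 j, 𝔼 j', V i s (Dl (e j - e j') D) := by
  have := W_C1 i (s + 1) hD e
  simp_rw [W_succ, ← E_ofReal] at this
  rw [Complex.norm_real, Complex.ofReal_re] at this
  simpa using this
lemma V_fibre (i : Z →+ G) (s : ℕ) (F : G → ℂ) :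
    V i s F = 𝔼 x, V (AddMonoidHom.id Z) s (fun w => F (x + i w)) := by
  induction s generalizing F with
  | zero =>
    simp only [V]; congr 1; ext x
    have : ∀ x' : Z, ‖𝔼 z, F (x + i (x' + AddMonoidHom.id Z z))‖ ^ 2 = ‖𝔼 z, F (x + i z)‖ ^ 2 := by
      intro x'; simp only [AddMonoidHom.id_apply]
      congr 2; rw [← E_shift (fun z => F (x + i z)) x']
      congr 1; ext z; rw [add_comm x' z]
    simp_rw [this]; rw [E_const]
  | succ s ih =>
    simp only [V]; simp_rw [ih]; rw [E_comm]
    congr 1; ext x; congr 1; ext z; congr 1; funext w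
    simp only [Dl, AddMonoidHom.id_apply, map_add]; congr 2; abel
end gowers
section box
variable {Z : Type} [AddCommGroup Z] [Fintype Z]
def DD (Z : Type) : ℕ → Type
  | 0 => Unit
  | k + 1 => Z × DD Z k
noncomputable instance DD.fintype (Z : Type) [Fintype Z] : (k : ℕ) → Fintype (DD Z k)
  | 0 => inferInstanceAs (Fintype Unit)
  | k + 1 => by
    haveI := DD.fintype Z k
    exact inferInstanceAs (Fintype (Z × DD Z k))
instance DD.nonempty (Z : Type) [Nonempty Z] : (k : ℕ) → Nonempty (DD Z k)
  | 0 => inferInstanceAs (Nonempty Unit)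
  | k + 1 => by
    haveI := DD.nonempty Z k
    exact inferInstanceAs (Nonempty (Z × DD Z k))
lemma E_DD_succ {M : Type*} [AddCommMonoid M] [Module ℚ≥0 M] (k : ℕ) (f : DD Z (k + 1) → M) :
    𝔼 p, f p = 𝔼 a : Z, 𝔼 b : DD Z k, f (a, b) := E_prod (ι := Z) (κ := DD Z k) f
lemma E_DD_zero {M : Type*} [AddCommMonoid M] [Module ℚ≥0 M] (f : DD Z 0 → M) :
    𝔼 p, f p = f () := by
  exact expect_singleton (ι := Unit) f ()
def BB : (k : ℕ) → (DD Z k → ℂ) → Prop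
  | 0, b => ∀ d, b d = 1
  | k + 1, b => ∃ (b0 : DD Z k → ℂ) (b1 : Z → DD Z k → ℂ), (∀ d, ‖b0 d‖ ≤ 1) ∧
      (∀ a, BB k (b1 a)) ∧ ∀ a d, b (a, d) = b0 d * b1 a d
lemma BB_mul {k : ℕ} {b c : DD Z k → ℂ} (hb : BB k b) (hc : BB k c) :
    BB k (fun d => b d * c d) := by
  induction k with
  | zero => intro d; simp [hb d, hc d]
  | succ k ih =>
    obtain ⟨b0, b1, h1, h2, h3⟩ := hb
    obtain ⟨c0, c1, g1, g2, g3⟩ := hc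
    refine ⟨fun d => b0 d * c0 d, fun a d => b1 a d * c1 a d, fun d => ?_, fun a => ih (h2 a) (g2 a),
      fun a d => ?_⟩
    · rw [norm_mul]; exact mul_le_one₀ (h1 d) (norm_nonneg _) (g1 d)
    · simp only [h3, g3]; ring
lemma BB_conj {k : ℕ} {b : DD Z k → ℂ} (hb : BB k b) : BB k (fun d => conj (b d)) := by
  induction k with
  | zero => intro d; simp [hb d]
  | succ k ih =>
    obtain ⟨b0, b1, h1, h2, h3⟩ := hb
    refine ⟨fun d => conj (b0 d), fun a d => conj (b1 a d), fun d => ?_, fun a => ih (h2 a),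
      fun a d => ?_⟩
    · simpa using h1 d
    · simp only [h3, map_mul]
lemma BB_const {k : ℕ} {b : DD Z (k + 1) → ℂ} (hb : BB (k + 1) b) (c : ℂ) (hc : ‖c‖ ≤ 1) :
    BB (k + 1) (fun d => c * b d) := by
  obtain ⟨b0, b1, h1, h2, h3⟩ := hb
  refine ⟨fun d => c * b0 d, b1, fun d => ?_, h2, fun a d => ?_⟩
  · rw [norm_mul]; exact mul_le_one₀ hc (norm_nonneg _) (h1 d)
  · simp only [h3]; ring
noncomputable def box : (k : ℕ) → (DD Z k → ℂ) → ℂ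
  | 0, T => T ()
  | k + 1, T => 𝔼 a, 𝔼 a', box k (fun d => T (a, d) * conj (T (a', d)))
lemma box_le {Ω : Type} [Fintype Ω] (k : ℕ) (T b : Ω → DD Z k → ℂ) (hb : ∀ ω, BB k (b ω)) :
    ‖𝔼 ω, 𝔼 d, T ω d * b ω d‖ ^ (2 ^ k) ≤ ‖𝔼 ω, box k (T ω)‖ := by
  induction k generalizing Ω with
  | zero =>
    simp only [box, E_DD_zero, pow_zero, pow_one]
    simp_rw [fun ω => hb ω ()]; simp
  | succ k ih =>
    choose b0 b1 h1 h2 h3 using hb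
    have e1 : 𝔼 ω, 𝔼 d, T ω d * b ω d
        = 𝔼 p : Ω × DD Z k, b0 p.1 p.2 * 𝔼 a, (T p.1 (a, p.2) * b1 p.1 a p.2) := by
      rw [E_prod]; congr 1; ext ω; rw [E_DD_succ, E_comm]; congr 1; ext d
      rw [mul_expect]; congr 1; ext a; rw [h3]; ring
    have e2 := kill (a := fun p : Ω × DD Z k => b0 p.1 p.2)
      (b := fun p (a : Z) => T p.1 (a, p.2) * b1 p.1 a p.2) (fun p => h1 _ _)
    have e3 := ih (Ω := Z × Z × Ω) (fun w d => T w.2.2 (w.1, d) * conj (T w.2.2 (w.2.1, d)))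
      (fun w d => b1 w.2.2 w.1 d * conj (b1 w.2.2 w.2.1 d))
      (fun w => BB_mul (h2 _ _) (BB_conj (h2 _ _)))
    rw [pow_succ', pow_mul, e1]
    refine (pow_le_pow_left₀ (by positivity) e2 _).trans ?_
    simp only [E_prod] at e3 ⊢
    refine le_trans (le_of_eq ?_) (e3.trans (le_of_eq ?_))
    · congr 2; refine congrArg _ ?_; ext a; congr 1; ext a'; congr 1; ext ω; congr 1; ext d
      simp only [map_mul]; ring
    · simp only [box]; congr 1; symm; refine (E_comm _).trans ?_; congr 1; ext a; exact E_comm _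
noncomputable def cp : (k : ℕ) → (DD Z k → ℂ) → DD Z k → DD Z k → ℂ
  | 0, T, _, _ => T ()
  | k + 1, T, p, p' => cp k (fun e => T (p.1, e) * conj (T (p'.1, e))) p.2 p'.2
lemma box_eq_cp (k : ℕ) (T : DD Z k → ℂ) : box k T = 𝔼 d, 𝔼 d', cp k T d d' := by
  induction k with
  | zero => simp only [box, cp, E_DD_zero]
  | succ k ih =>
    simp only [box, E_DD_succ, cp]
    congr 1; ext a; rw [E_comm (ι := DD Z k)]; congr 1; ext a'; rw [ih]
lemma cp_mul (k : ℕ) (S T : DD Z k → ℂ) (d d' : DD Z k) :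
    cp k (fun e => S e * T e) d d' = cp k S d d' * cp k T d d' := by
  induction k with
  | zero => rfl
  | succ k ih =>
    simp only [cp, ← ih]; congr 1; funext e; simp only [map_mul]; ring
lemma cp_bdd (k : ℕ) {T : DD Z k → ℂ} (hT : ∀ e, ‖T e‖ ≤ 1) (d d' : DD Z k) :
    ‖cp k T d d'‖ ≤ 1 := by
  induction k with
  | zero => exact hT _
  | succ k ih =>
    refine ih (fun e => ?_) _ _
    rw [norm_mul, RCLike.norm_conj]; exact mul_le_one₀ (hT _) (norm_nonneg _) (hT _)
lemma cp_ne_zero (k : ℕ) {T : DD Z k → ℂ} {d d' : DD Z k} (h : cp k T d d' ≠ 0) : T d ≠ 0 := by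
  induction k with
  | zero => exact h
  | succ k ih =>
    have := ih h
    exact (mul_ne_zero_iff.1 this).1
def ap : (k : ℕ) → (DD Z k → Z) → DD Z k → DD Z k → Z
  | 0, φ, _, _ => φ ()
  | k + 1, φ, p, p' => ap k (fun e => φ (p.1, e) - φ (p'.1, e)) p.2 p'.2
lemma cp_char (k : ℕ) (χ : Z → ℂ) (hχ : ∀ x y, χ (x - y) = χ x * conj (χ y)) (φ : DD Z k → Z)
    (d d' : DD Z k) : cp k (fun e => χ (φ e)) d d' = χ (ap k φ d d') := by
  induction k with
  | zero => rfl
  | succ k ih => simp only [cp, ap, ← ih, hχ]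
lemma char_ap (k : ℕ) (χ : Z → ℂ) (hχ : ∀ x y, χ (x + y) = χ x * χ y) (h1 : ∀ x, ‖χ x‖ ≤ 1)
    (φ : DD Z k → Z) (d' : DD Z k) :
    ∃ b, BB k b ∧ ∀ d, χ (φ d) = χ (ap k φ d d') * b d := by
  induction k with
  | zero => exact ⟨fun _ => 1, fun _ => rfl, fun d => by
      have : d = () := rfl
      simp [ap, this]⟩
  | succ k ih =>
    choose b hb hb' using fun a => ih (fun e => φ (a, e) - φ (d'.1, e)) d'.2
    refine ⟨fun p => χ (φ (d'.1, p.2)) * b p.1 p.2, ⟨fun e => χ (φ (d'.1, e)), b, fun e => h1 _, hb,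
      fun a d => rfl⟩, fun p => ?_⟩
    have e1 : φ p = φ (d'.1, p.2) + (φ (p.1, p.2) - φ (d'.1, p.2)) := by
      rw [add_sub_cancel]; rfl
    simp only [ap]
    rw [e1, hχ, hb' p.1 p.2]; ring
noncomputable def mD : (k : ℕ) → DD Z k → (Z → ℂ) → Z → ℂ
  | 0, _, K => K
  | k + 1, p, K => mD k p.2 (Dl p.1 K)
def sg : (k : ℕ) → DD Z k → Z
  | 0, _ => 0
  | k + 1, p => p.1 + sg k p.2
lemma V_eq_mD (s k : ℕ) (K : Z → ℂ) :
    V (AddMonoidHom.id Z) (s + k) K = 𝔼 d, V (AddMonoidHom.id Z) s (mD k d K) := by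
  induction k generalizing K with
  | zero => simp only [E_DD_zero, mD, add_zero]
  | succ k ih =>
    rw [← add_assoc]; simp only [V, E_DD_succ, mD, ih]; rfl
lemma mD_Dl (k : ℕ) (d : DD Z k) (a : Z) (K : Z → ℂ) : mD k d (Dl a K) = Dl a (mD k d K) := by
  induction k generalizing K with
  | zero => rfl
  | succ k ih => simp only [mD, Dl_comm _ a, ih]
lemma mD_bdd (k : ℕ) (d : DD Z k) {K : Z → ℂ} (hK : ∀ x, ‖K x‖ ≤ 1) (x : Z) : ‖mD k d K x‖ ≤ 1 := by
  induction k generalizing K with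
  | zero => exact hK x
  | succ k ih => exact ih _ (Dl_bdd hK _)
lemma mD_top (k : ℕ) {K : Z → ℂ} (hK : ∀ x, ‖K x‖ ≤ 1) (z : Z) :
    ∃ b, BB k b ∧ ∀ d, mD k d K z = K (z + sg k d) * b d := by
  induction k generalizing K with
  | zero => exact ⟨fun _ => 1, fun _ => rfl, fun d => by simp [mD, sg]⟩
  | succ k ih =>
    choose b hb hb' using fun a => ih (Dl_bdd hK a)
    refine ⟨fun p => conj (K (z + sg k p.2)) * b p.1 p.2,
      ⟨fun e => conj (K (z + sg k e)), b, fun e => by simpa using hK _, hb, fun a d => rfl⟩,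
      fun p => ?_⟩
    simp only [mD, sg, hb', Dl]
    rw [show z + sg k p.2 + p.1 = z + (p.1 + sg k p.2) by abel]; ring
lemma E_box (k : ℕ) (K : Z → ℂ) :
    𝔼 z, box k (fun d => K (z + sg k d)) = W (AddMonoidHom.id Z) k K := by
  induction k generalizing K with
  | zero => simp [box, W, sg]
  | succ k ih =>
    simp only [box, W, sg, AddMonoidHom.id_apply]
    have : ∀ a' : Z, 𝔼 z, 𝔼 a, box k (fun d => K (z + (a + sg k d)) * conj (K (z + (a' + sg k d))))
        = 𝔼 a, W (AddMonoidHom.id Z) k (Dl a K) := by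
      intro a'
      rw [E_comm, ← E_shift _ a']
      congr 1; ext a
      rw [← ih, ← E_shift_sub _ a']
      congr 1; ext z; congr 1; funext d; simp only [Dl]
      rw [show z - a' + (a + a' + sg k d) = z + sg k d + a by abel,
        show z - a' + (a' + sg k d) = z + sg k d by abel]
    calc _ = 𝔼 a' : Z, 𝔼 z, 𝔼 a, box k (fun d => K (z + (a + sg k d)) * conj (K (z + (a' + sg k d)))) := by
          refine Eq.trans ?_ (E_comm _); congr 1; ext z; exact E_comm _
      _ = _ := by simp_rw [this]; rw [E_const]
end box
end
section
lemma norm_mul_le_one {a b : ℂ} (ha : ‖a‖ ≤ 1) (hb : ‖b‖ ≤ 1) : ‖a * b‖ ≤ 1 := by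
  rw [norm_mul]; exact mul_le_one₀ ha (norm_nonneg _) hb
lemma E_mul_diff {I : Type*} [Fintype I] {a b c : I → ℂ} {ε : ℝ} (hε : 0 ≤ ε) (ha : ∀ i, ‖a i‖ ≤ 1)
    (h : ∀ i, ‖b i - c i‖ ≤ ε) : ‖𝔼 i, a i * b i‖ ≤ ‖𝔼 i, a i * c i‖ + ε := by
  have h1 : ‖𝔼 i, a i * b i - 𝔼 i, a i * c i‖ ≤ ε := by
    rw [← expect_sub_distrib]
    refine E_norm_le_const hε fun i => ?_
    rw [← mul_sub, norm_mul]
    exact (mul_le_of_le_one_left (norm_nonneg _) (ha i)).trans (h i)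
  have := norm_le_norm_add_norm_sub' (𝔼 i, a i * b i) (𝔼 i, a i * c i)
  linarith
lemma shift_kill {I : Type*} [Fintype I] {M H : ℕ} (hH : 0 < H) {a : I → ℂ} {u : I → ℕ → ℂ}
    (ha : ∀ i, ‖a i‖ ≤ 1) (hu : ∀ i y, ‖u i y‖ ≤ 1) {δ : ℝ} (hδ : 0 ≤ δ)
    (h : δ ≤ ‖𝔼 i, a i * 𝔼 y : Fin M, u i y‖) (hHM : 2 * (H : ℝ) / M ≤ δ / 2) :
    δ ^ 2 / 4 ≤ ‖𝔼 s : Fin H, 𝔼 s' : Fin H, 𝔼 i, 𝔼 y : Fin M, u i (y + s) * conj (u i (y + s'))‖ := by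
  have h1 : ‖𝔼 i, a i * 𝔼 y : Fin M, u i y‖ ≤
      ‖𝔼 i, a i * 𝔼 s : Fin H, 𝔼 y : Fin M, u i (y + s)‖ + 2 * H / M :=
    E_mul_diff (by positivity) ha fun i => E_interval_shift_avg hH (u i) (hu i)
  have h2 : 𝔼 i, a i * 𝔼 s : Fin H, 𝔼 y : Fin M, u i (y + s)
      = 𝔼 p : I × Fin M, a p.1 * 𝔼 s : Fin H, u p.1 (p.2 + s) := by
    rw [E_prod]; congr 1; ext i; rw [E_comm, mul_expect]
  have h3 := kill (a := fun p : I × Fin M => a p.1)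
    (b := fun p (s : Fin H) => u p.1 (p.2 + s)) (fun p => ha _)
  have h4 : δ / 2 ≤ ‖𝔼 p : I × Fin M, a p.1 * 𝔼 s : Fin H, u p.1 (p.2 + s)‖ := by
    rw [← h2]; linarith
  have h5 : δ ^ 2 / 4 = (δ / 2) ^ 2 := by ring
  rw [h5]
  refine (pow_le_pow_left₀ (by linarith) h4 2).trans (h3.trans (le_of_eq ?_))
  simp only [E_prod]
lemma shift2 {M H : ℕ} (hH : 0 < H) (u : ℕ → ℕ → ℂ) (hu : ∀ y y', ‖u y y'‖ ≤ 1) :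
    ‖𝔼 y : Fin M, 𝔼 y' : Fin M, u y y' -
      𝔼 t : Fin H, 𝔼 s : Fin H, 𝔼 y : Fin M, 𝔼 y' : Fin M, u (y + t) (y' + s)‖ ≤ 4 * H / M := by
  have h1 := E_interval_shift_avg (M := M) hH (fun y => 𝔼 y' : Fin M, u y y')
    (fun y => E_norm_le_one fun y' => hu _ _)
  have h2 : ‖𝔼 t : Fin H, 𝔼 y : Fin M, 𝔼 y' : Fin M, u (y + t) y' -
      𝔼 t : Fin H, 𝔼 y : Fin M, 𝔼 s : Fin H, 𝔼 y' : Fin M, u (y + t) (y' + s)‖ ≤ 2 * H / M := by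
    rw [← expect_sub_distrib]
    refine E_norm_le_const (by positivity) fun t => ?_
    rw [← expect_sub_distrib]
    refine E_norm_le_const (by positivity) fun y => ?_
    exact E_interval_shift_avg hH _ fun y' => hu _ _
  have h3 : 𝔼 t : Fin H, 𝔼 s : Fin H, 𝔼 y : Fin M, 𝔼 y' : Fin M, u (y + t) (y' + s) =
     𝔼 t : Fin H, 𝔼 y : Fin M, 𝔼 s : Fin H, 𝔼 y' : Fin M, u (y + t) (y' + s) := by
    congr 1; ext t; exact E_comm _
  rw [h3]
  refine (norm_sub_le_norm_sub_add_norm_sub _ (𝔼 t : Fin H, 𝔼 y : Fin M, 𝔼 y' : Fin M, u (y + t) y') _).trans ?_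
  have : 4 * (H : ℝ) / M = 2 * H / M + 2 * H / M := by ring
  rw [this]; exact add_le_add h1 h2
section LemK
variable {G : Type} [AddCommGroup G] [Fintype G] {P : ℕ} [NeZero P]
noncomputable def QQ (i : ZMod P →+ G) (M : ℕ) (F : G → ℂ) (L : List ((G → ℂ) × ℤ × ℤ)) : ℂ :=
  𝔼 x, 𝔼 y : Fin M, 𝔼 y' : Fin M,
    F x * (L.map fun l => l.1 (x + i ((2 * (l.2.1 * (y : ℕ) + l.2.2 * (y' : ℕ)) : ℤ) : ZMod P))).prod
noncomputable def recB (i : ZMod P →+ G) (H : ℕ) (B : (G → ℂ) → ℝ) : List (ℤ × ℤ) → (G → ℂ) → ℝ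
  | [], F => B F
  | c :: cs, F => 𝔼 τ : (Fin H × Fin H) × (Fin H × Fin H), recB i H B cs
      (Dl (i ((2 * (c.1 * ((τ.2.1 : ℕ) - (τ.1.1 : ℕ)) + c.2 * ((τ.2.2 : ℕ) - (τ.1.2 : ℕ))) : ℤ) : ZMod P)) F)
lemma prod_bdd {α : Type*} (L : List α) (f : α → ℂ) (h : ∀ l ∈ L, ‖f l‖ ≤ 1) :
    ‖(L.map f).prod‖ ≤ 1 := by
  induction L with
  | nil => simp
  | cons a L ih =>
    simp only [List.map_cons, List.prod_cons]
    exact norm_mul_le_one (h a (by simp)) (ih fun l hl => h l (by simp [hl]))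
lemma prod_map_mul_conj {α : Type*} (L : List α) (f g : α → ℂ) :
    (L.map f).prod * conj (L.map g).prod = (L.map fun l => f l * conj (g l)).prod := by
  induction L with
  | nil => simp
  | cons a L ih => simp only [List.map_cons, List.prod_cons, map_mul, ← ih]; ring
lemma QQ_bdd (i : ZMod P →+ G) (M : ℕ) {F : G → ℂ} {L : List ((G → ℂ) × ℤ × ℤ)}
    (hF : ∀ x, ‖F x‖ ≤ 1) (hL : ∀ l ∈ L, ∀ x, ‖l.1 x‖ ≤ 1) : ‖QQ i M F L‖ ≤ 1 :=
  E_norm_le_one fun x => E_norm_le_one fun y => E_norm_le_one fun y' =>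
    norm_mul_le_one (hF x) (prod_bdd _ _ fun l hl => hL l hl _)
lemma QQ_step (i : ZMod P →+ G) {M H : ℕ} (hH : 0 < H) {F : G → ℂ} {f : G → ℂ} {a b : ℤ}
    {L : List ((G → ℂ) × ℤ × ℤ)}
    (hF : ∀ x, ‖F x‖ ≤ 1) (hf : ∀ x, ‖f x‖ ≤ 1) (hL : ∀ l ∈ L, ∀ x, ‖l.1 x‖ ≤ 1) :
    ∃ L' : (Fin H × Fin H) × (Fin H × Fin H) → List ((G → ℂ) × ℤ × ℤ),
      (∀ τ, (L' τ).map Prod.snd = L.map Prod.snd ∧ ∀ l ∈ L' τ, ∀ x, ‖l.1 x‖ ≤ 1) ∧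
      ‖QQ i M F ((f, a, b) :: L)‖ ^ 2 ≤ (𝔼 τ, ‖QQ i M (Dl
        (i ((2 * (a * ((τ.2.1 : ℕ) - (τ.1.1 : ℕ)) + b * ((τ.2.2 : ℕ) - (τ.1.2 : ℕ))) : ℤ) : ZMod P)) F)
          (L' τ)‖) + 12 * (H / M) := by
  let c : ℤ → ℤ → G := fun y y' => i ((2 * (a * y + b * y') : ℤ) : ZMod P)
  let cl : (ℤ × ℤ) → ℤ → ℤ → G := fun p y y' => i ((2 * (p.1 * y + p.2 * y') : ℤ) : ZMod P)
  let u : G → ℕ → ℕ → ℂ := fun x y y' =>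
    F (x - c y y') * (L.map fun l => l.1 (x - c y y' + cl l.2 y y')).prod
  have hu : ∀ x y y', ‖u x y y'‖ ≤ 1 := fun x y y' =>
    norm_mul_le_one (hF _) (prod_bdd _ _ fun l hl => hL l hl _)
  let L' : (Fin H × Fin H) × (Fin H × Fin H) → List ((G → ℂ) × ℤ × ℤ) := fun τ =>
    L.map fun l => (fun x =>
      l.1 (x + (c τ.2.1 τ.2.2 - c τ.1.1 τ.1.2 + cl l.2 τ.1.1 τ.1.2)) *
      conj (l.1 (x + (cl l.2 τ.2.1 τ.2.2))), l.2)
  refine ⟨L', fun τ => ⟨?_, ?_⟩, ?_⟩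
  · simp [L', Function.comp_def]
  · intro l hl x
    simp only [L', List.mem_map] at hl
    obtain ⟨l0, hl0, rfl⟩ := hl
    exact norm_mul_le_one (hL _ hl0 _) (by simpa using hL _ hl0 _)
  have hQ1 : ‖QQ i M F ((f, a, b) :: L)‖ ≤ 1 := QQ_bdd i M hF (by
    intro l hl; rcases List.mem_cons.1 hl with rfl | h
    · exact hf
    · exact hL _ h)
  have e1 : QQ i M F ((f, a, b) :: L) = 𝔼 x, f x * 𝔼 y : Fin M, 𝔼 y' : Fin M, u x y y' := by
    have : ∀ y y' : Fin M, 𝔼 x, F x * (((f, a, b) :: L).map fun l => l.1 (x + i ((2 * (l.2.1 * (y : ℕ) + l.2.2 * (y' : ℕ)) : ℤ) : ZMod P))).prod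
       = 𝔼 x, f x * u x y y' := by
      intro y y'
      rw [← E_shift_sub _ (c (y : ℕ) (y' : ℕ))]
      congr 1; ext x
      simp only [List.map_cons, List.prod_cons, u]
      have : x - c (y : ℕ) (y' : ℕ) + i ((2 * (a * (y : ℕ) + b * (y' : ℕ)) : ℤ) : ZMod P) = x :=
        sub_add_cancel _ _
      rw [this]
      have h2 : ∀ l : (G → ℂ) × ℤ × ℤ, i ((2 * (l.2.1 * (y : ℕ) + l.2.2 * (y' : ℕ)) : ℤ) : ZMod P)
        = cl l.2 (y : ℕ) (y' : ℕ) := fun l => rfl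
      simp_rw [h2]
      ring
    unfold QQ
    calc _ = 𝔼 y : Fin M, 𝔼 y' : Fin M, 𝔼 x, F x * (((f, a, b) :: L).map fun l => l.1 (x + i ((2 * (l.2.1 * (y : ℕ) + l.2.2 * (y' : ℕ)) : ℤ) : ZMod P))).prod := by
          refine (E_comm _).trans ?_; congr 1; ext y; exact E_comm _
      _ = 𝔼 y : Fin M, 𝔼 y' : Fin M, 𝔼 x, f x * u x y y' := by simp_rw [this]
      _ = _ := by
          simp_rw [mul_expect]
          symm; refine (E_comm _).trans ?_; congr 1; ext y; exact E_comm _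
  have e2 : ‖QQ i M F ((f, a, b) :: L)‖ ≤ ‖𝔼 x, f x * 𝔼 t : Fin H, 𝔼 s : Fin H, 𝔼 y : Fin M, 𝔼 y' : Fin M, u x (y + t) (y' + s)‖ + 4 * H / M := by
    rw [e1]
    exact E_mul_diff (by positivity) hf fun x => shift2 hH (u x) (hu x)
  have e3 : 𝔼 x, f x * 𝔼 t : Fin H, 𝔼 s : Fin H, 𝔼 y : Fin M, 𝔼 y' : Fin M, u x (y + t) (y' + s)
     = 𝔼 p : G × Fin M × Fin M, f p.1 * 𝔼 τ : Fin H × Fin H, u p.1 (p.2.1 + τ.1) (p.2.2 + τ.2) := by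
    simp only [E_prod]
    congr 1; ext x
    have : 𝔼 t : Fin H, 𝔼 s : Fin H, 𝔼 y : Fin M, 𝔼 y' : Fin M, u x (y + t) (y' + s) =
      𝔼 y : Fin M, 𝔼 y' : Fin M, 𝔼 t : Fin H, 𝔼 s : Fin H, u x (y + t) (y' + s) := by
      have := E_comm (fun (p : Fin H × Fin H) (r : Fin M × Fin M) => u x (r.1 + p.1) (r.2 + p.2))
      simpa only [E_prod] using this
    rw [this, mul_expect]; congr 1; ext y; rw [mul_expect]
  have e4 := kill (a := fun p : G × Fin M × Fin M => f p.1)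
    (b := fun p (τ : Fin H × Fin H) => u p.1 (p.2.1 + τ.1) (p.2.2 + τ.2)) (fun p => hf _)
  have e5 : ‖𝔼 τ : Fin H × Fin H, 𝔼 τ' : Fin H × Fin H, 𝔼 p : G × Fin M × Fin M,
      u p.1 (p.2.1 + τ.1) (p.2.2 + τ.2) * conj (u p.1 (p.2.1 + τ'.1) (p.2.2 + τ'.2))‖
      ≤ (𝔼 τ, ‖QQ i M (Dl
        (i ((2 * (a * ((τ.2.1 : ℕ) - (τ.1.1 : ℕ)) + b * ((τ.2.2 : ℕ) - (τ.1.2 : ℕ))) : ℤ) : ZMod P)) F)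
          (L' τ)‖) := by
    rw [← E_prod (fun τ : (Fin H × Fin H) × (Fin H × Fin H) => 𝔼 p : G × Fin M × Fin M,
      u p.1 (p.2.1 + τ.1.1) (p.2.2 + τ.1.2) * conj (u p.1 (p.2.1 + τ.2.1) (p.2.2 + τ.2.2)))]
    refine (E_norm_le _).trans (le_of_eq ?_)
    congr 1; ext τ; congr 1
    unfold QQ
    have hcc : ∀ y y' : ℕ, 𝔼 x, u x (y + τ.1.1) (y' + τ.1.2) * conj (u x (y + τ.2.1) (y' + τ.2.2))
      = 𝔼 x, Dl
        (i ((2 * (a * ((τ.2.1 : ℕ) - (τ.1.1 : ℕ)) + b * ((τ.2.2 : ℕ) - (τ.1.2 : ℕ))) : ℤ) : ZMod P)) F x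
        * ((L' τ).map fun l => l.1 (x + i ((2 * (l.2.1 * (y : ℕ) + l.2.2 * (y' : ℕ)) : ℤ) : ZMod P))).prod := by
      intro y y'
      rw [← E_shift _ (c ((y : ℕ) + (τ.2.1 : ℕ)) ((y' : ℕ) + (τ.2.2 : ℕ)))]
      congr 1; ext x
      simp only [u, L', Dl, map_mul, List.map_map, Function.comp_def]
      have q1 : x + c ((y : ℕ) + (τ.2.1 : ℕ)) ((y' : ℕ) + (τ.2.2 : ℕ)) - c ((y + τ.1.1 : ℕ) : ℤ) ((y' + τ.1.2 : ℕ) : ℤ)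
         = x + i ((2 * (a * ((τ.2.1 : ℕ) - (τ.1.1 : ℕ)) + b * ((τ.2.2 : ℕ) - (τ.1.2 : ℕ))) : ℤ) : ZMod P) := by
        simp only [c]; rw [add_sub_assoc, ← map_sub, ← Int.cast_sub]; congr 3; push_cast; ring
      have q2 : x + c ((y : ℕ) + (τ.2.1 : ℕ)) ((y' : ℕ) + (τ.2.2 : ℕ)) - c ((y + τ.2.1 : ℕ) : ℤ) ((y' + τ.2.2 : ℕ) : ℤ) = x := by
        push_cast; exact add_sub_cancel_right _ _
      rw [q1, q2, ← mul_mul_mul_comm]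
      rw [prod_map_mul_conj]
      congr 2
      refine List.map_congr_left fun l _ => ?_
      congr 2
      · rw [← q1]; simp only [c, cl]
        congr 1
        simp only [add_sub_assoc, add_assoc]; congr 1
        simp only [← map_add, ← map_sub]; congr 1
        push_cast; ring
      · congr 1
        simp only [cl, add_assoc]; congr 1
        simp only [← map_add]; congr 1
        push_cast; ring
    simp only [E_prod]
    calc _ = 𝔼 y : Fin M, 𝔼 y' : Fin M, 𝔼 x, u x (y + τ.1.1) (y' + τ.1.2) * conj (u x (y + τ.2.1) (y' + τ.2.2)) := by
          refine (E_comm _).trans ?_; congr 1; ext y; exact E_comm _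
      _ = _ := by
          simp_rw [hcc]
          symm; refine (E_comm _).trans ?_; congr 1; ext y; exact E_comm _
  set A := ‖𝔼 x, f x * 𝔼 t : Fin H, 𝔼 s : Fin H, 𝔼 y : Fin M, 𝔼 y' : Fin M, u x (y + t) (y' + s)‖
  have hA1 : A ≤ 1 := E_norm_le_one fun x => norm_mul_le_one (hf x) <| E_norm_le_one fun t =>
    E_norm_le_one fun s => E_norm_le_one fun y => E_norm_le_one fun y' => hu _ _ _
  have hA0 : 0 ≤ A := norm_nonneg _
  have hB : 0 ≤ (H : ℝ) / M := by positivity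
  have e6 := e4.trans e5
  rw [← e3] at e6
  change A ^ 2 ≤ _ at e6
  have e7 : ‖QQ i M F ((f, a, b) :: L)‖ ^ 2 ≤ A ^ 2 + 12 * (H / M) := by
    rw [mul_div_assoc] at e2
    have := norm_nonneg (QQ i M F ((f, a, b) :: L))
    nlinarith
  linarith
end LemK
end
section
section
variable {G : Type} [AddCommGroup G] [Fintype G] {P : ℕ} [NeZero P]
lemma recB_nonneg (i : ZMod P →+ G) (H : ℕ) {B : (G → ℂ) → ℝ} (hB : ∀ F, 0 ≤ B F)
    (cs : List (ℤ × ℤ)) (F : G → ℂ) : 0 ≤ recB i H B cs F := by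
  induction cs generalizing F with
  | nil => exact hB F
  | cons c cs ih => exact E_nonneg fun τ => ih _
lemma recB_sq (i : ZMod P →+ G) (H : ℕ) {B B' : (G → ℂ) → ℝ} (hB : ∀ F, B F ^ 2 ≤ B' F)
    (cs : List (ℤ × ℤ)) (F : G → ℂ) : recB i H B cs F ^ 2 ≤ recB i H B' cs F := by
  induction cs generalizing F with
  | nil => exact hB F
  | cons c cs ih => exact (E_sq_le _).trans (E_mono fun τ => ih _)
lemma recB_append (i : ZMod P →+ G) (H : ℕ) (B : (G → ℂ) → ℝ) (cs ds : List (ℤ × ℤ)) (F : G → ℂ) :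
    recB i H B (cs ++ ds) F = recB i H (recB i H B ds) cs F := by
  induction cs generalizing F with
  | nil => rfl
  | cons c cs ih => simp only [List.cons_append, recB, ih]
lemma recB_mono (i : ZMod P →+ G) (H : ℕ) {B B' : (G → ℂ) → ℝ} (hB : ∀ F, B F ≤ B' F)
    (cs : List (ℤ × ℤ)) (F : G → ℂ) : recB i H B cs F ≤ recB i H B' cs F := by
  induction cs generalizing F with
  | nil => exact hB F
  | cons c cs ih => exact (E_mono fun τ => ih _)
lemma recB_const (i : ZMod P →+ G) (H : ℕ) (B : (G → ℂ) → ℝ) (w : ℝ)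
    (cs : List (ℤ × ℤ)) (F : G → ℂ) : recB i H (fun F => w * B F) cs F = w * recB i H B cs F := by
  induction cs generalizing F with
  | nil => rfl
  | cons c cs ih => simp only [recB, ih, mul_expect]
lemma lemK (m : ℕ) : ∃ D : ℝ, 1 ≤ D ∧ ∀ {G : Type} [AddCommGroup G] [Fintype G] {P : ℕ} [NeZero P]
    (i : ZMod P →+ G) (M H : ℕ), 0 < H → (H : ℝ) / M ≤ 1 → ∀ (F : G → ℂ) (L : List ((G → ℂ) × ℤ × ℤ)),
    L.length = m → (∀ x, ‖F x‖ ≤ 1) → (∀ l ∈ L, ∀ x, ‖l.1 x‖ ≤ 1) →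
    ‖QQ i M F L‖ ^ (2 ^ m) ≤ D * (recB i H (fun K => ‖𝔼 x, K x‖) (L.map Prod.snd) F + H / M) := by
  induction m with
  | zero =>
    refine ⟨1, le_rfl, ?_⟩
    intro G _ _ P _ i M H hH hM F L hL hF hL'
    have : L = [] := List.length_eq_zero_iff.1 hL
    subst this
    simp only [QQ, recB, List.map_nil, List.prod_nil, mul_one, pow_zero, pow_one, one_mul]
    have : ‖𝔼 x, 𝔼 _y : Fin M, 𝔼 _y' : Fin M, F x‖ ≤ ‖𝔼 x, F x‖ := by
      rcases Nat.eq_zero_or_pos M with rfl | hM0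
      · simp [Finset.univ_eq_empty]
      · haveI : NeZero M := ⟨hM0.ne'⟩
        simp_rw [E_const]; exact le_rfl
    have h2 : (0 : ℝ) ≤ H / M := by positivity
    linarith
  | succ m ih =>
    obtain ⟨D, hD, ih⟩ := ih
    refine ⟨24 ^ (2 ^ m) * (D + 1), ?_, ?_⟩
    · have : (1 : ℝ) ≤ 24 ^ (2 ^ m) := one_le_pow₀ (by norm_num)
      nlinarith
    intro G _ _ P _ i M H hH hM F L hL hF hL'
    obtain ⟨⟨f, a, b⟩, L, rfl⟩ : ∃ l L', L = l :: L' := List.exists_cons_of_length_eq_add_one hL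
    have hL1 : ∀ l ∈ L, ∀ x, ‖l.1 x‖ ≤ 1 := fun l hl => hL' l (by simp [hl])
    obtain ⟨L', h1, h2⟩ := QQ_step (M := M) (a := a) (b := b) i hH hF (hL' (f, a, b) (by simp)) hL1
    set Y := 𝔼 τ, ‖QQ i M (Dl
        (i ((2 * (a * ((τ.2.1 : ℕ) - (τ.1.1 : ℕ)) + b * ((τ.2.2 : ℕ) - (τ.1.2 : ℕ))) : ℤ) : ZMod P)) F)
          (L' τ)‖ with hY
    set ε : ℝ := H / M with hε
    have hε0 : 0 ≤ ε := by positivity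
    have hY0 : 0 ≤ Y := E_nonneg fun τ => norm_nonneg _
    have h3 : Y ^ (2 ^ m) ≤ D * (recB i H (fun K => ‖𝔼 x, K x‖) (((f, a, b) :: L).map Prod.snd) F + ε) := by
      refine (E_pow_le (fun τ => norm_nonneg _) m).trans ?_
      simp only [List.map_cons, recB]
      haveI : NeZero H := ⟨hH.ne'⟩
      rw [← E_const (ι := (Fin H × Fin H) × (Fin H × Fin H)) ε, ← expect_add_distrib, mul_expect]
      refine E_mono fun τ => ?_
      have := ih i M H hH hM (Dl
        (i ((2 * (a * ((τ.2.1 : ℕ) - (τ.1.1 : ℕ)) + b * ((τ.2.2 : ℕ) - (τ.1.2 : ℕ))) : ℤ) : ZMod P)) F)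
          (L' τ) (by
            have := congrArg List.length (h1 τ).1
            simp only [List.length_map] at this
            rw [this]; simpa using hL) (Dl_bdd hF _) (h1 τ).2
      rw [(h1 τ).1] at this
      exact this
    rw [pow_succ', pow_mul]
    set R := recB i H (fun K => ‖𝔼 x, K x‖) (((f, a, b) :: L).map Prod.snd) F
    have hR : 0 ≤ R := recB_nonneg i H (fun F => norm_nonneg _) _ _
    calc (‖QQ i M F ((f, a, b) :: L)‖ ^ 2) ^ 2 ^ m ≤ (Y + 12 * ε) ^ 2 ^ m :=
          pow_le_pow_left₀ (by positivity) h2 _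
      _ ≤ 2 ^ (2 ^ m - 1) * (Y ^ 2 ^ m + (12 * ε) ^ 2 ^ m) := add_pow_le hY0 (by positivity) _
      _ ≤ 2 ^ (2 ^ m) * (D * (R + ε) + 12 ^ 2 ^ m * ε) := by
          have : (12 * ε) ^ 2 ^ m ≤ 12 ^ 2 ^ m * ε := by
            rw [mul_pow]; gcongr
            exact pow_le_of_le_one hε0 hM (by positivity)
          gcongr
          · norm_num
          · exact Nat.sub_le _ _
      _ ≤ 2 ^ (2 ^ m) * (12 ^ 2 ^ m * (D * (R + ε)) + 12 ^ 2 ^ m * (R + ε)) := by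
          have : (1 : ℝ) ≤ 12 ^ (2 ^ m) := one_le_pow₀ (by norm_num)
          refine mul_le_mul_of_nonneg_left (add_le_add ?_ ?_) (by positivity)
          · exact le_mul_of_one_le_left (by positivity) this
          · exact mul_le_mul_of_nonneg_left (by linarith) (by positivity)
      _ = 24 ^ 2 ^ m * (D + 1) * (R + ε) := by
          rw [show (24 : ℝ) = 2 * 12 by norm_num, mul_pow]; ring
end
def Gd (H g : ℕ) (α β : ℤ) : Prop := (H : ℤ) ≤ |α| * g ∧ Int.gcd α β ≤ g
lemma card_congr_le {H m : ℕ} (hm : 0 < m) (S : Finset (Fin H))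
    (hS : ∀ s ∈ S, ∀ t ∈ S, (s : ℕ) ≡ t [MOD m]) : S.card ≤ H / m + 1 := by
  rw [← card_range (H / m + 1)]
  refine card_le_card_of_injOn (fun s => (s : ℕ) / m) ?_ ?_
  · intro s hs
    simp only [coe_range, Set.mem_Iio]
    exact Nat.lt_succ_of_le (Nat.div_le_div_right s.2.le)
  · intro s hs t ht hst
    have h1 : (s : ℕ) % m = t % m := hS s hs t ht
    have h2 : (s : ℕ) / m = t / m := hst
    apply Fin.ext
    rw [← Nat.div_add_mod (s : ℕ) m, ← Nat.div_add_mod (t : ℕ) m, h1, h2]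
lemma GL_count {H g P : ℕ} (hH : 0 < H) (hg : 0 < g) {α β : ℤ} (hα : |α| ≤ 4 * H) (hβ : |β| ≤ 4 * H)
    (hgd : Gd H g α β) (hP : 32 * H ^ 2 < P) (c : ℤ) (z : ZMod P) :
    (univ.filter fun p : Fin H × Fin H =>
      ((2 * (α * (p.1 : ℕ) + β * (p.2 : ℕ) - c) : ℤ) : ZMod P) = z).card ≤ 2 * g ^ 2 := by
  set S := univ.filter fun p : Fin H × Fin H =>
      ((2 * (α * (p.1 : ℕ) + β * (p.2 : ℕ) - c) : ℤ) : ZMod P) = z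
  have hα0 : α ≠ 0 := by
    rintro rfl
    have := hgd.1; simp at this; omega
  have key : ∀ p ∈ S, ∀ p' ∈ S, α * ((p.1 : ℕ) - (p'.1 : ℕ)) = β * ((p'.2 : ℕ) - (p.2 : ℕ)) := by
    intro p hp p' hp'
    have h1 := (mem_filter.1 hp).2.trans (mem_filter.1 hp').2.symm
    rw [ZMod.intCast_eq_intCast_iff_dvd_sub] at h1
    set w := 2 * (α * (p'.1 : ℕ) + β * (p'.2 : ℕ) - c) - 2 * (α * (p.1 : ℕ) + β * (p.2 : ℕ) - c) with hw
    have hw2 : |w| < P := by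
      have e : w = 2 * (α * ((p'.1 : ℕ) - (p.1 : ℕ)) + β * ((p'.2 : ℕ) - (p.2 : ℕ))) := by
        rw [hw]; ring
      have b1 : |((p'.1 : ℕ) : ℤ) - (p.1 : ℕ)| ≤ H := by
        have := p'.1.2; have := p.1.2; rw [abs_le]; omega
      have b2 : |((p'.2 : ℕ) : ℤ) - (p.2 : ℕ)| ≤ H := by
        have := p'.2.2; have := p.2.2; rw [abs_le]; omega
      have c1 : |α * (((p'.1 : ℕ) : ℤ) - (p.1 : ℕ))| ≤ 4 * H * H := by
        rw [abs_mul]; gcongr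
      have c2 : |β * (((p'.2 : ℕ) : ℤ) - (p.2 : ℕ))| ≤ 4 * H * H := by
        rw [abs_mul]; gcongr
      rw [e, abs_mul]
      have := abs_add_le (α * (((p'.1 : ℕ) : ℤ) - (p.1 : ℕ))) (β * (((p'.2 : ℕ) : ℤ) - (p.2 : ℕ)))
      have hP' : (32 * H ^ 2 : ℤ) < P := by exact_mod_cast hP
      simp only [abs_two]
      nlinarith
    have := Int.eq_zero_of_abs_lt_dvd h1 hw2
    rw [hw] at this; linarith
  set m := α.natAbs / Int.gcd α β with hm
  have hgpos : 0 < Int.gcd α β := Int.gcd_pos_of_ne_zero_left _ hα0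
  have hgdvd : Int.gcd α β ∣ α.natAbs := Int.natCast_dvd_natCast.1 (by simpa using Int.gcd_dvd_left α β)
  have hmpos : 0 < m := Nat.div_pos (Nat.le_of_dvd (Int.natAbs_pos.2 hα0) hgdvd) hgpos
  have hmul : m * Int.gcd α β = α.natAbs := Nat.div_mul_cancel hgdvd
  have hSc : S.card = (S.image Prod.snd).card := by
    symm; apply card_image_of_injOn
    intro p hp p' hp' h
    have h2 := key p hp p' hp'
    have h : p.2 = p'.2 := h
    rw [h, sub_self, mul_zero, mul_eq_zero] at h2
    have h3 : ((p.1 : ℕ) : ℤ) = (p'.1 : ℕ) := by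
      have := h2.resolve_left hα0; linarith
    exact Prod.ext (Fin.ext (by exact_mod_cast h3)) h
  rw [hSc]
  refine (card_congr_le hmpos _ ?_).trans ?_
  · intro s hs t ht
    obtain ⟨p, hp, rfl⟩ := mem_image.1 hs
    obtain ⟨p', hp', rfl⟩ := mem_image.1 ht
    have h2 := key p hp p' hp'
    rw [Nat.modEq_iff_dvd]
    have d1 : α ∣ β * (((p'.2 : ℕ) : ℤ) - (p.2 : ℕ)) := ⟨_, h2.symm⟩
    have d2 : (m : ℤ) ∣ α / (Int.gcd α β : ℤ) := by
      rw [hm, Int.natCast_dvd, Int.natAbs_ediv_of_dvd (Int.gcd_dvd_left _ _)]; simp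
    have d3 : α / (Int.gcd α β : ℤ) ∣ (β / (Int.gcd α β : ℤ)) * (((p'.2 : ℕ) : ℤ) - (p.2 : ℕ)) := by
      have e1 : α = Int.gcd α β * (α / (Int.gcd α β : ℤ)) := (Int.mul_ediv_cancel' (Int.gcd_dvd_left α β)).symm
      have e2 : β = Int.gcd α β * (β / (Int.gcd α β : ℤ)) := (Int.mul_ediv_cancel' (Int.gcd_dvd_right α β)).symm
      have e3 : ((Int.gcd α β : ℕ) : ℤ) ≠ 0 := by exact_mod_cast hgpos.ne'
      have : (Int.gcd α β : ℤ) * (α / (Int.gcd α β : ℤ)) ∣ Int.gcd α β * ((β / (Int.gcd α β : ℤ)) * (((p'.2 : ℕ) : ℤ) - (p.2 : ℕ))) := by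
        rw [← mul_assoc, ← e1, ← e2]; exact d1
      exact (mul_dvd_mul_iff_left e3).1 this
    have cop : IsCoprime (α / (Int.gcd α β : ℤ)) (β / (Int.gcd α β : ℤ)) := by
      rw [Int.isCoprime_iff_gcd_eq_one]; exact Int.gcd_ediv_gcd_ediv_gcd hgpos
    exact d2.trans (cop.dvd_of_dvd_mul_left d3)
  · have h1 : H ≤ α.natAbs * g := by
      have := hgd.1; rw [Int.abs_eq_natAbs] at this; exact_mod_cast this
    have h2 : H / m ≤ g ^ 2 := by
      apply Nat.div_le_of_le_mul
      calc H ≤ m * Int.gcd α β * g := by rw [hmul]; exact h1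
        _ ≤ m * g * g := by gcongr; exact hgd.2
        _ = m * g ^ 2 := by ring
    have : 1 ≤ g ^ 2 := Nat.one_le_pow _ _ hg
    omega
lemma GLem {H g P : ℕ} [NeZero P] (hH : 0 < H) (hg : 0 < g) {α β : ℤ} (hα : |α| ≤ 4 * H) (hβ : |β| ≤ 4 * H)
    (hgd : Gd H g α β) (hP : 32 * H ^ 2 < P) (A : ZMod P → ℝ) (hA : ∀ z, 0 ≤ A z) :
    𝔼 τ : (Fin H × Fin H) × (Fin H × Fin H),
      A ((2 * (α * ((τ.2.1 : ℕ) - (τ.1.1 : ℕ)) + β * ((τ.2.2 : ℕ) - (τ.1.2 : ℕ))) : ℤ) : ZMod P)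
    ≤ (2 * g ^ 2 * P / H ^ 2 : ℝ) * 𝔼 z, A z := by
  rw [E_prod]
  refine E_le_const (mul_nonneg (by positivity) (E_nonneg hA)) fun τ0 => ?_
  set c : ℤ := α * (τ0.1 : ℕ) + β * (τ0.2 : ℕ) with hc
  have e1 : ∀ p : Fin H × Fin H, A ((2 * (α * ((p.1 : ℕ) - (τ0.1 : ℕ)) + β * ((p.2 : ℕ) - (τ0.2 : ℕ))) : ℤ) : ZMod P)
     = A ((2 * (α * (p.1 : ℕ) + β * (p.2 : ℕ) - c) : ℤ) : ZMod P) := by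
    intro p; congr 2; rw [hc]; ring
  simp only [e1]
  rw [Fintype.expect_eq_sum_div_card, Fintype.expect_eq_sum_div_card]
  simp only [Fintype.card_prod, Fintype.card_fin, ZMod.card]
  have hP0 : (P : ℝ) ≠ 0 := by exact_mod_cast NeZero.ne P
  have e2 : (2 * g ^ 2 * P / H ^ 2 : ℝ) * ((∑ z, A z) / P) = (2 * g ^ 2 * ∑ z, A z) / (H * H) := by
    field_simp
  rw [e2]
  rw [Nat.cast_mul]
  gcongr
  rw [← sum_fiberwise_of_maps_to (s := univ) (t := univ)
    (g := fun p : Fin H × Fin H => ((2 * (α * (p.1 : ℕ) + β * (p.2 : ℕ) - c) : ℤ) : ZMod P)) (fun _ _ => mem_univ _)]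
  rw [mul_sum]
  refine sum_le_sum fun z _ => ?_
  rw [sum_congr rfl (g := fun _ => A z) (fun p hp => by rw [(mem_filter.1 hp).2]), sum_const, nsmul_eq_mul]
  have := GL_count hH hg hα hβ hgd hP c z
  gcongr
  · exact hA z
  · exact_mod_cast this
end
section
section BP
open Classical
lemma card_dvd_le {H m : ℕ} (hm : 0 < m) (u : ℤ) :
    (univ.filter fun a : Fin H => (m : ℤ) ∣ (a : ℕ) + u).card ≤ H / m + 1 := by
  refine card_congr_le hm _ fun s hs t ht => ?_
  rw [Nat.modEq_iff_dvd]
  have := dvd_sub (mem_filter.1 ht).2 (mem_filter.1 hs).2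
  simpa using this
lemma card_small_le {H g : ℕ} (hg : 0 < g) (u : ℤ) :
    (univ.filter fun a : Fin H => |((a : ℕ) : ℤ) + u| * g < H).card ≤ 2 * (H / g) + 1 := by
  have : (Icc (-((H / g : ℕ) : ℤ)) ((H / g : ℕ) : ℤ)).card = 2 * (H / g) + 1 := by
    rw [Int.card_Icc]; omega
  rw [← this]
  refine card_le_card_of_injOn (fun a => ((a : ℕ) : ℤ) + u) ?_ ?_
  · intro a ha
    have h := (mem_filter.1 ha).2
    simp only [coe_Icc, Set.mem_Icc]
    rw [← abs_le]
    have h2 : ((((a : ℕ) : ℤ) + u).natAbs * g : ℕ) < H := by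
      rw [Int.abs_eq_natAbs] at h; exact_mod_cast h
    rw [Int.abs_eq_natAbs]
    exact_mod_cast (Nat.le_div_iff_mul_le hg).2 h2.le
  · intro a _ b _ h
    have h : ((a : ℕ) : ℤ) + u = (b : ℕ) + u := h
    apply Fin.ext; omega
lemma BP {H g : ℕ} (hg : 0 < g) (hgH : g ≤ H) {u v : ℤ} (hu : |u| ≤ 3 * H) :
    𝔼 a : Fin H, 𝔼 b : Fin H, (if Gd H g ((a : ℕ) + u) ((b : ℕ) + v) then (0 : ℝ) else 1) ≤ 28 / g := by
  have hH : 0 < H := lt_of_lt_of_le hg hgH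
  have hHr : (0 : ℝ) < H := by exact_mod_cast hH
  have hgr : (0 : ℝ) < g := by exact_mod_cast hg
  have h1 : ∀ a b : Fin H, (if Gd H g ((a : ℕ) + u) ((b : ℕ) + v) then (0 : ℝ) else 1) ≤
      (if |((a : ℕ) : ℤ) + u| * g < H then 1 else 0) +
      ∑ e ∈ Ioc g (4 * H), (if (e : ℤ) ∣ (a : ℕ) + u then (1 : ℝ) else 0) * (if (e : ℤ) ∣ (b : ℕ) + v then (1 : ℝ) else 0) := by
    intro a b
    have hn : 0 ≤ ∑ e ∈ Ioc g (4 * H), (if (e : ℤ) ∣ (a : ℕ) + u then (1 : ℝ) else 0) * (if (e : ℤ) ∣ (b : ℕ) + v then (1 : ℝ) else 0) :=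
      sum_nonneg fun e _ => by positivity
    by_cases h : Gd H g ((a : ℕ) + u) ((b : ℕ) + v)
    · rw [if_pos h]; positivity
    rw [if_neg h]
    by_cases h2 : |((a : ℕ) : ℤ) + u| * g < H
    · rw [if_pos h2]; linarith
    rw [if_neg h2, zero_add]
    have h3 : ¬ Int.gcd ((a : ℕ) + u) ((b : ℕ) + v) ≤ g := fun h3 => h ⟨not_lt.1 h2, h3⟩
    set e := Int.gcd ((a : ℕ) + u) ((b : ℕ) + v) with he
    have ha0 : ((a : ℕ) : ℤ) + u ≠ 0 := by
      intro h4; rw [h4] at h2; simp at h2; omega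
    have d1 : (e : ℤ) ∣ (a : ℕ) + u := Int.gcd_dvd_left _ _
    have d2 : (e : ℤ) ∣ (b : ℕ) + v := Int.gcd_dvd_right _ _
    have he4 : e ≤ 4 * H := by
      have := Int.le_of_dvd (abs_pos.2 ha0) ((dvd_abs _ _).2 d1)
      have h5 := abs_add_le ((a : ℕ) : ℤ) u
      have := a.2
      rw [abs_of_nonneg (by positivity : (0 : ℤ) ≤ ((a : ℕ) : ℤ))] at h5
      omega
    have := single_le_sum (f := fun e : ℕ => (if (e : ℤ) ∣ (a : ℕ) + u then (1 : ℝ) else 0) * (if (e : ℤ) ∣ (b : ℕ) + v then (1 : ℝ) else 0))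
      (fun e _ => by positivity) (mem_Ioc.2 ⟨not_le.1 h3, he4⟩)
    simp only [d1, d2, if_true, mul_one] at this
    exact this
  refine (E_mono fun a => E_mono fun b => h1 a b).trans ?_
  haveI : NeZero H := ⟨hH.ne'⟩
  simp_rw [expect_add_distrib, E_const]
  have e1 : 𝔼 a : Fin H, (if |((a : ℕ) : ℤ) + u| * g < H then (1 : ℝ) else 0) ≤ 3 / g := by
    rw [Fintype.expect_eq_sum_div_card, ← sum_filter, sum_const, nsmul_eq_mul, mul_one, Fintype.card_fin]
    have := card_small_le (H := H) hg u
    have h2 : ((H / g : ℕ) : ℝ) ≤ H / g := Nat.cast_div_le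
    have h3 : (1 : ℝ) ≤ H / g := (one_le_div hgr).2 (by exact_mod_cast hgH)
    rw [div_le_iff₀ hHr]
    have h4 : ((univ.filter fun a : Fin H => |((a : ℕ) : ℤ) + u| * g < H).card : ℝ) ≤ 2 * (H / g : ℕ) + 1 := by
      exact_mod_cast this
    have : (3 : ℝ) / g * H = 3 * (H / g) := by ring
    rw [this]; linarith
  have e2 : ∀ e ∈ Ioc g (4 * H), ∀ w : ℤ, 𝔼 a : Fin H, (if (e : ℤ) ∣ (a : ℕ) + w then (1 : ℝ) else 0) ≤ 5 / e := by
    intro e he w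
    rw [mem_Ioc] at he
    have hepos : 0 < e := by omega
    have her : (0 : ℝ) < e := by exact_mod_cast hepos
    rw [Fintype.expect_eq_sum_div_card, ← sum_filter, sum_const, nsmul_eq_mul, mul_one, Fintype.card_fin]
    have h4 : ((univ.filter fun a : Fin H => (e : ℤ) ∣ (a : ℕ) + w).card : ℝ) ≤ (H / e : ℕ) + 1 := by
      exact_mod_cast card_dvd_le hepos w
    have h2 : ((H / e : ℕ) : ℝ) ≤ H / e := Nat.cast_div_le
    have h3 : (1 : ℝ) ≤ 4 * H / e := (one_le_div her).2 (by exact_mod_cast he.2)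
    rw [div_le_iff₀ hHr]
    have : (5 : ℝ) / e * H = H / e + 4 * H / e := by ring
    rw [this]; linarith
  have e3 : 𝔼 a : Fin H, 𝔼 b : Fin H, ∑ e ∈ Ioc g (4 * H), (if (e : ℤ) ∣ (a : ℕ) + u then (1 : ℝ) else 0) * (if (e : ℤ) ∣ (b : ℕ) + v then (1 : ℝ) else 0)
     ≤ 25 / g := by
    have : 𝔼 a : Fin H, 𝔼 b : Fin H, ∑ e ∈ Ioc g (4 * H), (if (e : ℤ) ∣ (a : ℕ) + u then (1 : ℝ) else 0) * (if (e : ℤ) ∣ (b : ℕ) + v then (1 : ℝ) else 0)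
      = ∑ e ∈ Ioc g (4 * H), (𝔼 a : Fin H, (if (e : ℤ) ∣ (a : ℕ) + u then (1 : ℝ) else 0)) * 𝔼 b : Fin H, (if (e : ℤ) ∣ (b : ℕ) + v then (1 : ℝ) else 0) := by
      simp_rw [expect_sum_comm, ← mul_expect, ← expect_mul]
    rw [this]
    calc _ ≤ ∑ e ∈ Ioc g (4 * H), 25 * ((e : ℝ) ^ 2)⁻¹ := by
          refine sum_le_sum fun e he => ?_
          have := mul_le_mul (e2 e he u) (e2 e he v) (E_nonneg fun b => by positivity) (by positivity)
          refine this.trans (le_of_eq ?_)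
          rw [div_mul_div_comm]; ring
      _ ≤ 25 * ((g : ℝ)⁻¹ - ((4 * H : ℕ) : ℝ)⁻¹) := by
          rw [← mul_sum]
          exact mul_le_mul_of_nonneg_left (sum_Ioc_inv_sq_le_sub hg.ne' (by omega)) (by norm_num)
      _ ≤ 25 / g := by
          have : (0 : ℝ) ≤ ((4 * H : ℕ) : ℝ)⁻¹ := by positivity
          rw [div_eq_mul_inv]; linarith
  have : (28 : ℝ) / g = 3 / g + 25 / g := by ring
  rw [this]
  exact add_le_add e1 e3
end BP
section
variable {G : Type} [AddCommGroup G] [Fintype G] {P : ℕ} [NeZero P]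
lemma recB_good {H g : ℕ} (hH : 0 < H) (hg : 0 < g) (hP : 32 * H ^ 2 < P) (i : ZMod P →+ G) (s : ℕ)
    (cs : List (ℤ × ℤ)) (hcs : ∀ c ∈ cs, |c.1| ≤ 4 * H ∧ |c.2| ≤ 4 * H ∧ Gd H g c.1 c.2) (F : G → ℂ) :
    recB i H (V i s) cs F ≤ (2 * g ^ 2 * P / H ^ 2 : ℝ) ^ cs.length * V i (s + cs.length) F := by
  induction cs generalizing F with
  | nil => simp [recB]
  | cons c cs ih =>
    obtain ⟨h1, h2, h3⟩ := hcs c (by simp)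
    have := GLem hH hg h1 h2 h3 hP (fun z => recB i H (V i s) cs (Dl (i z) F))
      (fun z => recB_nonneg i H (V_nonneg i s) _ _)
    refine this.trans ?_
    have h4 : 𝔼 z, recB i H (V i s) cs (Dl (i z) F) ≤
        (2 * g ^ 2 * P / H ^ 2 : ℝ) ^ cs.length * V i (s + cs.length + 1) F := by
      simp only [V, mul_expect]
      exact E_mono fun z => ih (fun c hc => hcs c (by simp [hc])) _
    refine (mul_le_mul_of_nonneg_left h4 (by positivity)).trans (le_of_eq ?_)
    rw [List.length_cons, ← add_assoc]; ring
lemma recB_translate (i : ZMod P →+ G) (H s : ℕ) (cs : List (ℤ × ℤ)) (F : G → ℂ) (t : G) :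
    recB i H (V i s) cs (fun x => F (x + t)) = recB i H (V i s) cs F := by
  induction cs generalizing F with
  | nil => exact V_translate i s F t
  | cons c cs ih =>
    simp only [recB]
    congr 1; ext τ
    refine Eq.trans ?_ (ih _)
    congr 1; ext x; simp only [Dl]; rw [add_right_comm]
open Classical in
lemma stepA5 {H g : ℕ} (hg : 0 < g) (hgH : g ≤ H) (hP : 32 * H ^ 2 < P) (i : ZMod P →+ G) (s : ℕ)
    {D : G → ℂ} (hD : ∀ x, ‖D x‖ ≤ 1) :
    (𝔼 p : Fin H × Fin H, recB i H (V i s) [(((p.1 : ℕ) : ℤ) - (p.2 : ℕ), 0)] D) ^ 2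
      ≤ (2 * g ^ 2 * P / H ^ 2 : ℝ) * V i (s + 1) D + 28 / g := by
  have hH : 0 < H := lt_of_lt_of_le hg hgH
  haveI : NeZero H := ⟨hH.ne'⟩
  set Wc := (2 * g ^ 2 * P / H ^ 2 : ℝ)
  have hW : 0 ≤ Wc := by positivity
  let e : (Fin H × Fin H) × ((Fin H × Fin H) × (Fin H × Fin H)) → ℤ := fun j =>
    2 * ((((j.1.1 : ℕ) : ℤ) - (j.1.2 : ℕ)) * ((j.2.2.1 : ℕ) - (j.2.1.1 : ℕ)) + 0 * ((j.2.2.2 : ℕ) - (j.2.1.2 : ℕ)))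
  have h0 : (𝔼 p : Fin H × Fin H, recB i H (V i s) [(((p.1 : ℕ) : ℤ) - (p.2 : ℕ), 0)] D)
      = 𝔼 j, V i s (Dl (i (e j : ZMod P)) D) := by
    exact (E_prod (fun j => V i s (Dl (i (e j : ZMod P)) D))).symm
  rw [h0]
  refine (V_C1 i s hD fun j => i (e j : ZMod P)).trans ?_
  have h1 : 𝔼 j, 𝔼 j', V i s (Dl (i (e j : ZMod P) - i (e j' : ZMod P)) D) =
      𝔼 p : Fin H × Fin H, 𝔼 p' : Fin H × Fin H, 𝔼 τ2 : Fin H × Fin H, 𝔼 τ2' : Fin H × Fin H,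
      𝔼 τ : (Fin H × Fin H) × (Fin H × Fin H), V i s (Dl (i ((2 *
        ((((p.1 : ℕ) : ℤ) - (p.2 : ℕ)) * ((τ.2.1 : ℕ) - (τ.1.1 : ℕ)) +
          (((p'.2 : ℕ) : ℤ) - (p'.1 : ℕ)) * ((τ.2.2 : ℕ) - (τ.1.2 : ℕ))) : ℤ) : ZMod P)) D) := by
    have : ∀ j j', V i s (Dl (i (e j : ZMod P) - i (e j' : ZMod P)) D) =
      V i s (Dl (i ((2 * ((((j.1.1 : ℕ) : ℤ) - (j.1.2 : ℕ)) * ((j.2.2.1 : ℕ) - (j.2.1.1 : ℕ)) +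
          (((j'.1.2 : ℕ) : ℤ) - (j'.1.1 : ℕ)) * ((j'.2.2.1 : ℕ) - (j'.2.1.1 : ℕ))) : ℤ) : ZMod P)) D) := by
      intro j j'
      rw [← map_sub, ← Int.cast_sub]; congr 5; simp only [e]; ring
    simp_rw [this]
    have hc : ∀ A : Fin H → Fin H → Fin H → Fin H → ℝ,
       𝔼 a : Fin H, 𝔼 _b : Fin H, 𝔼 c : Fin H, 𝔼 _d : Fin H, 𝔼 a' : Fin H, 𝔼 _b' : Fin H, 𝔼 c' : Fin H, 𝔼 _d' : Fin H, A a c a' c'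
        = 𝔼 a : Fin H, 𝔼 a' : Fin H, 𝔼 c : Fin H, 𝔼 c' : Fin H, A a c a' c' := by
      intro A
      simp only [E_const]
      congr 1; ext a; exact E_comm _
    simp only [E_prod]
    refine congrArg _ (funext fun p1 => congrArg _ (funext fun p2 => ?_))
    simp only [E_const]
    have h3 := E_comm (fun (q : Fin H × Fin H) (q' : Fin H × Fin H) => 𝔼 c : Fin H, 𝔼 c' : Fin H,
      V i s (Dl (i ((2 * ((((p1 : ℕ) : ℤ) - (p2 : ℕ)) * ((q.2 : ℕ) - (q.1 : ℕ)) +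
          (((q'.2 : ℕ) : ℤ) - (q'.1 : ℕ)) * ((c' : ℕ) - (c : ℕ))) : ℤ) : ZMod P)) D))
    simp only [E_prod] at h3
    refine h3.trans ?_
    refine congrArg _ (funext fun p1 => congrArg _ (funext fun p2 => ?_))
    refine congrArg _ (funext fun p1 => ?_)
    exact E_comm _
  rw [h1]
  have h2 : ∀ p p' : Fin H × Fin H, 𝔼 _τ2 : Fin H × Fin H, 𝔼 _τ2' : Fin H × Fin H,
      𝔼 τ : (Fin H × Fin H) × (Fin H × Fin H), V i s (Dl (i ((2 *
        ((((p.1 : ℕ) : ℤ) - (p.2 : ℕ)) * ((τ.2.1 : ℕ) - (τ.1.1 : ℕ)) +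
          (((p'.2 : ℕ) : ℤ) - (p'.1 : ℕ)) * ((τ.2.2 : ℕ) - (τ.1.2 : ℕ))) : ℤ) : ZMod P)) D)
      ≤ Wc * V i (s + 1) D + if Gd H g (((p.1 : ℕ) : ℤ) + -(p.2 : ℕ)) (((p'.2 : ℕ) : ℤ) + -(p'.1 : ℕ)) then (0 : ℝ) else 1 := by
    intro p p'
    simp only [E_const]
    have hb : ∀ a b : Fin H, |((a : ℕ) : ℤ) - (b : ℕ)| ≤ 4 * H := by
      intro a b; have := a.2; have := b.2; rw [abs_le]; omega
    split_ifs with h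
    · rw [add_zero]
      exact GLem hH hg (hb _ _) (hb _ _) h hP (fun z => V i s (Dl (i z) D)) (fun z => V_nonneg i s _)
    · have := mul_nonneg hW (V_nonneg i (s + 1) D)
      refine le_trans (E_le_const zero_le_one fun τ => V_le_one i s (Dl_bdd hD _)) (by linarith)
  refine (E_mono fun p => E_mono fun p' => h2 p p').trans ?_
  simp_rw [expect_add_distrib, E_const]
  gcongr
  simp only [E_prod]
  calc _ = 𝔼 p2 : Fin H, 𝔼 p1' : Fin H, 𝔼 p1 : Fin H, 𝔼 p2' : Fin H, (if Gd H g (((p1 : ℕ) : ℤ) + -(p2 : ℕ)) (((p2' : ℕ) : ℤ) + -(p1' : ℕ)) then (0 : ℝ) else 1) := by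
        refine (E_comm _).trans ?_
        congr 1; ext p2; exact E_comm _
    _ ≤ 28 / g := by
        refine E_le_const (by positivity) fun p2 => E_le_const (by positivity) fun p1' => ?_
        refine BP hg hgH ?_
        have := p2.2
        rw [abs_neg, abs_of_nonneg (by positivity)]; omega
end
end
section
section
variable {G : Type} [AddCommGroup G] [Fintype G] {P : ℕ} [NeZero P]
abbrev H4 (H : ℕ) := (Fin H × Fin H) × (Fin H × Fin H)
def kk {H : ℕ} (p : H4 H) : ℤ := (p.1.2 : ℕ) - (p.1.1 : ℕ)
def hh {H : ℕ} (p : H4 H) : ℤ := (p.2.2 : ℕ) - (p.2.1 : ℕ)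
lemma thA1 (i : ZMod P →+ G) (g : G) {M H : ℕ} (hH : 0 < H) {f0 f1 F : G → ℂ} (h0 : ∀ x, ‖f0 x‖ ≤ 1)
    (h1 : ∀ x, ‖f1 x‖ ≤ 1) (hF : ∀ x, ‖F x‖ ≤ 1) {δ : ℝ} (hδ : 0 < δ) (hδ1 : δ ≤ 1)
    (hHM : 2 * (H : ℝ) / M ≤ δ ^ 2 / 8)
    (h : δ ≤ ‖𝔼 x, 𝔼 y : Fin M, f0 x * f1 (x + ((y : ℕ) + 1) • g) * F (x + i ((((y : ℕ) : ZMod P) + 1) ^ 2))‖) :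
    ∃ c2 c3 c4 : H4 H → G, δ ^ 4 / 64 ≤ ‖𝔼 x, F x * 𝔼 j : H4 H × Fin M,
      conj (F (x + c2 j.1 + i ((2 * (hh j.1 * (j.2 : ℕ)) : ℤ) : ZMod P))) *
      conj (F (x + c3 j.1 + i ((2 * (kk j.1 * (j.2 : ℕ)) : ℤ) : ZMod P))) *
      F (x + c4 j.1 + i ((2 * ((hh j.1 + kk j.1) * (j.2 : ℕ)) : ℤ) : ZMod P))‖ := by
  let u : G → ℕ → ℂ := fun x y => f1 (x + (y + 1) • g) * F (x + i (((y : ZMod P) + 1) ^ 2))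
  have a1 := shift_kill (I := G) (M := M) (H := H) hH (a := f0) (u := u) (δ := δ) h0
    (fun x y => norm_mul_le_one (h1 _) (hF _)) hδ.le (by
      refine h.trans (le_of_eq ?_)
      congr 2; ext x; rw [mul_expect]; congr 1; ext y; simp only [u, mul_assoc]) (by nlinarith)
  let pt : ℕ → ℕ → G := fun y s => - ((y + 1) • g) + i (((y : ZMod P) + s + 1) ^ 2)
  let u2 : (Fin H × Fin H) × G → ℕ → ℂ := fun q y =>
    F (q.2 + pt y q.1.1) * conj (F (q.2 + pt y q.1.2))
  have a2 := shift_kill (I := (Fin H × Fin H) × G) (M := M) (H := H) hH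
    (a := fun q => f1 (q.2 + (q.1.1 : ℕ) • g) * conj (f1 (q.2 + (q.1.2 : ℕ) • g))) (u := u2) (δ := δ ^ 2 / 4)
    (fun q => norm_mul_le_one (h1 _) (by simpa using h1 _))
    (fun q y => norm_mul_le_one (hF _) (by simpa using hF _)) (by positivity) (by
      refine a1.trans (le_of_eq ?_)
      congr 1
      simp only [E_prod]
      refine congrArg _ (funext fun s => congrArg _ (funext fun s' => ?_))
      simp only [mul_expect]
      refine (E_comm _).trans (Eq.trans ?_ (E_comm _))
      refine congrArg _ (funext fun y => ?_)
      rw [← E_shift_sub _ (((y : ℕ) + 1) • g)]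
      refine congrArg _ (funext fun x => ?_)
      simp only [u, u2, pt, map_mul]
      have q1 : ∀ s : ℕ, x - ((y : ℕ) + 1) • g + ((y : ℕ) + s + 1) • g = x + s • g := by
        intro s; simp only [add_smul]; abel
      have q2 : ∀ s : ℕ, x - ((y : ℕ) + 1) • g + i ((((y + s : ℕ) : ZMod P) + 1) ^ 2) =
          x + (-(((y : ℕ) + 1) • g) + i ((((y : ℕ) : ZMod P) + s + 1) ^ 2)) := by
        intro s; push_cast; abel
      rw [q1, q1, q2, q2]; ring) (by linarith)
  let c2 : H4 H → G := fun p => i ((hh p * (2 * (p.1.1 : ℕ) + (p.2.1 : ℕ) + (p.2.2 : ℕ) + 2) : ℤ) : ZMod P)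
  let c3 : H4 H → G := fun p => -(kk p • g) +
    i ((kk p * ((p.1.1 : ℕ) + (p.1.2 : ℕ) + 2 * (p.2.1 : ℕ) + 2) : ℤ) : ZMod P)
  let c4 : H4 H → G := fun p => -(kk p • g) +
    i (((hh p + kk p) * ((p.1.1 : ℕ) + (p.1.2 : ℕ) + (p.2.1 : ℕ) + (p.2.2 : ℕ) + 2) : ℤ) : ZMod P)
  refine ⟨c2, c3, c4, ?_⟩
  have e0 : (δ ^ 2 / 4) ^ 2 / 4 = δ ^ 4 / 64 := by ring
  rw [e0] at a2
  refine a2.trans (le_of_eq ?_)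
  congr 1
  simp only [mul_expect]
  refine Eq.trans ?_ (E_comm _)
  simp only [E_prod]
  refine congrArg _ (funext fun k => congrArg _ (funext fun k' => ?_))
  refine congrArg _ (funext fun s => congrArg _ (funext fun s' => ?_))
  refine (E_comm _).trans ?_
  refine congrArg _ (funext fun y => ?_)
  rw [← E_shift_sub _ (pt (y + k) s)]
  refine congrArg _ (funext fun x => ?_)
  simp only [u2, map_mul, Complex.conj_conj]
  have w2 : x - pt (y + k) s + pt (y + k) s' = x + c2 ((k, k'), (s, s')) + i ((2 * (hh ((k, k'), (s, s')) * (y : ℕ)) : ℤ) : ZMod P) := by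
    simp only [pt, c2, hh]
    rw [add_assoc x, ← map_add]
    rw [show ∀ a b c : G, x - (a + b) + (a + c) = x + (c - b) by intros; abel, ← map_sub]
    congr 2; push_cast; ring
  have g1 : -((((y + k' : ℕ) + 1 : ℕ)) • g) = -((((y + k : ℕ) + 1 : ℕ)) • g) + -(kk ((k, k'), (s, s')) • g) := by
    simp only [kk]
    rw [← natCast_zsmul, ← natCast_zsmul, ← neg_smul, ← neg_smul, ← neg_smul, ← add_smul]
    congr 1; push_cast; ring
  have w3 : x - pt (y + k) s + pt (y + k') s = x + c3 ((k, k'), (s, s')) + i ((2 * (kk ((k, k'), (s, s')) * (y : ℕ)) : ℤ) : ZMod P) := by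
    simp only [pt, c3]
    rw [g1, show ∀ a b c d : G, x - (a + b) + (a + d + c) = x + (d + (c - b)) by intros; abel, ← map_sub, add_assoc x, add_assoc (-_), ← map_add]
    congr 3; simp only [kk]; push_cast; ring
  have w4 : x - pt (y + k) s + pt (y + k') s' = x + c4 ((k, k'), (s, s')) + i ((2 * ((hh ((k, k'), (s, s')) + kk ((k, k'), (s, s'))) * (y : ℕ)) : ℤ) : ZMod P) := by
    simp only [pt, c4]
    rw [g1, show ∀ a b c d : G, x - (a + b) + (a + d + c) = x + (d + (c - b)) by intros; abel, ← map_sub, add_assoc x, add_assoc (-_), ← map_add]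
    congr 3; simp only [kk, hh]; push_cast; ring
  rw [w2, w3, w4, sub_add_cancel]
  ring
def LL (c2 c3 c4 : G) (F : G → ℂ) (h κ : ℤ) (d2 d3 d4 : G) (h' κ' : ℤ) : List ((G → ℂ) × ℤ × ℤ) :=
  [(fun x => conj (F (x + c2)), -κ, 0), (fun x => conj (F (x + c3)), -h, 0),
   (fun x => F (x + d2), -(h + κ), h'), (fun x => F (x + d3), -(h + κ), κ'),
   (fun x => conj (F (x + d4)), -(h + κ), h' + κ')]
lemma thA2 (i : ZMod P →+ G) {M H : ℕ} {F : G → ℂ} (hF : ∀ x, ‖F x‖ ≤ 1) (c2 c3 c4 : H4 H → G) :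
    ‖𝔼 x, F x * 𝔼 j : H4 H × Fin M,
      conj (F (x + c2 j.1 + i ((2 * (hh j.1 * (j.2 : ℕ)) : ℤ) : ZMod P))) *
      conj (F (x + c3 j.1 + i ((2 * (kk j.1 * (j.2 : ℕ)) : ℤ) : ZMod P))) *
      F (x + c4 j.1 + i ((2 * ((hh j.1 + kk j.1) * (j.2 : ℕ)) : ℤ) : ZMod P))‖ ^ 2 ≤
    𝔼 p : H4 H, 𝔼 p' : H4 H, ‖QQ i M (fun x => F (x + c4 p))
      (LL (c2 p) (c3 p) (c4 p) F (hh p) (kk p) (c2 p') (c3 p') (c4 p') (hh p') (kk p'))‖ := by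
  refine (kill hF).trans ?_
  have e1 : ∀ p p' : H4 H, QQ i M (fun x => F (x + c4 p))
      (LL (c2 p) (c3 p) (c4 p) F (hh p) (kk p) (c2 p') (c3 p') (c4 p') (hh p') (kk p')) =
    𝔼 y : Fin M, 𝔼 y' : Fin M, 𝔼 x,
      (conj (F (x + c2 p + i ((2 * (hh p * (y : ℕ)) : ℤ) : ZMod P))) *
      conj (F (x + c3 p + i ((2 * (kk p * (y : ℕ)) : ℤ) : ZMod P))) *
      F (x + c4 p + i ((2 * ((hh p + kk p) * (y : ℕ)) : ℤ) : ZMod P))) *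
      conj (conj (F (x + c2 p' + i ((2 * (hh p' * (y' : ℕ)) : ℤ) : ZMod P))) *
      conj (F (x + c3 p' + i ((2 * (kk p' * (y' : ℕ)) : ℤ) : ZMod P))) *
      F (x + c4 p' + i ((2 * ((hh p' + kk p') * (y' : ℕ)) : ℤ) : ZMod P))) := by
    intro p p'
    unfold QQ
    refine (E_comm _).trans ?_
    refine congrArg _ (funext fun y => ?_)
    refine (E_comm _).trans ?_
    refine congrArg _ (funext fun y' => ?_)
    symm
    rw [← E_shift _ (i ((2 * (-(hh p + kk p) * (y : ℕ)) : ℤ) : ZMod P))]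
    refine congrArg _ (funext fun x => ?_)
    simp only [LL, List.map_cons, List.map_nil, List.prod_cons, List.prod_nil, map_mul, Complex.conj_conj, mul_one]
    have w : ∀ (a b c : ℤ) (d : G), a + b = c → x + i (a : ZMod P) + d + i (b : ZMod P) = x + i (c : ZMod P) + d := by
      rintro a b c d rfl
      push_cast; rw [map_add]; abel
    rw [w _ _ (2 * (-kk p * (y : ℕ) + 0 * (y' : ℕ))) _ (by ring),
      w _ _ (2 * (-hh p * (y : ℕ) + 0 * (y' : ℕ))) _ (by ring),
      w _ _ 0 _ (by ring),
      w _ _ (2 * (-(hh p + kk p) * (y : ℕ) + hh p' * (y' : ℕ))) _ (by ring),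
      w _ _ (2 * (-(hh p + kk p) * (y : ℕ) + kk p' * (y' : ℕ))) _ (by ring),
      w _ _ (2 * (-(hh p + kk p) * (y : ℕ) + (hh p' + kk p') * (y' : ℕ))) _ (by ring)]
    simp only [Int.cast_zero, map_zero, add_zero]
    ring
  simp only [e1]
  simp only [E_prod (ι := H4 H) (κ := Fin M)]
  refine (E_norm_le _).trans (E_mono fun p => ?_)
  refine le_trans (le_of_eq ?_) (E_norm_le _)
  congr 1
  exact E_comm _
end
end
section
def Mon (f : ℝ → ℝ) : Prop := ∃ a : ℕ, ∃ B : ℝ, 1 ≤ B ∧ ∀ δ, 0 < δ → δ ≤ 1 → δ ^ a / B ≤ f δ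
lemma Mon.pos {f : ℝ → ℝ} (h : Mon f) {δ : ℝ} (h0 : 0 < δ) (h1 : δ ≤ 1) : 0 < f δ := by
  obtain ⟨a, B, hB, h⟩ := h
  exact lt_of_lt_of_le (by positivity) (h δ h0 h1)
lemma Mon.mono {f g : ℝ → ℝ} (h : Mon f) (hfg : ∀ δ, 0 < δ → δ ≤ 1 → f δ ≤ g δ) : Mon g := by
  obtain ⟨a, B, hB, h⟩ := h
  exact ⟨a, B, hB, fun δ h0 h1 => (h δ h0 h1).trans (hfg δ h0 h1)⟩
lemma Mon.id : Mon (fun δ => δ) := ⟨1, 1, le_rfl, fun δ _ _ => by simp⟩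
lemma Mon.const {c : ℝ} (hc : 0 < c) : Mon (fun _ => c) := by
  refine ⟨0, max 1 c⁻¹, le_max_left _ _, fun δ _ _ => ?_⟩
  rw [pow_zero, one_div]
  exact inv_le_of_inv_le₀ hc (le_max_right _ _)
lemma Mon.mul {f g : ℝ → ℝ} (hf : Mon f) (hg : Mon g) : Mon (fun δ => f δ * g δ) := by
  obtain ⟨a, B, hB, h⟩ := hf
  obtain ⟨a', B', hB', h'⟩ := hg
  refine ⟨a + a', B * B', by nlinarith, fun δ h0 h1 => ?_⟩
  rw [pow_add, mul_div_mul_comm]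
  exact mul_le_mul (h δ h0 h1) (h' δ h0 h1) (by positivity) ((by positivity : (0 : ℝ) ≤ _).trans (h δ h0 h1))
lemma Mon.pow {f : ℝ → ℝ} (hf : Mon f) (n : ℕ) : Mon (fun δ => f δ ^ n) := by
  induction n with
  | zero => simpa using Mon.const one_pos
  | succ n ih => simp only [pow_succ]; exact ih.mul hf
lemma Mon.smul {f : ℝ → ℝ} (hf : Mon f) {c : ℝ} (hc : 0 < c) : Mon (fun δ => c * f δ) :=
  (Mon.const hc).mul hf
lemma Mon.div {f : ℝ → ℝ} (hf : Mon f) {c : ℝ} (hc : 0 < c) : Mon (fun δ => f δ / c) := by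
  simp only [div_eq_mul_inv]; exact hf.mul (Mon.const (inv_pos.2 hc))
lemma Mon.min {f g : ℝ → ℝ} (hf : Mon f) (hg : Mon g) : Mon (fun δ => min (f δ) (g δ)) := by
  obtain ⟨a, B, hB, h⟩ := hf
  obtain ⟨a', B', hB', h'⟩ := hg
  refine ⟨a + a', B * B', by nlinarith, fun δ h0 h1 => le_min ?_ ?_⟩
  · refine le_trans ?_ (h δ h0 h1)
    have : δ ^ (a + a') ≤ δ ^ a := pow_le_pow_of_le_one h0.le h1 (by omega)
    gcongr; nlinarith
  · refine le_trans ?_ (h' δ h0 h1)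
    have : δ ^ (a + a') ≤ δ ^ a' := pow_le_pow_of_le_one h0.le h1 (by omega)
    gcongr; nlinarith
lemma Mon.comp {f g : ℝ → ℝ} (hf : Mon f) (hg : Mon g) (hg1 : ∀ δ, 0 < δ → δ ≤ 1 → g δ ≤ 1) : Mon (fun δ => f (g δ)) := by
  have hg0 := hg
  obtain ⟨a, B, hB, h⟩ := hf
  refine ((hg0.pow a).div (c := B) (by linarith)).mono fun δ h0 h1 => ?_
  exact h _ (hg0.pos h0 h1) (hg1 δ h0 h1)
lemma exists_inv_nat {t : ℝ} (ht : 0 < t) (ht1 : t ≤ 1) : ∃ g : ℕ, 0 < g ∧ 1 / (g : ℝ) ≤ t ∧ t / 2 ≤ 1 / (g : ℝ) := by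
  refine ⟨⌈1 / t⌉₊, Nat.ceil_pos.2 (by positivity), ?_, ?_⟩
  · rw [one_div_le (by exact_mod_cast Nat.ceil_pos.2 (by positivity)) ht]
    exact Nat.le_ceil _
  · have h1 := (Nat.ceil_lt_add_one (by positivity : 0 ≤ 1 / t)).le
    have h2 : 1 ≤ 1 / t := (one_le_div ht).2 ht1
    rw [le_one_div (by positivity) (by exact_mod_cast Nat.ceil_pos.2 (by positivity))]
    refine h1.trans ?_
    rw [one_div_div]
    have : (2 : ℝ) / t = 1 / t + 1 / t := by ring
    linarith
section
variable {G : Type} [AddCommGroup G] [Fintype G] {P : ℕ} [NeZero P]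
def gd (H g : ℕ) (p p' : H4 H) : Prop :=
  Gd H g (-(hh p + kk p)) (hh p') ∧ Gd H g (-(hh p + kk p)) (kk p') ∧ Gd H g (-(hh p + kk p)) (hh p' + kk p')
lemma abs_hh {H : ℕ} (p : H4 H) : |hh p| ≤ H := by
  unfold hh; have := p.2.1.2; have := p.2.2.2; rw [abs_le]; omega
lemma abs_kk {H : ℕ} (p : H4 H) : |kk p| ≤ H := by
  unfold kk; have := p.1.1.2; have := p.1.2.2; rw [abs_le]; omega
lemma thA3 {D : ℝ} (hD : 1 ≤ D) (hK : ∀ {G : Type} [AddCommGroup G] [Fintype G] {P : ℕ} [NeZero P]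
    (i : ZMod P →+ G) (M H : ℕ), 0 < H → (H : ℝ) / M ≤ 1 → ∀ (F : G → ℂ) (L : List ((G → ℂ) × ℤ × ℤ)),
    L.length = 5 → (∀ x, ‖F x‖ ≤ 1) → (∀ l ∈ L, ∀ x, ‖l.1 x‖ ≤ 1) →
    ‖QQ i M F L‖ ^ (2 ^ 5) ≤ D * (recB i H (fun K => ‖𝔼 x, K x‖) (L.map Prod.snd) F + H / M))
    (i : ZMod P →+ G) {M H g : ℕ} (hH : 0 < H) (hg : 0 < g) (hP : 32 * H ^ 2 < P) (hHM : (H : ℝ) / M ≤ 1)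
    {F : G → ℂ} (hF : ∀ x, ‖F x‖ ≤ 1) (c2 c3 c4 d2 d3 d4 : G) (p p' : H4 H) (hgd : gd H g p p') :
    ‖QQ i M (fun x => F (x + c4))
      (LL c2 c3 c4 F (hh p) (kk p) d2 d3 d4 (hh p') (kk p'))‖ ^ (2 ^ 6) ≤
     2 * D ^ 2 * ((2 * g ^ 2 * P / H ^ 2 : ℝ) ^ 3 * recB i H (V i 3) [(-kk p, 0), (-hh p, 0)] F + H / M) := by
  have h1 := hK i M H hH hHM (fun x => F (x + c4)) (LL c2 c3 c4 F (hh p) (kk p) d2 d3 d4 (hh p') (kk p'))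
    rfl (fun x => hF _) (by
      intro l hl x
      simp only [LL, List.mem_cons, List.not_mem_nil, or_false] at hl
      rcases hl with rfl | rfl | rfl | rfl | rfl <;> simp [hF])
  set x := ‖QQ i M (fun x => F (x + c4)) (LL c2 c3 c4 F (hh p) (kk p) d2 d3 d4 (hh p') (kk p'))‖ with hx
  set R := recB i H (fun K => ‖𝔼 x, K x‖) ((LL c2 c3 c4 F (hh p) (kk p) d2 d3 d4 (hh p') (kk p')).map Prod.snd) (fun x => F (x + c4)) with hR
  have hR0 : 0 ≤ R := recB_nonneg i H (fun _ => norm_nonneg _) _ _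
  have h2 : R ^ 2 ≤ (2 * g ^ 2 * P / H ^ 2 : ℝ) ^ 3 * recB i H (V i 3) [(-kk p, 0), (-hh p, 0)] F := by
    refine (recB_sq i H (normsq_le_V0 i) _ _).trans ?_
    have e : ((LL c2 c3 c4 F (hh p) (kk p) d2 d3 d4 (hh p') (kk p')).map Prod.snd) =
      [(-kk p, 0), (-hh p, 0)] ++ [(-(hh p + kk p), hh p'), (-(hh p + kk p), kk p'), (-(hh p + kk p), hh p' + kk p')] := rfl
    rw [e, recB_append, ← recB_translate i H 3 [(-kk p, 0), (-hh p, 0)] F c4, ← recB_const]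
    refine recB_mono i H (fun K => ?_) _ _
    refine recB_good hH hg hP i 0 _ ?_ K
    have b1 := abs_hh p; have b2 := abs_kk p; have b3 := abs_hh p'; have b4 := abs_kk p'
    have b5 : |-(hh p + kk p)| ≤ 4 * H := by rw [abs_neg]; have := abs_add_le (hh p) (kk p); omega
    have b6 : |(hh p' + kk p')| ≤ 4 * H := by have := abs_add_le (hh p') (kk p'); omega
    intro c hc
    simp only [List.mem_cons, List.not_mem_nil, or_false] at hc
    rcases hc with rfl | rfl | rfl
    · exact ⟨b5, by dsimp only; omega, hgd.1⟩
    · exact ⟨b5, by dsimp only; omega, hgd.2.1⟩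
    · exact ⟨b5, b6, hgd.2.2⟩
  have h0 : 0 ≤ (H : ℝ) / M := by positivity
  have h3 : x ^ (2 ^ 6) ≤ (D * (R + H / M)) ^ 2 := by
    have : x ^ (2 ^ 6) = (x ^ (2 ^ 5)) ^ 2 := by ring
    rw [this]
    exact pow_le_pow_left₀ (by positivity) h1 2
  refine h3.trans ?_
  rw [mul_pow]
  have : (R + H / M) ^ 2 ≤ 2 * (R ^ 2 + H / M) := by nlinarith [sq_nonneg (R - H / M)]
  calc D ^ 2 * (R + H / M) ^ 2 ≤ D ^ 2 * (2 * (R ^ 2 + H / M)) := by gcongr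
    _ = 2 * D ^ 2 * (R ^ 2 + H / M) := by ring
    _ ≤ _ := by gcongr
open Classical in
lemma bad_prob {H g : ℕ} (hg : 0 < g) (hgH : g ≤ H) :
    𝔼 p : H4 H, 𝔼 p' : H4 H, (if gd H g p p' then (0 : ℝ) else 1) ≤ 84 / g := by
  have hH : 0 < H := lt_of_lt_of_le hg hgH
  haveI : NeZero H := ⟨hH.ne'⟩
  have k1 : ∀ p p' : H4 H, (if gd H g p p' then (0 : ℝ) else 1) ≤
     (if Gd H g (-(hh p + kk p)) (hh p') then (0 : ℝ) else 1) + (if Gd H g (-(hh p + kk p)) (kk p') then (0 : ℝ) else 1)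
      + (if Gd H g (-(hh p + kk p)) (hh p' + kk p') then (0 : ℝ) else 1) := by
    intro p p'
    unfold gd
    split_ifs <;> first | (norm_num; done) | (exfalso; tauto)
  have key : ∀ β : H4 H → ℤ, (∀ a b c d : Fin H, ∃ v, ∀ s, β ((a, b), (c, s)) = (s : ℕ) + v) →
      𝔼 p : H4 H, 𝔼 p' : H4 H, (if Gd H g (-(hh p + kk p)) (β p') then (0 : ℝ) else 1) ≤ 28 / g := by
    intro β hβ
    simp only [E_prod]
    have : ∀ (f : Fin H → Fin H → ℝ), (𝔼 s : Fin H, 𝔼 _s' : Fin H, f s _s' = 𝔼 s : Fin H, 𝔼 s' : Fin H, f s s') := fun f => rfl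
    refine E_le_const (by positivity) fun k => E_le_const (by positivity) fun k' => ?_
    rw [E_comm]
    refine E_le_const (by positivity) fun s' => ?_
    have e := E_comm (fun (s : Fin H) (q : (Fin H × Fin H) × Fin H) => 𝔼 t : Fin H,
      (if Gd H g (-(hh ((k, k'), (s, s')) + kk ((k, k'), (s, s')))) (β (q.1, (q.2, t))) then (0 : ℝ) else 1))
    simp only [E_prod] at e
    rw [e]
    refine E_le_const (by positivity) fun a => E_le_const (by positivity) fun b => E_le_const (by positivity) fun c => ?_
    obtain ⟨v, hv⟩ := hβ a b c s'
    have u1 : ∀ s : Fin H, -(hh ((k, k'), (s, s')) + kk ((k, k'), (s, s'))) = (s : ℕ) + (-((s' : ℕ) : ℤ) - (k' : ℕ) + (k : ℕ)) := by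
      intro s; simp only [hh, kk]; ring
    simp only [hv, u1]
    refine BP hg hgH ?_
    have := s'.2; have := k.2; have := k'.2
    rw [abs_le]; omega
  refine (E_mono fun p => E_mono fun p' => k1 p p').trans ?_
  simp only [expect_add_distrib]
  have r1 := key hh (fun a b c d => ⟨-(c : ℕ), fun s => by simp only [hh]; ring⟩)
  have r3 := key (fun p => hh p + kk p) (fun a b c d => ⟨-(c : ℕ) + (b : ℕ) - (a : ℕ), fun s => by simp only [hh, kk]; ring⟩)
  have r2 : 𝔼 p : H4 H, 𝔼 p' : H4 H, (if Gd H g (-(hh p + kk p)) (kk p') then (0 : ℝ) else 1) ≤ 28 / g := by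
    refine le_trans (le_of_eq ?_) r1
    congr 1; ext p
    exact Fintype.expect_equiv (Equiv.prodComm _ _) _ _ fun p' => rfl
  have : (84 : ℝ) / g = 28 / g + 28 / g + 28 / g := by ring
  rw [this]
  exact add_le_add (add_le_add r1 r2) r3
end
end
section
section
variable {G : Type} [AddCommGroup G] [Fintype G] {P : ℕ} [NeZero P]
lemma thA5 {H g2 g3 : ℕ} (hg2 : 0 < g2) (hgH2 : g2 ≤ H) (hg3 : 0 < g3) (hgH3 : g3 ≤ H)
    (hP : 32 * H ^ 2 < P) (i : ZMod P →+ G) {F : G → ℂ} (hF : ∀ x, ‖F x‖ ≤ 1) :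
    ∃ Y2 : ℝ, 0 ≤ Y2 ∧ (𝔼 p : H4 H, recB i H (V i 3) [(-kk p, 0), (-hh p, 0)] F) ^ 2
      ≤ (2 * g2 ^ 2 * P / H ^ 2 : ℝ) * Y2 + 28 / g2 ∧ Y2 ^ 2 ≤ (2 * g3 ^ 2 * P / H ^ 2 : ℝ) * V i 5 F + 28 / g3 := by
  refine ⟨𝔼 p : Fin H × Fin H, recB i H (V i 4) [(((p.1 : ℕ) : ℤ) - (p.2 : ℕ), 0)] F,
    E_nonneg fun p => recB_nonneg i H (V_nonneg i 4) _ _, ?_, stepA5 hg3 hgH3 hP i 4 hF⟩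
  have hH : 0 < H := lt_of_lt_of_le hg2 hgH2
  haveI : NeZero H := ⟨hH.ne'⟩
  have e : 𝔼 p : H4 H, recB i H (V i 3) [(-kk p, 0), (-hh p, 0)] F =
      𝔼 k : Fin H × Fin H, recB i H (fun K => 𝔼 s : Fin H × Fin H, recB i H (V i 3) [(((s.1 : ℕ) : ℤ) - (s.2 : ℕ), 0)] K)
        [(((k.1 : ℕ) : ℤ) - (k.2 : ℕ), 0)] F := by
    rw [E_prod]
    refine congrArg _ (funext fun k => ?_)
    have : ∀ s : Fin H × Fin H, recB i H (V i 3) [(-kk (k, s), 0), (-hh (k, s), 0)] F =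
      recB i H (recB i H (V i 3) [(((s.1 : ℕ) : ℤ) - (s.2 : ℕ), 0)]) [(((k.1 : ℕ) : ℤ) - (k.2 : ℕ), 0)] F := by
      intro s
      rw [← recB_append]
      simp only [kk, hh, List.cons_append, List.nil_append, neg_sub]
    simp only [this]
    exact E_comm _
  rw [e]
  refine (E_sq_le _).trans ?_
  set c := (2 * g2 ^ 2 * P / H ^ 2 : ℝ)
  have h1 : ∀ k : Fin H × Fin H, recB i H (fun K => 𝔼 s : Fin H × Fin H, recB i H (V i 3) [(((s.1 : ℕ) : ℤ) - (s.2 : ℕ), 0)] K)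
        [(((k.1 : ℕ) : ℤ) - (k.2 : ℕ), 0)] F ^ 2 ≤ c * recB i H (V i 4) [(((k.1 : ℕ) : ℤ) - (k.2 : ℕ), 0)] F + 28 / g2 := by
    intro k
    refine (E_sq_le _).trans ?_
    have : ∀ τ : H4 H, (recB i H (fun K => 𝔼 s : Fin H × Fin H, recB i H (V i 3) [(((s.1 : ℕ) : ℤ) - (s.2 : ℕ), 0)] K) []
       (Dl (i ((2 * ((((k.1 : ℕ) : ℤ) - (k.2 : ℕ)) * ((τ.2.1 : ℕ) - (τ.1.1 : ℕ)) + 0 * ((τ.2.2 : ℕ) - (τ.1.2 : ℕ))) : ℤ) : ZMod P)) F)) ^ 2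
       ≤ c * recB i H (V i 4) [] (Dl (i ((2 * ((((k.1 : ℕ) : ℤ) - (k.2 : ℕ)) * ((τ.2.1 : ℕ) - (τ.1.1 : ℕ)) + 0 * ((τ.2.2 : ℕ) - (τ.1.2 : ℕ))) : ℤ) : ZMod P)) F) + 28 / g2 :=
      fun τ => stepA5 hg2 hgH2 hP i 3 (Dl_bdd hF _)
    refine (E_mono this).trans (le_of_eq ?_)
    rw [expect_add_distrib, E_const, ← mul_expect]; rfl
  refine (E_mono h1).trans (le_of_eq ?_)
  rw [expect_add_distrib, E_const, ← mul_expect]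
open Classical in
lemma thA4 {D : ℝ} (hD : 1 ≤ D) (hK : ∀ {G : Type} [AddCommGroup G] [Fintype G] {P : ℕ} [NeZero P]
    (i : ZMod P →+ G) (M H : ℕ), 0 < H → (H : ℝ) / M ≤ 1 → ∀ (F : G → ℂ) (L : List ((G → ℂ) × ℤ × ℤ)),
    L.length = 5 → (∀ x, ‖F x‖ ≤ 1) → (∀ l ∈ L, ∀ x, ‖l.1 x‖ ≤ 1) →
    ‖QQ i M F L‖ ^ (2 ^ 5) ≤ D * (recB i H (fun K => ‖𝔼 x, K x‖) (L.map Prod.snd) F + H / M))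
    (i : ZMod P →+ G) {M H g : ℕ} (hg : 0 < g) (hgH : g ≤ H) (hP : 32 * H ^ 2 < P) (hHM : (H : ℝ) / M ≤ 1)
    {F : G → ℂ} (hF : ∀ x, ‖F x‖ ≤ 1) (c2 c3 c4 : H4 H → G) {δ : ℝ} (hδ : 0 ≤ δ)
    (h : δ ≤ 𝔼 p : H4 H, 𝔼 p' : H4 H, ‖QQ i M (fun x => F (x + c4 p))
      (LL (c2 p) (c3 p) (c4 p) F (hh p) (kk p) (c2 p') (c3 p') (c4 p') (hh p') (kk p'))‖)
    (hgδ : 84 / (g : ℝ) ≤ δ / 2) :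
    (δ / 2) ^ (2 ^ 6) ≤ 2 * D ^ 2 * ((2 * g ^ 2 * P / H ^ 2 : ℝ) ^ 3 *
      𝔼 p : H4 H, recB i H (V i 3) [(-kk p, 0), (-hh p, 0)] F + H / M) := by
  have hH : 0 < H := lt_of_lt_of_le hg hgH
  haveI : NeZero H := ⟨hH.ne'⟩
  set q : H4 H → H4 H → ℝ := fun p p' => ‖QQ i M (fun x => F (x + c4 p))
      (LL (c2 p) (c3 p) (c4 p) F (hh p) (kk p) (c2 p') (c3 p') (c4 p') (hh p') (kk p'))‖ with hq
  have hq1 : ∀ p p', q p p' ≤ 1 := fun p p' => QQ_bdd i M (fun x => hF _) (by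
      intro l hl x
      simp only [LL, List.mem_cons, List.not_mem_nil, or_false] at hl
      rcases hl with rfl | rfl | rfl | rfl | rfl <;> simp [hF])
  let X : H4 H → H4 H → ℝ := fun p p' => if gd H g p p' then q p p' else 0
  have hX0 : ∀ p p', 0 ≤ X p p' := fun p p' => by
    simp only [X]; split_ifs
    · exact norm_nonneg _
    · exact le_rfl
  have h1 : δ ≤ (𝔼 p : H4 H, 𝔼 p' : H4 H, X p p') + 84 / g := by
    refine h.trans ?_
    refine le_trans ?_ (add_le_add le_rfl (bad_prob hg hgH))
    simp only [← expect_add_distrib]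
    refine E_mono fun p => E_mono fun p' => ?_
    simp only [X]
    split_ifs
    · rw [add_zero]
    · rw [zero_add]; exact hq1 p p'
  have h2 : δ / 2 ≤ 𝔼 p : H4 H, 𝔼 p' : H4 H, X p p' := by linarith
  refine (pow_le_pow_left₀ (by positivity) h2 _).trans ?_
  refine (E_pow_le (fun p => E_nonneg fun p' => hX0 p p') 6).trans ?_
  rw [mul_add, mul_expect, mul_expect, ← E_const (ι := H4 H) (2 * D ^ 2 * ((H : ℝ) / M)), ← expect_add_distrib]
  refine E_mono fun p => ?_
  refine (E_pow_le (fun p' => hX0 p p') 6).trans ?_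
  have hr : 0 ≤ recB i H (V i 3) [(-kk p, 0), (-hh p, 0)] F := recB_nonneg i H (V_nonneg i 3) _ _
  refine E_le_const (by positivity) fun p' => ?_
  simp only [X]
  split_ifs with hgood
  · rw [← mul_add]
    exact thA3 hD hK i hH hg hP hHM hF _ _ _ _ _ _ p p' hgood
  · rw [zero_pow (by norm_num)]; positivity
end
lemma thA6a {A D U1 Y w1 y1 ε h : ℝ} (hD : 0 < D ^ 2) (hU : 0 ≤ U1) (hY0 : 0 ≤ Y) (hw : 0 < w1) (e_ε : ε = A / (64 * D ^ 2))
    (e_y1 : y1 = A * w1 ^ 3 / (4 * D ^ 2)) (W1 : U1 * w1 ≤ 1) (hh : 0 ≤ h) (hh : h ≤ ε)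
    (hc : A ≤ 2 * D ^ 2 * (U1 ^ 3 * Y + h)) : y1 ≤ Y := by
  have e2 : 2 * D ^ 2 * h ≤ A / 2 := by
    have h1 : 2 * D ^ 2 * h ≤ 2 * D ^ 2 * ε := by gcongr
    have e3 : 2 * D ^ 2 * ε = A / 32 := by
      have hD0 : D ≠ 0 := by rintro rfl; norm_num at hD
      rw [e_ε]; field_simp; ring
    have h2 : 0 ≤ 2 * D ^ 2 * h := by positivity
    linarith
  have e3 : A / (4 * D ^ 2) ≤ U1 ^ 3 * Y := by
    rw [div_le_iff₀ (by positivity)]; linarith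
  calc y1 = A / (4 * D ^ 2) * w1 ^ 3 := by rw [e_y1]; ring
    _ ≤ U1 ^ 3 * Y * w1 ^ 3 := by gcongr
    _ = (U1 * w1) ^ 3 * Y := by ring
    _ ≤ 1 * Y := by
        gcongr
        exact pow_le_one₀ (by positivity) W1
    _ = Y := one_mul Y
lemma thA6b : ∀ (U w y t Z Z' : ℝ) (g : ℕ), 0 < y → 0 < w → 0 ≤ Z' → U * w ≤ 1 → y ≤ Z → 1 / (g : ℝ) ≤ t → t = y ^ 2 / 56 →
    Z ^ 2 ≤ U * Z' + 28 / g → y ^ 2 * w / 2 ≤ Z' := by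
  intro U w y t Z Z' g hy hw hZ' hU hyZ hg ht hZ
  have e : (28 : ℝ) / g = 28 * (1 / g) := by ring
  rw [e] at hZ
  have h2 : y ^ 2 ≤ Z ^ 2 := pow_le_pow_left₀ hy.le hyZ 2
  have h3 : y ^ 2 / 2 ≤ U * Z' := by subst ht; linarith
  calc y ^ 2 * w / 2 = y ^ 2 / 2 * w := by ring
    _ ≤ U * Z' * w := by gcongr
    _ = (U * w) * Z' := by ring
    _ ≤ 1 * Z' := by gcongr
    _ = Z' := one_mul _
set_option maxHeartbeats 1000000 in
lemma thA6 {G : Type} [AddCommGroup G] [Fintype G] {P : ℕ} [NeZero P]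
    (i : ZMod P →+ G) (g : G) {M : ℕ} (hP : P = 8 * M ^ 2) {f0 f1 F : G → ℂ} (h0 : ∀ x, ‖f0 x‖ ≤ 1)
    (h1 : ∀ x, ‖f1 x‖ ≤ 1) (hF : ∀ x, ‖F x‖ ≤ 1) {δ : ℝ} (hδ : 0 < δ) (hδ1 : δ ≤ 1)
    {D : ℝ} (hD : 1 ≤ D) (hK : ∀ {G : Type} [AddCommGroup G] [Fintype G] {P : ℕ} [NeZero P]
    (i : ZMod P →+ G) (M H : ℕ), 0 < H → (H : ℝ) / M ≤ 1 → ∀ (F : G → ℂ) (L : List ((G → ℂ) × ℤ × ℤ)),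
    L.length = 5 → (∀ x, ‖F x‖ ≤ 1) → (∀ l ∈ L, ∀ x, ‖l.1 x‖ ≤ 1) →
    ‖QQ i M F L‖ ^ (2 ^ 5) ≤ D * (recB i H (fun K => ‖𝔼 x, K x‖) (L.map Prod.snd) F + H / M))
    {A ε t1 w1 y1 t2 w2 y2 t3 w3 y3 : ℝ}
    (e_A : A = (δ ^ 8 / 8192) ^ (2 ^ 6))
    (e_ε : ε = A / (64 * D ^ 2))
    (e_t1 : t1 = δ ^ 8 / (4096 * 168))
    (e_w1 : w1 = ε ^ 2 * t1 ^ 2 / 256)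
    (e_y1 : y1 = A * w1 ^ 3 / (4 * D ^ 2))
    (e_t2 : t2 = y1 ^ 2 / 56)
    (e_w2 : w2 = ε ^ 2 * t2 ^ 2 / 256)
    (e_y2 : y2 = y1 ^ 2 * w2 / 2)
    (e_t3 : t3 = y2 ^ 2 / 56)
    (e_w3 : w3 = ε ^ 2 * t3 ^ 2 / 256)
    (e_y3 : y3 = y2 ^ 2 * w3 / 2)
    (pA : 0 < A) (pε : 0 < ε) (pt1 : 0 < t1) (pw1 : 0 < w1) (py1 : 0 < y1) (pt2 : 0 < t2) (pw2 : 0 < w2) (py2 : 0 < y2) (pt3 : 0 < t3) (pw3 : 0 < w3)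
    (hM2 : 1 ≤ M * (ε * (t1 * (t2 * t3)) / 16))
    (h : δ ≤ ‖𝔼 x, 𝔼 y : Fin M, f0 x * f1 (x + ((y : ℕ) + 1) • g) * F (x + i ((((y : ℕ) : ZMod P) + 1) ^ 2))‖) :
    y3 ≤ V i 5 F := by
  have hD0 : 0 < D := by linarith
  have hD2 : 0 < D ^ 2 := by positivity
  have hd8 : δ ^ 8 ≤ 1 := pow_le_one₀ hδ.le hδ1
  have hD1 : 1 ≤ D ^ 2 := one_le_pow₀ hD
  have bA : A ≤ δ ^ 2 := by
    calc A = _ := e_A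
      _ ≤ (δ ^ 8 / 8192) ^ 1 := pow_le_pow_of_le_one (by positivity) (by linarith) (by norm_num)
      _ ≤ δ ^ 8 := by rw [pow_one]; linarith [pow_pos hδ 8]
      _ ≤ δ ^ 2 := pow_le_pow_of_le_one hδ.le hδ1 (by norm_num)
  have hd2 : δ ^ 2 ≤ 1 := pow_le_one₀ hδ.le hδ1
  have bA1 : A ≤ 1 := bA.trans hd2
  have bε : ε ≤ δ ^ 2 / 64 := by
    calc ε ≤ A / 64 := by
          rw [e_ε]
          refine div_le_div_of_nonneg_left pA.le (by norm_num) (by linarith)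
      _ ≤ _ := by linarith
  have bε1 : ε ≤ 1 / 64 := by linarith
  have bt1 : t1 ≤ 1 := by rw [e_t1]; linarith
  have bw : ∀ t : ℝ, 0 < t → t ≤ 1 → ε ^ 2 * t ^ 2 / 256 ≤ 1 := by
    intro t ht ht1
    have : ε ^ 2 * t ^ 2 ≤ 1 * 1 := mul_le_mul (pow_le_one₀ pε.le (by linarith)) (pow_le_one₀ ht.le ht1) (by positivity) (by norm_num)
    linarith
  have bw1 : w1 ≤ 1 := e_w1 ▸ bw _ pt1 bt1
  have by1 : y1 ≤ 1 := by
    rw [e_y1]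
    rw [div_le_one (by positivity)]
    have : A * w1 ^ 3 ≤ 1 * 1 := mul_le_mul bA1 (pow_le_one₀ pw1.le bw1) (by positivity) (by norm_num)
    linarith
  have bt2 : t2 ≤ 1 := by
    have : y1 ^ 2 ≤ 1 := pow_le_one₀ py1.le by1
    rw [e_t2]; linarith
  have bw2 : w2 ≤ 1 := e_w2 ▸ bw _ pt2 bt2
  have by2 : y2 ≤ 1 := by
    have : y1 ^ 2 * w2 ≤ 1 * 1 := mul_le_mul (pow_le_one₀ py1.le by1) bw2 pw2.le (by norm_num)
    rw [e_y2]; linarith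
  have bt3 : t3 ≤ 1 := by
    have : y2 ^ 2 ≤ 1 := pow_le_one₀ py2.le by2
    rw [e_t3]; linarith
  obtain ⟨g1, hg1, hg1a, hg1b⟩ := exists_inv_nat pt1 bt1
  obtain ⟨g2, hg2, hg2a, hg2b⟩ := exists_inv_nat pt2 bt2
  obtain ⟨g3, hg3, hg3a, hg3b⟩ := exists_inv_nat pt3 bt3
  have hMr : (0 : ℝ) < M := by
    rcases Nat.eq_zero_or_pos M with rfl | h
    · norm_num at hM2
    · exact_mod_cast h
  set H := ⌊ε * M⌋₊ with hHdef
  have hεM : ∀ t, 0 < t → (t1 * (t2 * t3) ≤ t) → 16 ≤ ε * M * t := by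
    intro t ht hle
    have : M * (ε * (t1 * (t2 * t3)) / 16) ≤ M * (ε * t / 16) := by gcongr
    linarith
  have c1 : t1 * (t2 * t3) ≤ t1 := mul_le_of_le_one_right pt1.le (mul_le_one₀ bt2 pt3.le bt3)
  have c2 : t1 * (t2 * t3) ≤ t2 := (mul_le_of_le_one_left (by positivity) bt1).trans (mul_le_of_le_one_right pt2.le bt3)
  have c3 : t1 * (t2 * t3) ≤ t3 := (mul_le_of_le_one_left (by positivity) bt1).trans (mul_le_of_le_one_left pt3.le bt2)
  have hH1 : (H : ℝ) ≤ ε * M := Nat.floor_le (by positivity)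
  have h16 : 16 ≤ ε * M := by simpa using hεM 1 one_pos (c1.trans bt1)
  have hH2 : ε * M / 2 ≤ H := by
    have := Nat.lt_floor_add_one (ε * M); linarith
  have hHpos : 0 < H := by
    have : (0 : ℝ) < H := by linarith
    exact_mod_cast this
  have hgle : ∀ (g : ℕ) (t : ℝ), 0 < g → 0 < t → t / 2 ≤ 1 / (g : ℝ) → (t1 * (t2 * t3) ≤ t) → g ≤ H := by
    intro g t hg ht hgt hle
    have hgr : (0 : ℝ) < g := by exact_mod_cast hg
    rw [le_div_iff₀ hgr] at hgt
    have h3 := hεM t ht hle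
    have : (g : ℝ) ≤ H := by
      refine le_trans ?_ hH2
      have h5 : (g : ℝ) * t ≤ ε * M / 2 * t := by
        have e1 : (g : ℝ) * t = 2 * (t / 2 * g) := by ring
        have e2 : ε * M / 2 * t = (ε * M * t) / 2 := by ring
        rw [e1, e2]; linarith only [hgt, h3]
      exact le_of_mul_le_mul_right h5 ht
    exact_mod_cast this
  have hgH1 := hgle g1 _ hg1 pt1 hg1b c1
  have hgH2 := hgle g2 _ hg2 pt2 hg2b c2
  have hgH3 := hgle g3 _ hg3 pt3 hg3b c3
  have hHM : (H : ℝ) / M ≤ ε := by rw [div_le_iff₀ hMr]; exact hH1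
  have hP32 : 32 * H ^ 2 < P := by
    rw [hP]
    have : (H : ℝ) ≤ M / 64 := hH1.trans ((mul_le_mul_of_nonneg_right bε1 hMr.le).trans (by linarith only []))
    have h2 : (32 * H ^ 2 : ℝ) < 8 * M ^ 2 := by
      have h5 : (H : ℝ) ^ 2 ≤ (M / 64) ^ 2 := pow_le_pow_left₀ (Nat.cast_nonneg _) this 2
      have h6 : (0 : ℝ) < (M : ℝ) ^ 2 := by positivity
      rw [div_pow] at h5
      linarith only [h5, h6]
    exact_mod_cast h2
  have hW : ∀ (g : ℕ) (t : ℝ), 0 < g → 0 < t → t / 2 ≤ 1 / (g : ℝ) →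
      (2 * g ^ 2 * P / H ^ 2 : ℝ) * (ε ^ 2 * t ^ 2 / 256) ≤ 1 := by
    intro g t hg ht hgt
    have hgr : (0 : ℝ) < g := by exact_mod_cast hg
    have hHr : (0 : ℝ) < H := by exact_mod_cast hHpos
    rw [le_div_iff₀ hgr] at hgt
    have e1 : (P : ℝ) = 8 * M ^ 2 := by exact_mod_cast hP
    rw [e1]
    have e2 : (2 * g ^ 2 * (8 * M ^ 2) / H ^ 2 : ℝ) * (ε ^ 2 * t ^ 2 / 256)
      = (t / 2 * g) ^ 2 * ((ε * M / 2) ^ 2 / H ^ 2) := by field_simp; ring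
    rw [e2]
    refine mul_le_one₀ (pow_le_one₀ (by positivity) hgt) (by positivity) ?_
    rw [div_le_one (by positivity)]
    exact pow_le_pow_left₀ (by positivity) hH2 2
  have W1 : (2 * g1 ^ 2 * P / H ^ 2 : ℝ) * w1 ≤ 1 := e_w1 ▸ hW g1 _ hg1 pt1 hg1b
  have W2 : (2 * g2 ^ 2 * P / H ^ 2 : ℝ) * w2 ≤ 1 := e_w2 ▸ hW g2 _ hg2 pt2 hg2b
  have W3 : (2 * g3 ^ 2 * P / H ^ 2 : ℝ) * w3 ≤ 1 := e_w3 ▸ hW g3 _ hg3 pt3 hg3b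
  obtain ⟨a2, a3, a4, ha⟩ := thA1 (H := H) i g hHpos h0 h1 hF hδ hδ1 (by
    rw [mul_div_assoc]; linarith) h
  have hb := (pow_le_pow_left₀ (by positivity) ha 2).trans (thA2 i hF a2 a3 a4)
  have hc := thA4 (g := g1) hD hK i hg1 hgH1 hP32 (hHM.trans (by linarith)) hF a2 a3 a4 (by positivity) hb (by
    have : (84 : ℝ) / g1 = 84 * (1 / g1) := by ring
    rw [this]
    have e : (δ ^ 4 / 64) ^ 2 / 2 = 84 * t1 := by rw [e_t1]; ring
    rw [e]; linarith)
  obtain ⟨Y2, hY20, hY2, hY3⟩ := thA5 hg2 hgH2 hg3 hgH3 hP32 i hF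
  have hY0 : 0 ≤ 𝔼 p : H4 H, recB i H (V i 3) [(-kk p, 0), (-hh p, 0)] F := E_nonneg fun p => recB_nonneg i H (V_nonneg i 3) _ _
  generalize 𝔼 p : H4 H, recB i H (V i 3) [(-kk p, 0), (-hh p, 0)] F = Y at *
  have hU1 : 0 ≤ (2 * g1 ^ 2 * P / H ^ 2 : ℝ) := by positivity
  generalize (2 * g1 ^ 2 * P / H ^ 2 : ℝ) = U1 at *
  generalize (2 * g2 ^ 2 * P / H ^ 2 : ℝ) = U2 at *
  generalize (2 * g3 ^ 2 * P / H ^ 2 : ℝ) = U3 at *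
  have e1 : ((δ ^ 4 / 64) ^ 2 / 2) ^ (2 ^ 6) = A := by rw [e_A]; congr 1; ring
  rw [e1] at hc
  have r1 : y1 ≤ Y := thA6a hD2 hU1 hY0 pw1 e_ε e_y1 W1 (by positivity) hHM hc
  have r2 : y2 ≤ Y2 := e_y2 ▸ thA6b U2 _ _ _ Y Y2 g2 py1 pw2 hY20 W2 r1 hg2a e_t2 hY2
  rw [e_y3]
  exact thA6b U3 _ _ _ Y2 _ g3 py2 pw3 (V_nonneg i 5 F) W3 r2 hg3a e_t3 hY3
theorem thmA : ∃ f : ℝ → ℝ, Mon f ∧ ∀ {G : Type} [AddCommGroup G] [Fintype G] {P : ℕ} [NeZero P]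
    (i : ZMod P →+ G) (g : G) {M : ℕ} (_ : P = 8 * M ^ 2) {f0 f1 F : G → ℂ} (_ : ∀ x, ‖f0 x‖ ≤ 1)
    (_ : ∀ x, ‖f1 x‖ ≤ 1) (_ : ∀ x, ‖F x‖ ≤ 1) {δ : ℝ} (_ : 0 < δ) (_ : δ ≤ 1)
    (_ : 1 ≤ M * f δ)
    (_ : δ ≤ ‖𝔼 x, 𝔼 y : Fin M, f0 x * f1 (x + ((y : ℕ) + 1) • g) * F (x + i ((((y : ℕ) : ZMod P) + 1) ^ 2))‖),
    f δ ≤ V i 5 F := by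
  obtain ⟨D, hD, hK⟩ := lemK 5
  have hD0 : 0 < D := by linarith
  have hD2 : 0 < D ^ 2 := by positivity
  let A : ℝ → ℝ := fun δ => (δ ^ 8 / 8192) ^ (2 ^ 6)
  let ε : ℝ → ℝ := fun δ => A δ / (64 * D ^ 2)
  let t1 : ℝ → ℝ := fun δ => δ ^ 8 / (4096 * 168)
  let w1 : ℝ → ℝ := fun δ => ε δ ^ 2 * t1 δ ^ 2 / 256
  let y1 : ℝ → ℝ := fun δ => A δ * w1 δ ^ 3 / (4 * D ^ 2)
  let t2 : ℝ → ℝ := fun δ => y1 δ ^ 2 / 56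
  let w2 : ℝ → ℝ := fun δ => ε δ ^ 2 * t2 δ ^ 2 / 256
  let y2 : ℝ → ℝ := fun δ => y1 δ ^ 2 * w2 δ / 2
  let t3 : ℝ → ℝ := fun δ => y2 δ ^ 2 / 56
  let w3 : ℝ → ℝ := fun δ => ε δ ^ 2 * t3 δ ^ 2 / 256
  let y3 : ℝ → ℝ := fun δ => y2 δ ^ 2 * w3 δ / 2
  have mA : Mon A := ((Mon.id.pow 8).div (by norm_num)).pow _
  have mε : Mon ε := mA.div (by positivity)
  have mt1 : Mon t1 := (Mon.id.pow 8).div (by norm_num)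
  have mw1 : Mon w1 := ((mε.pow 2).mul (mt1.pow 2)).div (by norm_num)
  have my1 : Mon y1 := (mA.mul (mw1.pow 3)).div (by positivity)
  have mt2 : Mon t2 := (my1.pow 2).div (by norm_num)
  have mw2 : Mon w2 := ((mε.pow 2).mul (mt2.pow 2)).div (by norm_num)
  have my2 : Mon y2 := ((my1.pow 2).mul mw2).div (by norm_num)
  have mt3 : Mon t3 := (my2.pow 2).div (by norm_num)
  have mw3 : Mon w3 := ((mε.pow 2).mul (mt3.pow 2)).div (by norm_num)
  have my3 : Mon y3 := ((my2.pow 2).mul mw3).div (by norm_num)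
  refine ⟨fun δ => min (y3 δ) (ε δ * (t1 δ * (t2 δ * t3 δ)) / 16), my3.min ((mε.mul (mt1.mul (mt2.mul mt3))).div (by norm_num)), ?_⟩
  intro G _ _ P _ i g M hP f0 f1 F h0 h1 hF δ hδ hδ1 hM h
  refine (min_le_left _ _).trans ?_
  exact thA6 i g hP h0 h1 hF hδ hδ1 hD hK (A := A δ) (ε := ε δ) (t1 := t1 δ) (w1 := w1 δ) (y1 := y1 δ) (t2 := t2 δ)
    (w2 := w2 δ) (y2 := y2 δ) (t3 := t3 δ) (w3 := w3 δ) (y3 := y3 δ) rfl rfl rfl rfl rfl rfl rfl rfl rfl rfl rfl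
    (mA.pos hδ hδ1) (mε.pos hδ hδ1) (mt1.pos hδ hδ1) (mw1.pos hδ hδ1) (my1.pos hδ hδ1) (mt2.pos hδ hδ1)
    (mw2.pos hδ hδ1) (my2.pos hδ hδ1) (mt3.pos hδ hδ1) (mw3.pos hδ hδ1)
    (hM.trans (mul_le_mul_of_nonneg_left (min_le_right _ _) (Nat.cast_nonneg _))) h
end
section
section
variable {P : ℕ} [NeZero P]
noncomputable def ee (x : ZMod P) : ℂ := ZMod.stdAddChar x
lemma ee_add (x y : ZMod P) : ee (x + y) = ee x * ee y := AddChar.map_add_eq_mul _ _ _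
lemma ee_norm (x : ZMod P) : ‖ee x‖ = 1 := AddChar.norm_apply _ _
lemma ee_neg (x : ZMod P) : ee (-x) = conj (ee x) := AddChar.map_neg_eq_conj _ _
lemma ee_zero : ee (0 : ZMod P) = 1 := AddChar.map_zero_eq_one _
lemma ee_sub (x y : ZMod P) : ee (x - y) = ee x * conj (ee y) := by
  rw [sub_eq_add_neg, ee_add, ee_neg]
def nrm (x : ZMod P) : ℕ := x.valMinAbs.natAbs
lemma nrm_neg (x : ZMod P) : nrm (-x) = nrm x := ZMod.natAbs_valMinAbs_neg x
lemma nrm_add (x y : ZMod P) : nrm (x + y) ≤ nrm x + nrm y :=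
  (ZMod.natAbs_valMinAbs_add_le x y).trans (Int.natAbs_add_le _ _)
lemma nrm_sub (x y : ZMod P) : nrm (x - y) ≤ nrm x + nrm y := by
  rw [sub_eq_add_neg]; refine (nrm_add _ _).trans ?_; rw [nrm_neg]
lemma nrm_le (t : ℤ) : nrm (t : ZMod P) ≤ t.natAbs := by
  apply ZMod.natAbs_min_of_le_div_two P
  · simp
  · exact ZMod.natAbs_valMinAbs_le _
lemma nrm_eq (t : ℤ) (h : 2 * t.natAbs < P) : nrm (t : ZMod P) = t.natAbs := by
  rw [nrm, (ZMod.valMinAbs_spec (t : ZMod P) t).2 ⟨rfl, by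
    constructor <;> omega⟩]
lemma ee_sub_one (t : ℤ) : ‖ee (t : ZMod P) - 1‖ ≤ 7 * |(t : ℝ)| / P := by
  have hP : (0 : ℝ) < P := by exact_mod_cast NeZero.pos P
  rw [ee, ZMod.stdAddChar_coe]
  have : (2 * Real.pi * Complex.I * t / P : ℂ) = Complex.I * ((2 * Real.pi * t / P : ℝ) : ℂ) := by
    push_cast; ring
  rw [this, Complex.norm_exp_I_mul_ofReal_sub_one, norm_mul, Real.norm_eq_abs, Real.norm_eq_abs]
  have h1 := Real.abs_sin_le_abs (x := 2 * Real.pi * t / P / 2)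
  have h2 : |2 * Real.pi * t / P / 2| = Real.pi * |(t : ℝ)| / P := by
    rw [abs_div, abs_div, abs_mul, abs_mul, abs_of_pos Real.pi_pos, abs_of_pos hP]; norm_num; ring
  rw [h2] at h1
  have h3 : Real.pi * |(t : ℝ)| / P ≤ 3.5 * |(t : ℝ)| / P := by
    gcongr; linarith [Real.pi_lt_d2]
  norm_num at *
  calc _ ≤ 2 * (7 / 2 * |(t : ℝ)| / P) := by linarith
    _ = _ := by ring
lemma ee_sub_one_nrm (x : ZMod P) : ‖ee x - 1‖ ≤ 7 * nrm x / P := by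
  have := ee_sub_one (P := P) x.valMinAbs
  rw [ZMod.coe_valMinAbs] at this
  convert this using 3
  rw [nrm, Nat.cast_natAbs, Int.cast_abs]
lemma ee_sub_one_ge (x : ZMod P) : 4 * (nrm x : ℝ) / P ≤ ‖ee x - 1‖ := by
  have hP : (0 : ℝ) < P := by exact_mod_cast NeZero.pos P
  set t := x.valMinAbs with ht
  have hx : x = (t : ZMod P) := (ZMod.coe_valMinAbs x).symm
  have hn : (nrm x : ℝ) = |(t : ℝ)| := by rw [nrm, Nat.cast_natAbs, Int.cast_abs]
  have ht2 : |(t : ℝ)| * 2 ≤ P := by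
    have h1 : x.valMinAbs.natAbs ≤ P / 2 := ZMod.natAbs_valMinAbs_le x
    have h2 : x.valMinAbs.natAbs * 2 ≤ P := by omega
    rw [← hn]; exact_mod_cast h2
  rw [hn, hx, ee, ZMod.stdAddChar_coe]
  have : (2 * Real.pi * Complex.I * t / P : ℂ) = Complex.I * ((2 * Real.pi * t / P : ℝ) : ℂ) := by
    push_cast; ring
  rw [this, Complex.norm_exp_I_mul_ofReal_sub_one, norm_mul, Real.norm_eq_abs, Real.norm_eq_abs]
  have h2 : |2 * Real.pi * t / P / 2| = Real.pi * |(t : ℝ)| / P := by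
    rw [abs_div, abs_div, abs_mul, abs_mul, abs_of_pos Real.pi_pos, abs_of_pos hP]; norm_num; ring
  have h1 := Real.mul_abs_le_abs_sin (x := 2 * Real.pi * t / P / 2) (by
    rw [h2, div_le_div_iff₀ hP (by norm_num)]
    rw [mul_assoc]
    gcongr)
  rw [h2] at h1
  have e : 2 / Real.pi * (Real.pi * |(t : ℝ)| / P) = 2 * |(t : ℝ)| / P := by
    field_simp
  rw [e] at h1
  norm_num
  calc 4 * |(t : ℝ)| / P = 2 * (2 * |(t : ℝ)| / P) := by ring
    _ ≤ _ := by linarith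
lemma ee_mul_nat (x : ZMod P) (n : ℕ) : ee (x * (n : ZMod P)) = ee x ^ n := by
  rw [mul_comm, ← nsmul_eq_mul]; exact AddChar.map_nsmul_eq_pow _ _ _
lemma geo {M : ℕ} (x : ZMod P) {η : ℝ} (h : η ≤ ‖𝔼 y : Fin M, ee (x * ((y : ℕ) : ZMod P))‖) :
    η * M * (2 * nrm x) ≤ P := by
  have hP : (0 : ℝ) < P := by exact_mod_cast NeZero.pos P
  rcases Nat.eq_zero_or_pos M with rfl | hM
  · simp
  have hMr : (0 : ℝ) < M := by exact_mod_cast hM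
  have h1 : ‖𝔼 y : Fin M, ee (x * ((y : ℕ) : ZMod P))‖ * M * ‖ee x - 1‖ ≤ 2 := by
    have e : 𝔼 y : Fin M, ee (x * ((y : ℕ) : ZMod P)) = (∑ y ∈ range M, ee x ^ y) / M := by
      rw [Fintype.expect_eq_sum_div_card, Fintype.card_fin]
      simp only [ee_mul_nat]
      rw [Fin.sum_univ_eq_sum_range (fun y => ee x ^ y)]
    rw [e, norm_div, Complex.norm_natCast, div_mul_cancel₀ _ hMr.ne', mul_comm, ← norm_mul, mul_geom_sum]
    refine (norm_sub_le _ _).trans ?_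
    rw [norm_pow, ee_norm]; norm_num
  have h2 := ee_sub_one_ge x
  have h3 : η * M * (4 * (nrm x : ℝ) / P) ≤ 2 := by
    calc η * M * (4 * (nrm x : ℝ) / P) ≤ ‖𝔼 y : Fin M, ee (x * ((y : ℕ) : ZMod P))‖ * M * (4 * (nrm x : ℝ) / P) := by
          gcongr
      _ ≤ _ := by refine le_trans ?_ h1; gcongr
  rw [mul_div_assoc', div_le_iff₀ hP] at h3
  linarith
lemma exists_gap {T : Finset ℕ} {k : ℕ} (h : k < T.card) : ∃ x ∈ T, ∃ y ∈ T, x + k ≤ y := by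
  have hne : T.Nonempty := card_pos.1 (by omega)
  refine ⟨T.min' hne, T.min'_mem hne, T.max' hne, T.max'_mem hne, ?_⟩
  by_contra hc
  have : T ⊆ Ico (T.min' hne) (T.min' hne + k) := by
    intro x hx
    have h1 := T.min'_le x hx
    have h2 := T.le_max' x hx
    rw [mem_Ico]; omega
  have := card_le_card this
  simp at this
  omega
lemma dense_major {H L E m : ℕ} (hL : 0 < L) (x : ZMod P) (S : Finset ℕ) (hS : S ⊆ range H)
    (h1 : H / L + 1 < S.card) (hm : 0 < m) (h2 : L * m < S.card)
    (hE : ∀ s ∈ S, ∀ t ∈ S, nrm (((s : ZMod P) - (t : ZMod P)) * x) ≤ E) (hP : 2 * (H * E) < P) :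
    ∃ b : ℕ, 0 < b ∧ b < L ∧ m * nrm ((b : ZMod P) * x) ≤ E := by
  classical
  obtain ⟨s, hs, t, ht, hne, he⟩ := exists_ne_map_eq_of_card_lt_of_maps_to (s := S) (t := range (H / L + 1))
    (by simpa using h1) (f := fun s => s / L) (by
      intro s hs
      have := mem_range.1 (hS hs)
      simp only [coe_range, Set.mem_Iio]
      exact Nat.lt_succ_of_le (Nat.div_le_div_right this.le))
  have key : ∃ s ∈ S, ∃ t ∈ S, t < s ∧ s / L = t / L := by
    rcases lt_or_gt_of_ne hne with h | h
    · exact ⟨t, ht, s, hs, h, he.symm⟩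
    · exact ⟨s, hs, t, ht, h, he⟩
  obtain ⟨s, hs, t, ht, hlt, he⟩ := key
  obtain ⟨b, rfl⟩ := Nat.exists_eq_add_of_lt hlt
  have hbL : b + 1 < L := by
    have e1 := Nat.div_add_mod (t + b + 1) L
    have e2 := Nat.div_add_mod t L
    rw [he] at e1
    have := Nat.mod_lt (t + b + 1) hL
    omega
  refine ⟨b + 1, by omega, hbL, ?_⟩
  set β := b + 1 with hβ
  have hEb : nrm ((β : ZMod P) * x) ≤ E := by
    have := hE _ hs _ ht
    convert this using 3
    rw [hβ]; push_cast; ring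
  obtain ⟨c, hc, hcard⟩ := exists_lt_card_fiber_of_mul_lt_card_of_maps_to (s := S) (t := range β) (n := m) (f := fun s => s % β)
    (fun a _ => mem_range.2 (Nat.mod_lt _ (by omega))) (by
      rw [card_range]; exact lt_of_le_of_lt (Nat.mul_le_mul_right _ hbL.le) h2)
  set T := (S.filter (fun s => s % β = c)).image (fun s => s / β) with hT
  have hTc : m < T.card := by
    rw [hT, card_image_of_injOn]
    · exact hcard
    · intro s hs t ht hst
      simp only [coe_filter, Set.mem_setOf_eq] at hs ht
      rw [← Nat.div_add_mod s β, ← Nat.div_add_mod t β, hs.2, ht.2]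
      simp only at hst
      rw [hst]
  obtain ⟨u, hu, v, hv, huv⟩ := exists_gap hTc
  obtain ⟨s1, hs1, rfl⟩ := mem_image.1 hu
  obtain ⟨t1, ht1, rfl⟩ := mem_image.1 hv
  rw [mem_filter] at hs1 ht1
  have hd := hE _ ht1.1 _ hs1.1
  obtain ⟨d, hd2⟩ := Nat.exists_eq_add_of_le huv
  have e1 : t1 = s1 + β * (m + d) := by
    rw [← Nat.div_add_mod s1 β, ← Nat.div_add_mod t1 β, hs1.2, ht1.2, hd2]; ring
  have hmd : m + d ≤ H := by
    have := mem_range.1 (hS ht1.1)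
    have : m + d ≤ β * (m + d) := Nat.le_mul_of_pos_left _ (by omega)
    omega
  set γ := ((β : ZMod P) * x).valMinAbs with hγ
  have e2 : ((t1 : ZMod P) - (s1 : ZMod P)) * x = (((m + d : ℕ) * γ : ℤ) : ZMod P) := by
    rw [e1]
    push_cast
    rw [hγ, ZMod.coe_valMinAbs]; ring
  have hγE : γ.natAbs ≤ E := hEb
  rw [e2, nrm_eq, Int.natAbs_mul, Int.natAbs_natCast] at hd
  · refine le_trans ?_ hd
    exact Nat.mul_le_mul_right _ (by omega)
  · rw [Int.natAbs_mul, Int.natAbs_natCast]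
    refine lt_of_le_of_lt ?_ hP
    gcongr
end
end
section
section
variable {P : ℕ} [NeZero P]
def Maj (B : ℝ) (x : ZMod P) : Prop := ∃ b : ℕ, 0 < b ∧ (b : ℝ) ≤ B ∧ (nrm ((b : ZMod P) * x) : ℝ) ≤ B
lemma Maj.mono {B B' : ℝ} (h : B ≤ B') {x : ZMod P} : Maj B x → Maj B' x := by
  rintro ⟨b, h1, h2, h3⟩; exact ⟨b, h1, h2.trans h, h3.trans h⟩
lemma Maj.two {B : ℝ} {x : ZMod P} (hB : 0 ≤ B) : Maj B (2 * x) → Maj (2 * B) x := by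
  rintro ⟨b, h1, h2, h3⟩
  refine ⟨b * 2, by omega, by push_cast; linarith, ?_⟩
  have : (((b * 2 : ℕ) : ZMod P) * x) = (b : ZMod P) * (2 * x) := by push_cast; ring
  rw [this]; linarith
lemma weyl {M : ℕ} (hP : P = 8 * M ^ 2) {η : ℝ} (hη : 0 < η) (hη1 : η ≤ 1) (hM : 1 ≤ M * (η ^ 3 / 2048))
    (x : ZMod P) (h : η ≤ 𝔼 s : Fin ⌊η * M / 8⌋₊, 𝔼 s' : Fin ⌊η * M / 8⌋₊, ‖𝔼 y : Fin M,
      ee (((((s : ℕ) : ZMod P) - ((s' : ℕ) : ZMod P)) * x) * ((y : ℕ) : ZMod P))‖) : Maj (32768 / η ^ 4) x := by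
  classical
  have hη2 : η ^ 2 ≤ 1 := pow_le_one₀ hη.le hη1
  have hη3 : η ^ 3 ≤ η := by
    calc η ^ 3 = η * η ^ 2 := by ring
      _ ≤ η * 1 := by gcongr
      _ = η := mul_one _
  have hMη : 2048 ≤ η * M := by
    have : M * (η ^ 3 / 2048) ≤ M * (η / 2048) := by gcongr
    linarith
  have hMr : (0 : ℝ) < M := by
    by_contra hc
    have : (M : ℝ) = 0 := le_antisymm (not_lt.1 hc) (Nat.cast_nonneg _)
    rw [this] at hMη; linarith
  set H := ⌊η * M / 8⌋₊ with hH
  have hH1 : (H : ℝ) ≤ η * M / 8 := Nat.floor_le (by positivity)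
  have hH2 : η * M / 16 ≤ H := by
    have := Nat.lt_floor_add_one (η * M / 8); rw [← hH] at this; linarith
  have hHr : (0 : ℝ) < H := by linarith
  have hHpos : 0 < H := by exact_mod_cast hHr
  haveI : NeZero H := ⟨hHpos.ne'⟩
  have hηH : 128 ≤ η ^ 2 * H := by
    have : η ^ 2 * (η * M / 16) ≤ η ^ 2 * H := by gcongr
    have e : η ^ 2 * (η * M / 16) = 128 * (M * (η ^ 3 / 2048)) := by ring
    linarith
  have hηH' : 128 ≤ η * H := by
    have e : η ^ 2 ≤ η := by
      calc η ^ 2 = η * η := by ring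
        _ ≤ η * 1 := by gcongr
        _ = η := mul_one _
    have : η ^ 2 * H ≤ η * H := by gcongr
    linarith
  rw [E_comm] at h
  obtain ⟨s', hs'⟩ : ∃ s' : Fin H, η ≤ 𝔼 s : Fin H, ‖𝔼 y : Fin M,
      ee (((((s : ℕ) : ZMod P) - ((s' : ℕ) : ZMod P)) * x) * ((y : ℕ) : ZMod P))‖ := by
    exact E_exists h
  have h2 := ind_ge_of_E (p := fun s : Fin H => η / 2 ≤ ‖𝔼 y : Fin M,
      ee (((((s : ℕ) : ZMod P) - ((s' : ℕ) : ZMod P)) * x) * ((y : ℕ) : ZMod P))‖) (c := η / 2)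
      (fun s => E_norm_le_one fun y => (ee_norm _).le) (fun s hs => (not_le.1 hs).le) (by positivity)
  set S := (range H).filter (fun s : ℕ => η / 2 ≤ ‖𝔼 y : Fin M,
      ee ((((s : ZMod P) - ((s' : ℕ) : ZMod P)) * x) * ((y : ℕ) : ZMod P))‖) with hS
  have hcard : η / 2 * H ≤ S.card := by
    have e1 : (𝔼 s : Fin H, if η / 2 ≤ ‖𝔼 y : Fin M,
      ee (((((s : ℕ) : ZMod P) - ((s' : ℕ) : ZMod P)) * x) * ((y : ℕ) : ZMod P))‖ then (1 : ℝ) else 0) = S.card / H := by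
      rw [Fintype.expect_eq_sum_div_card, Fintype.card_fin]
      rw [Fin.sum_univ_eq_sum_range (fun s : ℕ => if η / 2 ≤ ‖𝔼 y : Fin M,
      ee ((((s : ZMod P) - ((s' : ℕ) : ZMod P)) * x) * ((y : ℕ) : ZMod P))‖ then (1 : ℝ) else 0)]
      rw [← sum_filter, sum_const, nsmul_eq_mul, mul_one]
    rw [e1] at h2
    rw [← le_div_iff₀ hHr]
    linarith
  obtain ⟨L, hL, hL1, hL2⟩ := exists_inv_nat (t := η / 8) (by positivity) (by linarith)
  have hLr : (0 : ℝ) < L := by exact_mod_cast hL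
  set m := ⌊η * H / (4 * L)⌋₊ with hm
  have hL3 : 1 ≤ η / 8 * L := by rwa [div_le_iff₀ hLr] at hL1
  have hL4 : η / 16 * L ≤ 1 := by
    rw [le_div_iff₀ hLr] at hL2; linarith
  have hmm : η ^ 2 * H / 64 ≤ η * H / (4 * L) := by
    rw [div_le_div_iff₀ (by norm_num) (by positivity)]
    have : η * H * (η / 16 * L) ≤ η * H * 1 := by gcongr
    linarith
  have hm1 : (m : ℝ) ≤ η * H / (4 * L) := Nat.floor_le (by positivity)
  have hm2 : η ^ 2 * H / 128 ≤ m := by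
    have := Nat.lt_floor_add_one (η * H / (4 * L)); rw [← hm] at this; linarith
  have hmpos : 0 < m := by
    have : (0 : ℝ) < m := by linarith
    exact_mod_cast this
  set E := 2 * ⌊8 * M / η⌋₊ with hE
  have hE1 : (E : ℝ) ≤ 16 * M / η := by
    have : (⌊8 * M / η⌋₊ : ℝ) ≤ 8 * M / η := Nat.floor_le (by positivity)
    rw [hE]; push_cast
    calc _ ≤ 2 * (8 * M / η) := by linarith
      _ = _ := by ring
  have hnr : ∀ s ∈ S, nrm (((s : ZMod P) - ((s' : ℕ) : ZMod P)) * x) ≤ ⌊8 * M / η⌋₊ := by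
    intro s hs
    have := geo _ (mem_filter.1 hs).2
    apply Nat.le_floor
    rw [le_div_iff₀ hη]
    have e : (P : ℝ) = 8 * M ^ 2 := by exact_mod_cast hP
    rw [e] at this
    refine le_of_mul_le_mul_right ?_ hMr
    calc _ = _ := ?_
      _ ≤ _ := this
      _ = _ := by ring
    ring
  obtain ⟨b, hb, hbL, hbn⟩ := dense_major (H := H) (L := L) (E := E) (m := m) hL x S (filter_subset _ _) (by
      have a1 : ((H / L : ℕ) : ℝ) ≤ H / L := Nat.cast_div_le
      have a2 : (H / L : ℝ) ≤ H * (η / 8) := by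
        calc (H / L : ℝ) = H * (1 / L) := by ring
          _ ≤ _ := by gcongr
      have : ((H / L + 1 : ℕ) : ℝ) < S.card := by push_cast; linarith
      exact_mod_cast this) hmpos (by
      have : (L : ℝ) * m ≤ η * H / 4 := by
        calc (L : ℝ) * m ≤ L * (η * H / (4 * L)) := by gcongr
          _ = _ := by field_simp
      have : ((L * m : ℕ) : ℝ) < S.card := by push_cast; linarith
      exact_mod_cast this) (by
      intro s hs t ht
      have e : ((s : ZMod P) - (t : ZMod P)) * x = ((s : ZMod P) - ((s' : ℕ) : ZMod P)) * x - ((t : ZMod P) - ((s' : ℕ) : ZMod P)) * x := by ring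
      rw [e]
      refine (nrm_sub _ _).trans ?_
      have := hnr s hs; have := hnr t ht; omega) (by
      have : (H : ℝ) * E ≤ η * M / 8 * (16 * M / η) := by gcongr
      have e : η * M / 8 * (16 * M / η) = 2 * (M : ℝ) ^ 2 := by field_simp; ring
      rw [e] at this
      have h6 : (0 : ℝ) < (M : ℝ) ^ 2 := by positivity
      have : ((2 * (H * E) : ℕ) : ℝ) < P := by rw [hP]; push_cast; linarith
      exact_mod_cast this)
  refine ⟨b, hb, ?_, ?_⟩
  · have h1 : (b : ℝ) ≤ L := by exact_mod_cast hbL.le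
    refine h1.trans ?_
    rw [le_div_iff₀ (by positivity)]
    have : L * η ^ 4 ≤ L * η := by
      gcongr
      calc η ^ 4 = η ^ 3 * η := by ring
        _ ≤ 1 * η := by gcongr; linarith
        _ = η := one_mul _
    linarith
  · have h1 : (m : ℝ) * nrm ((b : ZMod P) * x) ≤ E := by exact_mod_cast hbn
    have h2 : η ^ 3 * M / 2048 ≤ m := by
      refine le_trans ?_ hm2
      calc η ^ 3 * M / 2048 = η ^ 2 * (η * M / 16) / 128 := by ring
        _ ≤ _ := by gcongr
    have h3 : η ^ 3 * M / 2048 * nrm ((b : ZMod P) * x) ≤ 16 * M / η :=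
      le_trans (by gcongr) (h1.trans hE1)
    rw [le_div_iff₀ (by positivity)]
    rw [le_div_iff₀ hη] at h3
    refine le_of_mul_le_mul_right ?_ hMr
    linarith
end
end
section
section
variable {P : ℕ} [NeZero P]
lemma card_sol {b : ℕ} (hb : 0 < b) (v : ZMod P) : (univ.filter (fun x : ZMod P => (b : ZMod P) * x = v)).card ≤ b := by
  refine (card_le_card_of_injOn (t := range b) (fun x => b * x.val / P) ?_ ?_).trans_eq (card_range b)
  · intro x _
    simp only [coe_range, Set.mem_Iio]
    rw [Nat.div_lt_iff_lt_mul (NeZero.pos P)]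
    exact Nat.mul_lt_mul_of_pos_left (ZMod.val_lt x) hb
  · intro x hx y hy hxy
    simp only [coe_filter, mem_univ, true_and, Set.mem_setOf_eq] at hx hy hxy
    have e : ∀ x : ZMod P, (b : ZMod P) * x = v → b * x.val % P = v.val := by
      intro x hx
      rw [← hx, ZMod.val_mul, ZMod.val_natCast, Nat.mod_mul_mod]
    have h1 : b * x.val = b * y.val := by
      rw [← Nat.div_add_mod (b * x.val) P, ← Nat.div_add_mod (b * y.val) P, e x hx, e y hy, hxy]
    exact ZMod.val_injective P (Nat.eq_of_mul_eq_mul_left hb h1)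
open Classical in
lemma card_Maj {B : ℝ} (hB : 1 ≤ B) : ((univ.filter (fun x : ZMod P => Maj B x)).card : ℝ) ≤ 3 * B ^ 3 := by
  set n := ⌊B⌋₊ with hn
  have hnB : (n : ℝ) ≤ B := Nat.floor_le (by linarith)
  have hn1 : 1 ≤ n := Nat.le_floor (by simpa using hB)
  have hsub : (univ.filter (fun x : ZMod P => Maj B x)) ⊆
      (Icc 1 n ×ˢ Icc (-(n : ℤ)) n).biUnion (fun p => univ.filter (fun x : ZMod P => (p.1 : ZMod P) * x = (p.2 : ZMod P))) := by
    intro x hx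
    obtain ⟨b, h1, h2, h3⟩ := (mem_filter.1 hx).2
    have h2' : b ≤ n := Nat.le_floor h2
    have h3' : nrm ((b : ZMod P) * x) ≤ n := Nat.le_floor h3
    rw [mem_biUnion]
    refine ⟨(b, ((b : ZMod P) * x).valMinAbs), ?_, ?_⟩
    · rw [mem_product, mem_Icc, mem_Icc]
      unfold nrm at h3'
      refine ⟨⟨h1, h2'⟩, ?_, ?_⟩ <;> simp only <;> omega
    · simp
  have h1 : (univ.filter (fun x : ZMod P => Maj B x)).card ≤ (Icc 1 n ×ˢ Icc (-(n : ℤ)) n).card * n := by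
    refine (card_le_card hsub).trans (card_biUnion_le_card_mul _ _ _ ?_)
    intro p hp
    rw [mem_product, mem_Icc] at hp
    exact (card_sol (by omega) _).trans hp.1.2
  have h2 : (Icc 1 n ×ˢ Icc (-(n : ℤ)) n).card = n * (2 * n + 1) := by
    rw [card_product, Nat.card_Icc, Int.card_Icc]
    have : ((n : ℤ) + 1 - -(n : ℤ)).toNat = 2 * n + 1 := by omega
    rw [this]; simp
  rw [h2] at h1
  have h3 : n * (2 * n + 1) * n ≤ 3 * n ^ 3 := by
    have : n * (2 * n + 1) * n ≤ n * (3 * n) * n := by gcongr; omega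
    exact this.trans (le_of_eq (by ring))
  calc ((univ.filter (fun x : ZMod P => Maj B x)).card : ℝ) ≤ ((3 * n ^ 3 : ℕ) : ℝ) := by exact_mod_cast h1.trans h3
    _ = 3 * (n : ℝ) ^ 3 := by push_cast; rfl
    _ ≤ _ := by gcongr
variable {G : Type} [AddCommGroup G] [Fintype G]
noncomputable def Sm (M : ℕ) (g : G) (G0 g1 : G → ℂ) (a : G → ZMod P) : ℂ :=
  𝔼 x, G0 x * 𝔼 y : Fin M, g1 (x + ((y : ℕ) + 1) • g) * ee (a x * (((y : ℕ) : ZMod P) + 1) ^ 2)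
lemma mal_const {M : ℕ} (hP : P = 8 * M ^ 2) (g : G) {G0 g1 : G → ℂ} (h0 : ∀ x, ‖G0 x‖ ≤ 1) (h1 : ∀ x, ‖g1 x‖ ≤ 1)
    (A : ZMod P) {η : ℝ} (hη : 0 < η) (hη1 : η ≤ 1) (hM : 1 ≤ M * ((η ^ 2 / 4) ^ 3 / 2048))
    (h : η ≤ ‖Sm M g G0 g1 (fun _ => A)‖) : Maj (2 * (32768 / (η ^ 2 / 4) ^ 4)) A := by
  set η' := η ^ 2 / 4 with hη'
  have hη2 : η ^ 2 ≤ η := by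
    calc η ^ 2 = η * η := by ring
        _ ≤ η * 1 := by gcongr
        _ = η := mul_one _
  have hp' : 0 < η' := by positivity
  have hp1 : η' ≤ η / 4 := by linarith
  have hMr : (0 : ℝ) < M := by
    by_contra hc
    have : (M : ℝ) = 0 := le_antisymm (not_lt.1 hc) (Nat.cast_nonneg _)
    rw [this] at hM; linarith
  have hη3 : η' ^ 3 ≤ η' := pow_le_of_le_one hp'.le (by linarith) (by norm_num)
  have hMη : 2048 ≤ η' * M := by
    have : M * (η' ^ 3 / 2048) ≤ M * (η' / 2048) := by gcongr
    linarith
  set H := ⌊η' * M / 8⌋₊ with hH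
  have hH1 : (H : ℝ) ≤ η' * M / 8 := Nat.floor_le (by positivity)
  have hHpos : 0 < H := Nat.floor_pos.2 (by linarith)
  have key := shift_kill (H := H) hHpos (a := G0) (u := fun x y => g1 (x + (y + 1) • g) * ee (A * ((y : ZMod P) + 1) ^ 2)) h0
    (fun x y => norm_mul_le_one (h1 _) (ee_norm _).le) hη.le h (by
      rw [div_le_iff₀ hMr]
      have : η' * M ≤ η / 4 * M := by gcongr
      linarith)
  apply Maj.two (by positivity)
  apply weyl hP hp' (by linarith) hM
  refine key.trans ?_
  refine (E_norm_le _).trans (E_mono fun s => (E_norm_le _).trans (E_mono fun s' => ?_))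
  have e : 𝔼 x, 𝔼 y : Fin M, (g1 (x + ((y : ℕ) + s + 1) • g) * ee (A * ((((y : ℕ) + s : ℕ) : ZMod P) + 1) ^ 2)) *
      conj (g1 (x + ((y : ℕ) + s' + 1) • g) * ee (A * ((((y : ℕ) + s' : ℕ) : ZMod P) + 1) ^ 2)) =
      (𝔼 x, g1 (x + ((s : ℕ) + 1) • g) * conj (g1 (x + ((s' : ℕ) + 1) • g))) * (ee (A * ((((s : ℕ) : ZMod P) + 1) ^ 2 - (((s' : ℕ) : ZMod P) + 1) ^ 2)) *
      𝔼 y : Fin M, ee (((((s : ℕ) : ZMod P) - ((s' : ℕ) : ZMod P)) * (2 * A)) * ((y : ℕ) : ZMod P))) := by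
    rw [E_comm, mul_expect, mul_expect]
    refine congrArg _ (funext fun y => ?_)
    rw [← E_shift (fun x => _) ((-((y : ℕ) : ℤ)) • g), expect_mul]
    refine congrArg _ (funext fun x => ?_)
    have e1 : ∀ s : ℕ, x + (-((y : ℕ) : ℤ)) • g + ((y : ℕ) + s + 1) • g = x + (s + 1) • g := by
      intro s
      simp only [add_smul, neg_smul, natCast_zsmul]; abel
    rw [e1, e1, map_mul, ← ee_add, mul_mul_mul_comm, ← ee_sub]
    congr 2
    push_cast; ring
  rw [e, norm_mul, norm_mul, ee_norm, one_mul]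
  refine mul_le_of_le_one_left (norm_nonneg _) (E_norm_le_one fun x => norm_mul_le_one (h1 _) ?_)
  rw [RCLike.norm_conj]; exact h1 _
end
end
section
section
variable {P : ℕ} [NeZero P] {G : Type} [AddCommGroup G] [Fintype G]
structure Fib (i : ZMod P →+ G) (g : G) (q : ℕ) (ρ : G → G) (ζ : G → ZMod P) : Prop where
  hx : ∀ x, ρ x + i (ζ x) = x
  hρ : ∀ x z, ρ (x + i z) = ρ x
  hζ : ∀ x z, ζ (x + i z) = ζ x + z
  hq : 0 < q
  heq : ∀ φ : G → ℝ, (∀ x z, φ (x + i z) = φ x) → ∀ x, 𝔼 k : Fin q, φ (x - (k : ℕ) • g) = 𝔼 x, φ x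
open Classical in
lemma mal_ii1 {M H q : ℕ} (hH : 0 < H) (hq : 0 < q) (g : G) {G0 g1 : G → ℂ} (h0 : ∀ x, ‖G0 x‖ ≤ 1) (h1 : ∀ x, ‖g1 x‖ ≤ 1)
    (a : G → ZMod P) (S : G → Prop) (hsupp : ∀ x, ¬ S x → G0 x = 0) {η : ℝ} (hη : 0 < η)
    (hHM : 2 * (H : ℝ) / M ≤ η / 2) (hqM : 2 * (q : ℝ) / M ≤ η ^ 2 / 4 / 2)
    (h : η ≤ ‖Sm M g G0 g1 a‖) :
    η ^ 4 / 64 ≤ 𝔼 x, 𝔼 k : Fin q, 𝔼 k' : Fin q, if S (x - (k : ℕ) • g) ∧ S (x - (k' : ℕ) • g) then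
      𝔼 s : Fin H, 𝔼 s' : Fin H, ‖𝔼 y : Fin M,
      ee (((((s : ℕ) : ZMod P) - ((s' : ℕ) : ZMod P)) * (2 * (a (x - (k : ℕ) • g) - a (x - (k' : ℕ) • g)))) * ((y : ℕ) : ZMod P))‖ else 0 := by
  set iS : G → ℂ := fun x => if S x then 1 else 0 with hiS
  have hiS1 : ∀ x, ‖iS x‖ ≤ 1 := by intro x; simp only [hiS]; split_ifs <;> simp
  have hSm : Sm M g G0 g1 a = 𝔼 x, G0 x * 𝔼 y : Fin M, iS x * (g1 (x + ((y : ℕ) + 1) • g) * ee (a x * (((y : ℕ) : ZMod P) + 1) ^ 2)) := by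
    rw [Sm]
    refine congrArg _ (funext fun x => ?_)
    by_cases hx : S x
    · simp [hiS, hx]
    · rw [hsupp x hx]; simp
  rw [hSm] at h
  have key := shift_kill (H := H) hH (a := G0) (u := fun x y => iS x * (g1 (x + (y + 1) • g) * ee (a x * ((y : ZMod P) + 1) ^ 2))) h0
    (fun x y => norm_mul_le_one (hiS1 _) (norm_mul_le_one (h1 _) (ee_norm _).le)) hη.le h hHM
  let w : Fin H × Fin H × G → ℕ → ℂ := fun p y => iS (p.2.2 - y • g) * ee (a (p.2.2 - y • g) * (((y : ZMod P) + ((p.1 : ℕ) : ZMod P) + 1) ^ 2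
      - ((y : ZMod P) + ((p.2.1 : ℕ) : ZMod P) + 1) ^ 2))
  let A : Fin H × Fin H × G → ℂ := fun p => g1 (p.2.2 + ((p.1 : ℕ) + 1) • g) * conj (g1 (p.2.2 + ((p.2.1 : ℕ) + 1) • g))
  have e1 : (𝔼 s : Fin H, 𝔼 s' : Fin H, 𝔼 x, 𝔼 y : Fin M, (iS x * (g1 (x + ((y : ℕ) + s + 1) • g) * ee (a x * ((((y : ℕ) + s : ℕ) : ZMod P) + 1) ^ 2))) *
      conj (iS x * (g1 (x + ((y : ℕ) + s' + 1) • g) * ee (a x * ((((y : ℕ) + s' : ℕ) : ZMod P) + 1) ^ 2)))) =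
      𝔼 p : Fin H × Fin H × G, A p * 𝔼 y : Fin M, w p y := by
    rw [E_prod]
    refine congrArg _ (funext fun s => ?_)
    rw [E_prod]
    refine congrArg _ (funext fun s' => ?_)
    rw [E_comm]
    simp only [mul_expect]
    refine Eq.trans ?_ (E_comm _)
    refine congrArg _ (funext fun y => ?_)
    rw [← E_shift (fun x => _) ((-((y : ℕ) : ℤ)) • g)]
    refine congrArg _ (funext fun x => ?_)
    have e1 : ∀ s : ℕ, x + (-((y : ℕ) : ℤ)) • g + ((y : ℕ) + s + 1) • g = x + (s + 1) • g := by
      intro s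
      simp only [add_smul, neg_smul, natCast_zsmul]; abel
    have e2 : x + (-((y : ℕ) : ℤ)) • g = x - (y : ℕ) • g := by
      simp only [neg_smul, natCast_zsmul]; abel
    rw [e1, e1, e2]
    simp only [A, w, mul_sub, ee_sub, map_mul]
    have e3 : iS (x - (y : ℕ) • g) * conj (iS (x - (y : ℕ) • g)) = iS (x - (y : ℕ) • g) := by
      simp only [hiS]; split_ifs <;> simp
    push_cast
    rw [mul_mul_mul_comm, e3]
    ring
  rw [e1] at key
  have hwb : ∀ p y, ‖w p y‖ ≤ 1 := fun p y => norm_mul_le_one (hiS1 _) (ee_norm _).le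
  have key2 := shift_kill (H := q) hq (a := A) (u := w) (fun p => norm_mul_le_one (h1 _) (by rw [RCLike.norm_conj]; exact h1 _))
    hwb (by positivity) key hqM
  have e4 : (η ^ 2 / 4) ^ 2 / 4 = η ^ 4 / 64 := by ring
  rw [e4] at key2
  refine key2.trans ?_
  rw [E_comm]
  have hr : ∀ k k' : Fin q, ‖𝔼 p : Fin H × Fin H × G, 𝔼 y : Fin M, w p (y + k) * conj (w p (y + k'))‖ ≤
      𝔼 x, if S (x - (k : ℕ) • g) ∧ S (x - (k' : ℕ) • g) then
      𝔼 s : Fin H, 𝔼 s' : Fin H, ‖𝔼 y : Fin M,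
      ee (((((s : ℕ) : ZMod P) - ((s' : ℕ) : ZMod P)) * (2 * (a (x - (k : ℕ) • g) - a (x - (k' : ℕ) • g)))) * ((y : ℕ) : ZMod P))‖ else 0 := by
    intro k k'
    rw [E_prod]
    refine (E_norm_le _).trans ?_
    have e5 : ∀ s : Fin H, ‖𝔼 r : Fin H × G, 𝔼 y : Fin M, w (s, r) (y + k) * conj (w (s, r) (y + k'))‖ ≤
       𝔼 x, if S (x - (k : ℕ) • g) ∧ S (x - (k' : ℕ) • g) then 𝔼 s' : Fin H, ‖𝔼 y : Fin M,
      ee (((((s : ℕ) : ZMod P) - ((s' : ℕ) : ZMod P)) * (2 * (a (x - (k : ℕ) • g) - a (x - (k' : ℕ) • g)))) * ((y : ℕ) : ZMod P))‖ else 0 := by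
      intro s
      rw [E_prod]
      refine (E_norm_le _).trans ?_
      have e6 : ∀ s' : Fin H, ‖𝔼 x : G, 𝔼 y : Fin M, w (s, s', x) (y + k) * conj (w (s, s', x) (y + k'))‖ ≤
         𝔼 x, if S (x - (k : ℕ) • g) ∧ S (x - (k' : ℕ) • g) then ‖𝔼 y : Fin M,
         ee (((((s : ℕ) : ZMod P) - ((s' : ℕ) : ZMod P)) * (2 * (a (x - (k : ℕ) • g) - a (x - (k' : ℕ) • g)))) * ((y : ℕ) : ZMod P))‖ else 0 := by
        intro s'
        have e7 : 𝔼 x : G, 𝔼 y : Fin M, w (s, s', x) (y + k) * conj (w (s, s', x) (y + k')) =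
           𝔼 x : G, (iS (x - (k : ℕ) • g) * iS (x - (k' : ℕ) • g)) * (ee ((((s : ℕ) : ZMod P) - ((s' : ℕ) : ZMod P)) *
            (a (x - (k : ℕ) • g) * (2 * ((k : ℕ) : ZMod P) + ((s : ℕ) : ZMod P) + ((s' : ℕ) : ZMod P) + 2) -
             a (x - (k' : ℕ) • g) * (2 * ((k' : ℕ) : ZMod P) + ((s : ℕ) : ZMod P) + ((s' : ℕ) : ZMod P) + 2))) *
              𝔼 y : Fin M, ee (((((s : ℕ) : ZMod P) - ((s' : ℕ) : ZMod P)) * (2 * (a (x - (k : ℕ) • g) - a (x - (k' : ℕ) • g)))) * ((y : ℕ) : ZMod P))) := by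
          rw [E_comm]
          simp only [mul_expect]
          refine Eq.trans ?_ (E_comm _)
          refine congrArg _ (funext fun y => ?_)
          rw [← E_shift (fun x => _) (((y : ℕ)) • g)]
          refine congrArg _ (funext fun x => ?_)
          have e1 : ∀ k : ℕ, x + (y : ℕ) • g - ((y : ℕ) + k) • g = x - k • g := by
            intro s
            simp only [add_smul]; abel
          have e3 : conj (iS (x - (k' : ℕ) • g)) = iS (x - (k' : ℕ) • g) := by
            simp only [hiS]; split_ifs <;> simp
          simp only [w, e1, map_mul, e3]
          rw [mul_mul_mul_comm, ← ee_sub, ← ee_add]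
          congr 2
          push_cast
          ring
        rw [e7]
        refine (E_norm_le _).trans (E_mono fun x => ?_)
        rw [norm_mul, norm_mul, norm_mul, ee_norm, one_mul]
        simp only [hiS]
        by_cases hk : S (x - (k : ℕ) • g) <;> by_cases hk' : S (x - (k' : ℕ) • g) <;> simp [hk, hk']
      refine (E_mono e6).trans (le_of_eq ?_)
      rw [E_comm]
      refine congrArg _ (funext fun x => ?_)
      split_ifs
      · rfl
      · simp
    refine (E_mono e5).trans (le_of_eq ?_)
    rw [E_comm]
    refine congrArg _ (funext fun x => ?_)
    split_ifs
    · rfl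
    · simp
  refine (E_norm_le _).trans ?_
  refine (E_mono fun k' => (E_norm_le _).trans (E_mono fun k => hr k k')).trans (le_of_eq ?_)
  rw [E_comm]
  simp only [E_comm (ι := Fin q) (κ := G)]
end
end
section
section
variable {P : ℕ} [NeZero P] {G : Type} [AddCommGroup G] [Fintype G]
lemma Maj_zero {B : ℝ} (hB : 1 ≤ B) : Maj B (0 : ZMod P) := ⟨1, one_pos, by simpa using hB, by simp [nrm]; linarith⟩
lemma small_floor {M : ℕ} {t : ℝ} (ht : 0 < t) (ht1 : t ≤ 1) (hM : 1 ≤ M * (t ^ 3 / 2048)) :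
    (0 : ℝ) < M ∧ 0 < ⌊t * M / 8⌋₊ ∧ 2 * (⌊t * M / 8⌋₊ : ℝ) / M ≤ t / 4 := by
  have hMr : (0 : ℝ) < M := by
    by_contra hc
    have : (M : ℝ) = 0 := le_antisymm (not_lt.1 hc) (Nat.cast_nonneg _)
    rw [this] at hM; linarith
  have hη3 : t ^ 3 ≤ t := pow_le_of_le_one ht.le ht1 (by norm_num)
  have hMη : 2048 ≤ t * M := by
    have : M * (t ^ 3 / 2048) ≤ M * (t / 2048) := by gcongr
    linarith
  have hH1 : (⌊t * M / 8⌋₊ : ℝ) ≤ t * M / 8 := Nat.floor_le (by positivity)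
  refine ⟨hMr, Nat.floor_pos.2 (by linarith), ?_⟩
  rw [div_le_iff₀ hMr]; linarith
open Classical in
lemma mal_ii {M q : ℕ} (hP : P = 8 * M ^ 2) {i : ZMod P →+ G} {g : G} {ρ : G → G} {ζ : G → ZMod P} (hF : Fib i g q ρ ζ)
    {G0 g1 : G → ℂ} (h0 : ∀ x, ‖G0 x‖ ≤ 1) (h1 : ∀ x, ‖g1 x‖ ≤ 1)
    (a : G → ZMod P) (S : G → Prop) (hsupp : ∀ x, ¬ S x → G0 x = 0) (ha : ∀ x z, a (x + i z) = a x)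
    (hS : ∀ x z, S (x + i z) ↔ S x) {η t : ℝ} (hη : 0 < η) (hη1 : η ≤ 1) (et : t = η ^ 4 / 128)
    (hM : 1 ≤ M * (t ^ 3 / 2048)) (hqM : 2 * (q : ℝ) / M ≤ η ^ 2 / 8)
    (h : η ≤ ‖Sm M g G0 g1 a‖) :
    ∃ A, t / (3 * (2 * (32768 / t ^ 4)) ^ 3) ≤ 𝔼 x, if S x ∧ a x = A then (1 : ℝ) else 0 := by
  have ht : 0 < t := by rw [et]; positivity
  have hη4 : η ^ 4 ≤ η := pow_le_of_le_one hη.le hη1 (by norm_num)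
  have htη : t ≤ η / 128 := by rw [et]; linarith
  have ht1 : t ≤ 1 := by linarith
  obtain ⟨hMr, hH, hHM⟩ := small_floor ht ht1 hM
  have key := mal_ii1 hH hF.hq g h0 h1 a S hsupp hη (by linarith) (by linarith) h
  set H := ⌊t * M / 8⌋₊
  set B := 2 * (32768 / t ^ 4) with hB
  have hB1 : 1 ≤ B := by
    have h4 : t ^ 4 ≤ 1 := pow_le_one₀ ht.le ht1
    have : 1 ≤ 32768 / t ^ 4 := by rw [le_div_iff₀ (by positivity)]; linarith
    linarith
  haveI : NeZero q := ⟨hF.hq.ne'⟩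
  have h2 : t ≤ 𝔼 x, 𝔼 k : Fin q, 𝔼 k' : Fin q, if S (x - (k : ℕ) • g) ∧ S (x - (k' : ℕ) • g) ∧
      Maj B (a (x - (k : ℕ) • g) - a (x - (k' : ℕ) • g)) then (1 : ℝ) else 0 := by
    have : η ^ 4 / 64 ≤ (𝔼 x, 𝔼 k : Fin q, 𝔼 k' : Fin q, if S (x - (k : ℕ) • g) ∧ S (x - (k' : ℕ) • g) ∧
      Maj B (a (x - (k : ℕ) • g) - a (x - (k' : ℕ) • g)) then (1 : ℝ) else 0) + t := by
      refine key.trans ?_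
      rw [← E_const (ι := G) t, ← expect_add_distrib]
      refine E_mono fun x => ?_
      rw [← E_const (ι := Fin q) t, ← expect_add_distrib]
      refine E_mono fun k => ?_
      rw [← E_const (ι := Fin q) t, ← expect_add_distrib]
      refine E_mono fun k' => ?_
      by_cases hs : S (x - (k : ℕ) • g) ∧ S (x - (k' : ℕ) • g)
      · rw [if_pos hs]
        by_cases hw : t ≤ 𝔼 s : Fin H, 𝔼 s' : Fin H, ‖𝔼 y : Fin M,
          ee (((((s : ℕ) : ZMod P) - ((s' : ℕ) : ZMod P)) * (2 * (a (x - (k : ℕ) • g) - a (x - (k' : ℕ) • g)))) * ((y : ℕ) : ZMod P))‖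
        · have := weyl hP ht ht1 hM _ hw
          rw [if_pos ⟨hs.1, hs.2, this.two (by positivity)⟩]
          have : (𝔼 s : Fin H, 𝔼 s' : Fin H, ‖𝔼 y : Fin M,
           ee (((((s : ℕ) : ZMod P) - ((s' : ℕ) : ZMod P)) * (2 * (a (x - (k : ℕ) • g) - a (x - (k' : ℕ) • g)))) * ((y : ℕ) : ZMod P))‖) ≤ 1 :=
            E_le_const zero_le_one fun s => E_le_const zero_le_one fun s' => E_norm_le_one fun y => (ee_norm _).le
          linarith
        · refine (not_le.1 hw).le.trans ?_
          have : (0 : ℝ) ≤ if S (x - (k : ℕ) • g) ∧ S (x - (k' : ℕ) • g) ∧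
            Maj B (a (x - (k : ℕ) • g) - a (x - (k' : ℕ) • g)) then (1 : ℝ) else 0 := by split_ifs <;> norm_num
          linarith
      · rw [if_neg hs]
        have : (0 : ℝ) ≤ if S (x - (k : ℕ) • g) ∧ S (x - (k' : ℕ) • g) ∧
            Maj B (a (x - (k : ℕ) • g) - a (x - (k' : ℕ) • g)) then (1 : ℝ) else 0 := by split_ifs <;> norm_num
        linarith
    linarith
  obtain ⟨x, hx⟩ := E_exists h2
  obtain ⟨k, hk⟩ := E_exists hx
  set MM := univ.filter (fun x : ZMod P => Maj B x) with hMM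
  set α := a (x - (k : ℕ) • g) with hα
  have h3 : t ≤ ∑ ξ ∈ MM, 𝔼 x, if S x ∧ a x = α - ξ then (1 : ℝ) else 0 := by
    have e : ∀ ξ, (𝔼 x, if S x ∧ a x = α - ξ then (1 : ℝ) else 0) =
        𝔼 k' : Fin q, if S (x - (k' : ℕ) • g) ∧ a (x - (k' : ℕ) • g) = α - ξ then (1 : ℝ) else 0 := by
      intro ξ
      exact (hF.heq (fun x => if S x ∧ a x = α - ξ then (1 : ℝ) else 0) (fun x z => by simp only [hS, ha]) x).symm
    simp only [e]
    rw [← expect_sum_comm]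
    refine hk.trans (E_mono fun k' => ?_)
    split_ifs with hc
    · have hmem : α - a (x - (k' : ℕ) • g) ∈ MM := mem_filter.2 ⟨mem_univ _, hc.2.2⟩
      refine le_trans ?_ (single_le_sum (fun ξ _ => ?_) hmem)
      · rw [if_pos ⟨hc.2.1, by ring⟩]
      · split_ifs <;> norm_num
    · exact sum_nonneg fun ξ _ => by split_ifs <;> norm_num
  have hMc : (MM.card : ℝ) ≤ 3 * B ^ 3 := card_Maj hB1
  obtain ⟨ξ, hξ, hle⟩ := exists_le_of_sum_le (s := MM) (f := fun _ => t / (3 * B ^ 3)) (g := fun ξ => 𝔼 x, if S x ∧ a x = α - ξ then (1 : ℝ) else 0)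
    ⟨0, mem_filter.2 ⟨mem_univ _, Maj_zero hB1⟩⟩ (by
      refine le_trans ?_ h3
      rw [sum_const, nsmul_eq_mul]
      calc (MM.card : ℝ) * (t / (3 * B ^ 3)) ≤ 3 * B ^ 3 * (t / (3 * B ^ 3)) := by gcongr
        _ = t := by field_simp)
  exact ⟨_, hle⟩
lemma Sm_add {M : ℕ} (g : G) (A B g1 : G → ℂ) (a : G → ZMod P) : Sm M g (fun x => A x + B x) g1 a = Sm M g A g1 a + Sm M g B g1 a := by
  simp only [Sm, add_mul, expect_add_distrib]
lemma Sm_sum {M : ℕ} {J : Type*} (s : Finset J) (g : G) (A : J → G → ℂ) (g1 : G → ℂ) (a : G → ZMod P) :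
    Sm M g (fun x => ∑ j ∈ s, A j x) g1 a = ∑ j ∈ s, Sm M g (A j) g1 a := by
  simp only [Sm, sum_mul, expect_sum_comm]
open Classical in
lemma mal {M q : ℕ} (hP : P = 8 * M ^ 2) {i : ZMod P →+ G} {g : G} {ρ : G → G} {ζ : G → ZMod P} (hF : Fib i g q ρ ζ)
    {G0 g1 : G → ℂ} (h0 : ∀ x, ‖G0 x‖ ≤ 1) (h1 : ∀ x, ‖g1 x‖ ≤ 1)
    (a : G → ZMod P) (S : G → Prop) (hsupp : ∀ x, ¬ S x → G0 x = 0) (ha : ∀ x z, a (x + i z) = a x)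
    (hS : ∀ x z, S (x + i z) ↔ S x) {η t θ κ : ℝ} (hη : 0 < η) (hη1 : η ≤ 1) (et : t = (η / 2) ^ 4 / 128)
    (eθ : θ = t / (3 * (2 * (32768 / t ^ 4)) ^ 3)) (eκ : κ = η / 2 * θ)
    (hM : 1 ≤ M * (t ^ 3 / 2048)) (hM2 : 1 ≤ M * ((κ ^ 2 / 4) ^ 3 / 2048)) (hqM : 2 * (q : ℝ) / M ≤ (η / 2) ^ 2 / 8)
    (h : η ≤ ‖Sm M g G0 g1 a‖) :
    ∃ x, S x ∧ Maj (2 * (32768 / (κ ^ 2 / 4) ^ 4)) (a x) := by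
  have ht : 0 < t := by rw [et]; positivity
  have hη4 : (η / 2) ^ 4 ≤ (η / 2) := pow_le_of_le_one (by positivity) (by linarith) (by norm_num)
  have ht1 : t ≤ 1 := by rw [et]; linarith
  have hθ : 0 < θ := by rw [eθ]; positivity
  have hθ1 : θ ≤ 1 := by
    rw [eθ, div_le_one (by positivity)]
    have h4 : t ^ 4 ≤ 1 := pow_le_one₀ ht.le ht1
    have : 1 ≤ 32768 / t ^ 4 := by rw [le_div_iff₀ (by positivity)]; linarith
    have : 1 ≤ (2 * (32768 / t ^ 4)) ^ 3 := one_le_pow₀ (by linarith)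
    linarith
  have hκ : 0 < κ := by rw [eκ]; positivity
  have hκ1 : κ ≤ 1 := by rw [eκ]; exact mul_le_one₀ (by linarith) hθ.le hθ1
  let m : ZMod P → ℝ := fun A => 𝔼 x, if S x ∧ a x = A then (1 : ℝ) else 0
  have hm0 : ∀ A, 0 ≤ m A := fun A => E_nonneg fun x => by split_ifs <;> norm_num
  have hsum : ∑ A, m A ≤ 1 := by
    simp only [m]
    rw [← expect_sum_comm]
    refine E_le_const zero_le_one fun x => ?_
    by_cases hx : S x
    · simp [hx]
    · simp [hx]
  set 𝒜 := univ.filter (fun A => θ ≤ m A) with h𝒜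
  have hcard : (𝒜.card : ℝ) * θ ≤ 1 := by
    rw [← nsmul_eq_mul, ← sum_const]
    refine le_trans ?_ hsum
    refine le_trans (sum_le_sum fun A hA => (mem_filter.1 hA).2) ?_
    exact sum_le_sum_of_subset_of_nonneg (subset_univ _) fun A _ _ => hm0 A
  let Gb : G → ℂ := fun x => if m (a x) < θ then G0 x else 0
  let GA : ZMod P → G → ℂ := fun A x => if a x = A then G0 x else 0
  have hGb : ∀ x, ‖Gb x‖ ≤ 1 := by intro x; simp only [Gb]; split_ifs; exacts [h0 x, by simp]
  have hGA : ∀ A x, ‖GA A x‖ ≤ 1 := by intro A x; simp only [GA]; split_ifs; exacts [h0 x, by simp]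
  have hdec : G0 = fun x => Gb x + ∑ A ∈ 𝒜, GA A x := by
    funext x
    simp only [Gb, GA]
    rw [sum_ite_eq]
    by_cases hx : m (a x) < θ
    · rw [if_pos hx, if_neg]
      · simp
      · rw [h𝒜, mem_filter]; push Not; exact fun _ => hx
    · rw [if_neg hx, if_pos]
      · simp
      · rw [h𝒜, mem_filter]; exact ⟨mem_univ _, not_lt.1 hx⟩
  have hb : ‖Sm M g Gb g1 a‖ < η / 2 := by
    by_contra hc
    obtain ⟨A, hA⟩ := mal_ii hP hF hGb h1 a (fun x => S x ∧ m (a x) < θ) (by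
      intro x hx
      simp only [Gb]
      split_ifs with h
      · exact hsupp x fun hs => hx ⟨hs, h⟩
      · rfl) ha (by intro x z; simp only [hS, ha]) (by positivity) (by linarith) et hM hqM (not_lt.1 hc)
    rw [← eθ] at hA
    have h3 : ∃ x, (S x ∧ m (a x) < θ) ∧ a x = A := by
      obtain ⟨x, hx⟩ := E_exists hA
      split_ifs at hx with h
      · exact ⟨x, h⟩
      · linarith
    obtain ⟨x, ⟨hx1, hx2⟩, hx3⟩ := h3
    have : θ ≤ m A := by
      refine hA.trans (E_mono fun x => ?_)
      split_ifs with h h' h'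
      · rfl
      · exact absurd ⟨h.1.1, h.2⟩ h'
      · norm_num
      · rfl
    rw [hx3] at hx2
    linarith
  have hbig : ∃ A ∈ 𝒜, κ ≤ ‖Sm M g (GA A) g1 a‖ := by
    by_contra hc
    push Not at hc
    have h2 : Sm M g G0 g1 a = Sm M g Gb g1 a + ∑ A ∈ 𝒜, Sm M g (GA A) g1 a := by
      conv_lhs => rw [hdec]
      rw [Sm_add, Sm_sum]
    have h3 : ‖∑ A ∈ 𝒜, Sm M g (GA A) g1 a‖ ≤ η / 2 := by
      refine (norm_sum_le _ _).trans ((sum_le_sum fun A hA => (hc A hA).le).trans ?_)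
      rw [sum_const, nsmul_eq_mul, eκ]
      calc (𝒜.card : ℝ) * (η / 2 * θ) = η / 2 * (𝒜.card * θ) := by ring
        _ ≤ η / 2 * 1 := by gcongr
        _ = _ := mul_one _
    have := norm_add_le (Sm M g Gb g1 a) (∑ A ∈ 𝒜, Sm M g (GA A) g1 a)
    rw [← h2] at this
    linarith
  obtain ⟨A, hA, hA2⟩ := hbig
  have h4 : Sm M g (GA A) g1 a = Sm M g (GA A) g1 (fun _ => A) := by
    simp only [Sm]
    refine congrArg _ (funext fun x => ?_)
    by_cases hx : a x = A
    · rw [hx]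
    · simp [GA, hx]
  rw [h4] at hA2
  have hmaj := mal_const hP g (hGA A) h1 A hκ hκ1 hM2 hA2
  have hmA : θ ≤ m A := (mem_filter.1 hA).2
  obtain ⟨x, hx⟩ := E_exists hmA
  split_ifs at hx with h
  · exact ⟨x, h.1, by rw [h.2]; exact hmaj⟩
  · linarith
theorem MALc : ∃ f : ℝ → ℝ, Mon f ∧ ∀ {G : Type} [AddCommGroup G] [Fintype G] {P : ℕ} [NeZero P] {M q : ℕ} (_ : P = 8 * M ^ 2)
    {i : ZMod P →+ G} {g : G} {ρ : G → G} {ζ : G → ZMod P} (_ : Fib i g q ρ ζ)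
    {G0 g1 : G → ℂ} (_ : ∀ x, ‖G0 x‖ ≤ 1) (_ : ∀ x, ‖g1 x‖ ≤ 1)
    (a : G → ZMod P) (S : G → Prop) [DecidablePred S] (_ : ∀ x, ¬ S x → G0 x = 0) (_ : ∀ x z, a (x + i z) = a x)
    (_ : ∀ x z, S (x + i z) ↔ S x) {ε : ℝ} (_ : 0 < ε) (_ : ε ≤ 1) (_ : q ≤ M * f ε)
    [DecidablePred (fun x => S x ∧ Maj (1 / f ε) (a x))],
    ‖Sm M g G0 g1 a‖ ≤ ε + 𝔼 x, if S x ∧ Maj (1 / f ε) (a x) then (1 : ℝ) else 0 := by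
  let t : ℝ → ℝ := fun η => (η / 2) ^ 4 / 128
  let θ : ℝ → ℝ := fun η => t η / (3 * (2 * (32768 / t η ^ 4)) ^ 3)
  let κ : ℝ → ℝ := fun η => η / 2 * θ η
  have mt : Mon t := ((Mon.id.div (by norm_num)).pow 4).div (by norm_num)
  have eθ : θ = fun η => t η ^ 13 / (3 * 65536 ^ 3) := by
    funext η
    simp only [θ]
    rcases eq_or_ne (t η) 0 with h | h
    · rw [h]; norm_num
    · field_simp
      norm_num
  have mθ : Mon θ := by rw [eθ]; exact (mt.pow 13).div (by norm_num)
  have mκ : Mon κ := (Mon.id.div (by norm_num)).mul mθ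
  refine ⟨fun η => min (t η ^ 3 / 2048) (min ((κ η ^ 2 / 4) ^ 3 / 2048) (min ((η / 2) ^ 2 / 8 / 2) ((κ η ^ 2 / 4) ^ 4 / 65536))),
    ((mt.pow 3).div (by norm_num)).min (((((mκ.pow 2).div (by norm_num)).pow 3).div (by norm_num)).min
     ((((Mon.id.div (by norm_num)).pow 2).div (by norm_num) |>.div (by norm_num)).min
      ((((mκ.pow 2).div (by norm_num)).pow 4).div (by norm_num)))), ?_⟩
  intro G _ _ P _ M q hP i g ρ ζ hF G0 g1 h0 h1 a S _ hsupp ha hS ε hε hε1 hM _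
  set F := min (t ε ^ 3 / 2048) (min ((κ ε ^ 2 / 4) ^ 3 / 2048) (min ((ε / 2) ^ 2 / 8 / 2) ((κ ε ^ 2 / 4) ^ 4 / 65536))) with hFd
  have b1 : F ≤ t ε ^ 3 / 2048 := min_le_left _ _
  have b2 : F ≤ (κ ε ^ 2 / 4) ^ 3 / 2048 := (min_le_right _ _).trans (min_le_left _ _)
  have b3 : F ≤ (ε / 2) ^ 2 / 8 / 2 := (min_le_right _ _).trans ((min_le_right _ _).trans (min_le_left _ _))
  have b4 : F ≤ (κ ε ^ 2 / 4) ^ 4 / 65536 := (min_le_right _ _).trans ((min_le_right _ _).trans (min_le_right _ _))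
  have pκ : 0 < κ ε := mκ.pos hε hε1
  have pt : 0 < t ε := mt.pos hε hε1
  have pF : 0 < F := by
    refine lt_min (by positivity) (lt_min (by positivity) (lt_min (by positivity) (by positivity)))
  have hq1 : (1 : ℝ) ≤ q := by exact_mod_cast hF.hq
  have hMr : (0 : ℝ) < M := by
    by_contra hc
    have : (M : ℝ) = 0 := le_antisymm (not_lt.1 hc) (Nat.cast_nonneg _)
    rw [this] at hM; linarith
  classical
  let Gb : G → ℂ := fun x => if Maj (1 / F) (a x) then 0 else G0 x
  let GA : G → ℂ := fun x => if Maj (1 / F) (a x) then G0 x else 0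
  have hdec : G0 = fun x => Gb x + GA x := by
    funext x; simp only [Gb, GA]; split_ifs <;> simp
  have hb : ‖Sm M g Gb g1 a‖ ≤ ε := by
    by_contra hc
    obtain ⟨x, hx, hx2⟩ := mal hP hF (G0 := Gb) (by intro x; simp only [Gb]; split_ifs; exacts [by simp, h0 x]) h1 a
      (fun x => S x ∧ ¬ Maj (1 / F) (a x)) (by
        intro x hx
        simp only [Gb]
        split_ifs with h
        · rfl
        · exact hsupp x fun hs => hx ⟨hs, h⟩) ha (by intro x z; simp only [hS, ha]) (t := t ε) (θ := θ ε) (κ := κ ε) hε hε1 rfl rfl rfl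
        (hq1.trans (hM.trans (by gcongr))) (hq1.trans (hM.trans (by gcongr))) (by
          rw [div_le_iff₀ hMr]
          have : M * F ≤ M * ((ε / 2) ^ 2 / 8 / 2) := by gcongr
          linarith) (not_le.1 hc).le
    refine hx.2 (hx2.mono ?_)
    rw [le_div_iff₀ pF]
    calc 2 * (32768 / (κ ε ^ 2 / 4) ^ 4) * F ≤ 2 * (32768 / (κ ε ^ 2 / 4) ^ 4) * ((κ ε ^ 2 / 4) ^ 4 / 65536) := by gcongr
      _ = 1 := by field_simp; norm_num
  have hA : ‖Sm M g GA g1 a‖ ≤ 𝔼 x, if S x ∧ Maj (1 / F) (a x) then (1 : ℝ) else 0 := by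
    rw [Sm]
    refine (E_norm_le _).trans (E_mono fun x => ?_)
    rw [norm_mul]
    have h5 : ‖𝔼 y : Fin M, g1 (x + ((y : ℕ) + 1) • g) * ee (a x * (((y : ℕ) : ZMod P) + 1) ^ 2)‖ ≤ 1 :=
      E_norm_le_one fun y => norm_mul_le_one (h1 _) (ee_norm _).le
    split_ifs with h
    · refine mul_le_one₀ ?_ (norm_nonneg _) h5
      simp only [GA]; split_ifs; exacts [h0 x, by simp]
    · have : GA x = 0 := by
        simp only [GA]; split_ifs with h'
        · exact hsupp x fun hs => h ⟨hs, h'⟩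
        · rfl
      rw [this]; simp
  have e : Sm M g G0 g1 a = Sm M g Gb g1 a + Sm M g GA g1 a := by
    conv_lhs => rw [hdec]
    rw [Sm_add]
  rw [e]
  exact (norm_add_le _ _).trans (add_le_add hb hA)
end
end
section
section
variable {P : ℕ} [NeZero P]
lemma ee_orth (x : ZMod P) : ∑ φ : ZMod P, ee (φ * x) = if x = 0 then (P : ℂ) else 0 := by
  have := AddChar.sum_mulShift (R' := ℂ) x (ZMod.isPrimitive_stdAddChar P)
  simp only [ee]
  rw [this, ZMod.card]
  split_ifs <;> simp
lemma parseval (K : ZMod P → ℂ) :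
    ∑ φ : ZMod P, ‖𝔼 z, K z * ee (-(φ * z))‖ ^ 2 = 𝔼 z, ‖K z‖ ^ 2 := by
  have hP : (P : ℂ) ≠ 0 := by exact_mod_cast NeZero.ne P
  have key : ((∑ φ : ZMod P, ‖𝔼 z, K z * ee (-(φ * z))‖ ^ 2 : ℝ) : ℂ)
      = ((𝔼 z, ‖K z‖ ^ 2 : ℝ) : ℂ) := by
    rw [Complex.ofReal_sum, E_ofReal]
    simp_rw [E_normsq_eq]
    rw [← expect_sum_comm]
    refine congrArg _ (funext fun z => ?_)
    rw [← expect_sum_comm]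
    have : ∀ z' : ZMod P, ∑ φ : ZMod P, K z * ee (-(φ * z)) * conj (K z' * ee (-(φ * z')))
        = if z' = z then (P : ℂ) * (K z * conj (K z)) else 0 := by
      intro z'
      have h : ∀ φ : ZMod P, K z * ee (-(φ * z)) * conj (K z' * ee (-(φ * z')))
          = K z * conj (K z') * ee (φ * (z' - z)) := by
        intro φ
        rw [map_mul, ← ee_neg, neg_neg, mul_sub, sub_eq_add_neg, ee_add]; ring
      simp_rw [h]
      rw [← Finset.mul_sum, ee_orth]
      simp only [sub_eq_zero]
      split_ifs with hz
      · subst hz; ring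
      · simp
    simp_rw [this]
    rw [Fintype.expect_eq_sum_div_card, Finset.sum_ite_eq' univ z, if_pos (mem_univ _), ZMod.card,
      normsq_eq]
    field_simp
  exact_mod_cast key
lemma V1_id (K : ZMod P → ℂ) :
    V (AddMonoidHom.id (ZMod P)) 1 K = 𝔼 h, ‖𝔼 x, Dl h K x‖ ^ 2 := by
  simp only [V]
  refine congrArg _ (funext fun h => ?_)
  have : ∀ x : ZMod P, 𝔼 z : ZMod P, Dl ((AddMonoidHom.id (ZMod P)) h) K (x + (AddMonoidHom.id (ZMod P)) z)
      = 𝔼 x, Dl h K x := by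
    intro x
    simp only [AddMonoidHom.id_apply]
    simp_rw [add_comm x]
    exact E_shift _ _
  simp_rw [this]
  rw [E_const]
lemma U2_eq (K : ZMod P → ℂ) :
    V (AddMonoidHom.id (ZMod P)) 1 K = ∑ φ : ZMod P, (‖𝔼 z, K z * ee (-(φ * z))‖ ^ 2) ^ 2 := by
  rw [V1_id, ← parseval]
  refine sum_congr rfl fun φ _ => ?_
  congr 1
  have : 𝔼 h, (𝔼 x, Dl h K x) * ee (-(φ * h))
      = (𝔼 z, K z * ee (-(φ * z))) * conj (𝔼 z, K z * ee (-(φ * z))) := by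
    simp_rw [expect_mul]
    rw [E_comm]
    have h : ∀ x : ZMod P, 𝔼 h, Dl h K x * ee (-(φ * h))
        = (𝔼 z, K z * ee (-(φ * z))) * conj (K x * ee (-(φ * x))) := by
      intro x
      rw [← E_shift (fun z => K z * ee (-(φ * z))) x, expect_mul]
      refine congrArg _ (funext fun h => ?_)
      rw [map_mul, ← ee_neg, neg_neg]
      have : ee (-(φ * h)) = ee (-(φ * (h + x))) * ee (φ * x) := by
        rw [← ee_add]; congr 1; ring
      rw [this]; simp only [Dl]; rw [add_comm x h]; ring
    simp_rw [h]
    rw [← mul_expect, ← E_conj, expect_mul]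
  rw [this, norm_mul, RCLike.norm_conj, sq]
lemma U2_inv {K : ZMod P → ℂ} (hK : ∀ z, ‖K z‖ ≤ 1) :
    ∃ φ : ZMod P, V (AddMonoidHom.id (ZMod P)) 1 K ≤ ‖𝔼 z, K z * ee (-(φ * z))‖ ^ 2 := by
  obtain ⟨φ, -, h⟩ := exists_max_image univ (fun φ : ZMod P => ‖𝔼 z, K z * ee (-(φ * z))‖ ^ 2)
    ⟨0, mem_univ _⟩
  refine ⟨φ, ?_⟩
  rw [U2_eq]
  have hp : ∑ φ : ZMod P, ‖𝔼 z, K z * ee (-(φ * z))‖ ^ 2 ≤ 1 := by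
    rw [parseval]
    exact E_le_const zero_le_one fun z => pow_le_one₀ (norm_nonneg _) (hK z)
  calc _ ≤ ∑ ψ : ZMod P, ‖𝔼 z, K z * ee (-(φ * z))‖ ^ 2 * ‖𝔼 z, K z * ee (-(ψ * z))‖ ^ 2 := by
        refine sum_le_sum fun ψ _ => ?_
        rw [sq (‖𝔼 z, K z * ee (-(ψ * z))‖ ^ 2)]
        exact mul_le_mul_of_nonneg_right (h ψ (mem_univ _)) (by positivity)
    _ = ‖𝔼 z, K z * ee (-(φ * z))‖ ^ 2 * ∑ ψ : ZMod P, ‖𝔼 z, K z * ee (-(ψ * z))‖ ^ 2 := by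
        rw [mul_sum]
    _ ≤ _ := mul_le_of_le_one_right (by positivity) hp
end
end
section
open Classical in
lemma pig {P : ℕ} [NeZero P] {Ω : Type} [Fintype Ω] (p : Ω → Prop) (ξ : Ω → ZMod P) {B κ : ℝ} (hB : 1 ≤ B)
    (hκ : 0 < κ) (h : κ ≤ 𝔼 ω, if p ω ∧ Maj B (ξ ω) then (1 : ℝ) else 0) :
    ∃ ξ0, Maj B ξ0 ∧ κ / (3 * B ^ 3) ≤ 𝔼 ω, if p ω ∧ ξ ω = ξ0 then (1 : ℝ) else 0 := by
  set A := univ.filter (fun x : ZMod P => Maj B x) with hA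
  have hc : (A.card : ℝ) ≤ 3 * B ^ 3 := by convert card_Maj (P := P) hB
  have h1 : 𝔼 ω, (if p ω ∧ Maj B (ξ ω) then (1 : ℝ) else 0)
      = ∑ x ∈ A, 𝔼 ω, if p ω ∧ ξ ω = x then (1 : ℝ) else 0 := by
    rw [← expect_sum_comm]
    refine congrArg _ (funext fun ω => ?_)
    by_cases hp : p ω
    · simp only [hp, true_and]
      rw [Finset.sum_ite_eq A (ξ ω)]
      simp [hA]
    · simp [hp]
  rw [h1] at h
  by_contra hcon
  push Not at hcon
  have hne : A.Nonempty := by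
    rw [nonempty_iff_ne_empty]; intro h0; rw [h0, sum_empty] at h; linarith
  have : ∑ x ∈ A, 𝔼 ω, (if p ω ∧ ξ ω = x then (1 : ℝ) else 0) < ∑ x ∈ A, κ / (3 * B ^ 3) :=
    sum_lt_sum_of_nonempty hne fun x hx => hcon x (by simpa [hA] using hx)
  rw [sum_const, nsmul_eq_mul] at this
  have h3 : (A.card : ℝ) * (κ / (3 * B ^ 3)) ≤ 3 * B ^ 3 * (κ / (3 * B ^ 3)) := by gcongr
  have h4 : 3 * B ^ 3 * (κ / (3 * B ^ 3)) = κ := by field_simp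
  linarith
lemma E_prod3 {A B C : Type} [Fintype A] [Fintype B] [Fintype C] (f : A × B × C → ℂ) :
    𝔼 p, f p = 𝔼 a, 𝔼 b, 𝔼 c, f (a, b, c) := by
  rw [E_prod]; refine congrArg _ (funext fun a => ?_); rw [E_prod]
section
variable {P : ℕ} [NeZero P]
lemma BB_const' {k : ℕ} (hk : 1 ≤ k) {b : DD (ZMod P) k → ℂ} (hb : BB k b) (c : ℂ) (hc : ‖c‖ ≤ 1) :
    BB k (fun d => c * b d) := by
  obtain ⟨k', rfl⟩ : ∃ k', k = k' + 1 := ⟨k - 1, by omega⟩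
  exact BB_const hb c hc
lemma degB1 {Ω : Type} [Fintype Ω] {k : ℕ} (hk : 1 ≤ k) {K : Ω → ZMod P → ℂ} (hK : ∀ ω z, ‖K ω z‖ ≤ 1)
    (φ : Ω → DD (ZMod P) k → ZMod P) (d0 : DD (ZMod P) k) (ξ : ZMod P) :
    (𝔼 ω, 𝔼 d, ‖𝔼 z, mD k d (K ω) z * ee (-((φ ω d - ap k (φ ω) d d0 - ξ) * z))‖ ^ 2) ^ (2 ^ k)
      ≤ 𝔼 ω, V (AddMonoidHom.id (ZMod P)) k (K ω) := by
  have e1 : ∀ ω d, ((‖𝔼 z, mD k d (K ω) z * ee (-((φ ω d - ap k (φ ω) d d0 - ξ) * z))‖ ^ 2 : ℝ) : ℂ)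
      = 𝔼 s, 𝔼 z, mD k d (Dl s (K ω)) z * ee (-((φ ω d - ap k (φ ω) d d0 - ξ) * s)) := by
    intro ω d
    set θ := φ ω d - ap k (φ ω) d d0 - ξ
    have h0 : V (AddMonoidHom.id (ZMod P)) 0 (fun z => mD k d (K ω) z * ee (-(θ * z)))
        = ‖𝔼 z, mD k d (K ω) z * ee (-(θ * z))‖ ^ 2 := by
      simp only [V, AddMonoidHom.id_apply]
      have : ∀ x : ZMod P, 𝔼 z, mD k d (K ω) (x + z) * ee (-(θ * (x + z))) =
          𝔼 z, mD k d (K ω) z * ee (-(θ * z)) := by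
        intro x
        simp_rw [add_comm x]
        exact E_shift (fun z => mD k d (K ω) z * ee (-(θ * z))) x
      simp_rw [this]; rw [E_const]
    rw [← h0, V0_eq]
    refine congrArg _ (funext fun s => congrArg _ (funext fun z => ?_))
    rw [Dl_mul, mD_Dl]
    simp only [AddMonoidHom.id_apply]
    congr 1
    simp only [Dl]
    rw [← ee_neg, ← ee_add]; congr 1; ring
  have e2 : ∀ ω s, ∃ b, BB k b ∧ ∀ d, ee (-((φ ω d - ap k (φ ω) d d0 - ξ) * s)) = b d := by
    intro ω s
    obtain ⟨b, hb, h⟩ := char_ap k (fun u : ZMod P => ee (-(u * s)))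
      (fun x y => by rw [← ee_add]; congr 1; ring) (fun x => (ee_norm _).le) (φ ω) d0
    refine ⟨fun d => ee (ξ * s) * b d, BB_const' hk hb _ (ee_norm _).le, fun d => ?_⟩
    have : -((φ ω d - ap k (φ ω) d d0 - ξ) * s) = -(φ ω d * s) + (ap k (φ ω) d d0 * s + ξ * s) := by ring
    rw [this, ee_add, h d, ee_add]
    have h2 : ee (-(ap k (φ ω) d d0 * s)) * ee (ap k (φ ω) d d0 * s) = 1 := by
      rw [← ee_add, neg_add_cancel, ee_zero]
    linear_combination (b d * ee (ξ * s)) * h2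
  choose b hb hbe using e2
  have e3 : ∀ ω s z, ∃ b, BB k b ∧ ∀ d, mD k d (Dl s (K ω)) z = Dl s (K ω) (z + sg k d) * b d :=
    fun ω s z => mD_top k (fun x => Dl_bdd (hK ω) s x) z
  choose b' hb' hbe' using e3
  have key := box_le (Ω := Ω × ZMod P × ZMod P) k (fun p d => Dl p.2.1 (K p.1) (p.2.2 + sg k d))
    (fun p d => b' p.1 p.2.1 p.2.2 d * b p.1 p.2.1 d) (fun p => BB_mul (hb' _ _ _) (hb _ _))
  have e4 : ((𝔼 ω, 𝔼 d, ‖𝔼 z, mD k d (K ω) z * ee (-((φ ω d - ap k (φ ω) d d0 - ξ) * z))‖ ^ 2 : ℝ) : ℂ)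
      = 𝔼 p : Ω × ZMod P × ZMod P, 𝔼 d, Dl p.2.1 (K p.1) (p.2.2 + sg k d) *
        (b' p.1 p.2.1 p.2.2 d * b p.1 p.2.1 d) := by
    rw [E_prod3, E_ofReal]
    refine congrArg _ (funext fun ω => ?_)
    rw [E_ofReal]
    simp_rw [e1]
    rw [E_comm]
    refine congrArg _ (funext fun s => ?_)
    rw [E_comm]
    refine congrArg _ (funext fun z => congrArg _ (funext fun d => ?_))
    rw [hbe', hbe]; ring
  have e5 : 𝔼 p : Ω × ZMod P × ZMod P, box k (fun d => Dl p.2.1 (K p.1) (p.2.2 + sg k d))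
      = ((𝔼 ω, V (AddMonoidHom.id (ZMod P)) k (K ω) : ℝ) : ℂ) := by
    rw [E_prod3, E_ofReal]
    refine congrArg _ (funext fun ω => ?_)
    rw [← W_succ, W]
    refine congrArg _ (funext fun s => ?_)
    simp only []
    rw [E_box]; rfl
  rw [← e4, e5, Complex.norm_real, Complex.norm_real, Real.norm_eq_abs, Real.norm_eq_abs,
    abs_of_nonneg (E_nonneg fun ω => E_nonneg fun d => by positivity),
    abs_of_nonneg (E_nonneg fun ω => V_nonneg _ _ _)] at key
  exact key
end
section
variable {P : ℕ} [NeZero P] {G : Type} [AddCommGroup G] [Fintype G]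
noncomputable def dual (M : ℕ) (i : ZMod P →+ G) (g : G) (f0 f1 : G → ℂ) (x : G) : ℂ :=
  𝔼 y : Fin M, f0 (x - i ((((y : ℕ) : ZMod P) + 1) ^ 2)) *
    f1 (x - i ((((y : ℕ) : ZMod P) + 1) ^ 2) + ((y : ℕ) + 1) • g)
lemma dual_bdd {M : ℕ} {i : ZMod P →+ G} {g : G} {f0 f1 : G → ℂ} (h0 : ∀ x, ‖f0 x‖ ≤ 1)
    (h1 : ∀ x, ‖f1 x‖ ≤ 1) (x : G) : ‖dual M i g f0 f1 x‖ ≤ 1 :=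
  E_norm_le_one fun y => norm_mul_le_one (h0 _) (h1 _)
lemma Fib.z0 {i : ZMod P →+ G} {g : G} {q : ℕ} {ρ : G → G} {ζ : G → ZMod P} (hF : Fib i g q ρ ζ) (x : G) (z : ZMod P) :
    ζ (ρ x + i z) = z := by
  have h := hF.hζ (ρ x) (ζ x)
  rw [hF.hx] at h
  rw [hF.hζ]
  have : ζ (ρ x) = 0 := by linear_combination -h
  rw [this, zero_add]
lemma Fib.inv {X : Type*} {i : ZMod P →+ G} {g : G} {q : ℕ} {ρ : G → G} {ζ : G → ZMod P} (hF : Fib i g q ρ ζ)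
    {c : G → X} (hc : ∀ x z, c (x + i z) = c x) (x : G) (z : ZMod P) : c (ρ x + i z) = c x := by
  rw [hc, ← hc (ρ x) (ζ x), hF.hx]
lemma Fib.avg {i : ZMod P →+ G} {g : G} {q : ℕ} {ρ : G → G} {ζ : G → ZMod P} (hF : Fib i g q ρ ζ)
    (H : G → ℂ) : 𝔼 x, 𝔼 z, H (ρ x + i z) = 𝔼 x, H x := by
  have : ∀ x, 𝔼 z, H (ρ x + i z) = 𝔼 z, H (x + i z) := by
    intro x
    rw [← E_shift (fun z => H (ρ x + i z)) (ζ x)]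
    refine congrArg _ (funext fun z => ?_)
    rw [map_add, add_comm (i z), ← add_assoc, hF.hx]
  simp_rw [this]
  rw [E_comm]
  simp_rw [E_shift]
  rw [E_const]
lemma Fib.V_eq {i : ZMod P →+ G} {g : G} {q : ℕ} {ρ : G → G} {ζ : G → ZMod P} (hF : Fib i g q ρ ζ)
    (s : ℕ) (F : G → ℂ) : V i s F = 𝔼 x, V (AddMonoidHom.id (ZMod P)) s (fun w => F (ρ x + i w)) := by
  rw [V_fibre]
  refine congrArg _ (funext fun x => ?_)
  rw [← V_translate (AddMonoidHom.id (ZMod P)) s (fun w => F (ρ x + i w)) (ζ x)]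
  congr 1; funext w
  rw [map_add, add_comm (i w), ← add_assoc, hF.hx]
lemma degB2 {M q k : ℕ} {i : ZMod P →+ G} {g : G} {ρ : G → G} {ζ : G → ZMod P} (hF : Fib i g q ρ ζ)
    {f0 f1 : G → ℂ} (h0 : ∀ x, ‖f0 x‖ ≤ 1) (h1 : ∀ x, ‖f1 x‖ ≤ 1)
    (c : G → DD (ZMod P) k → ℂ) (φ : G → DD (ZMod P) k → ZMod P)
    (hc : ∀ x z, c (x + i z) = c x) (hφ : ∀ x z, φ (x + i z) = φ x) :
    ‖𝔼 x, 𝔼 d, c x d * 𝔼 z, mD k d (fun w => dual M i g f0 f1 (ρ x + i w)) z * ee (-(φ x d * z))‖ ^ (2 ^ k)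
      ≤ 𝔼 d, 𝔼 d', ‖Sm M g (fun x => cp k (c x) d d' * ee (-(ap k (φ x) d d' * ζ x)) *
          cp k (fun e => f0 (x + i (sg k e))) d d') (fun x => cp k (fun e => f1 (x + i (sg k e))) d d')
          (fun x => -ap k (φ x) d d')‖ := by
  have e3 : ∀ x z, ∃ b, BB k b ∧ ∀ d, mD k d (fun w => dual M i g f0 f1 (ρ x + i w)) z
      = dual M i g f0 f1 (ρ x + i (z + sg k d)) * b d :=
    fun x z => mD_top k (K := fun w => dual M i g f0 f1 (ρ x + i w)) (fun w => dual_bdd h0 h1 _) z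
  choose b hb hbe using e3
  let sq : Fin M → ZMod P := fun y => (((y : ℕ) : ZMod P) + 1) ^ 2
  let T : G × ZMod P × Fin M → DD (ZMod P) k → ℂ := fun p d =>
    c p.1 d * ee (-(φ p.1 d * p.2.1)) * f0 (ρ p.1 + i (p.2.1 - sq p.2.2) + i (sg k d)) *
      f1 (ρ p.1 + i (p.2.1 - sq p.2.2) + ((p.2.2 : ℕ) + 1) • g + i (sg k d))
  have key := box_le (Ω := G × ZMod P × Fin M) k T (fun p d => b p.1 p.2.1 d) (fun p => hb _ _)
  have e4 : 𝔼 x, 𝔼 d, c x d * 𝔼 z, mD k d (fun w => dual M i g f0 f1 (ρ x + i w)) z * ee (-(φ x d * z))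
      = 𝔼 p : G × ZMod P × Fin M, 𝔼 d, T p d * b p.1 p.2.1 d := by
    rw [E_prod3]
    refine congrArg _ (funext fun x => ?_)
    have : ∀ z, 𝔼 y : Fin M, 𝔼 d, T (x, z, y) d * b x z d = 𝔼 d, c x d *
       (mD k d (fun w => dual M i g f0 f1 (ρ x + i w)) z * ee (-(φ x d * z))) := by
      intro z
      rw [E_comm]
      refine congrArg _ (funext fun d => ?_)
      rw [hbe, dual, expect_mul, expect_mul, mul_expect]
      refine congrArg _ (funext fun y => ?_)
      simp only [T, sq, map_sub, map_add]
      have a1 : ρ x + (i z - i ((((y : ℕ) : ZMod P) + 1) ^ 2)) + i (sg k d)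
        = ρ x + (i z + i (sg k d)) - i ((((y : ℕ) : ZMod P) + 1) ^ 2) := by abel
      have a2 : ρ x + (i z - i ((((y : ℕ) : ZMod P) + 1) ^ 2)) + ((y : ℕ) + 1) • g + i (sg k d)
        = ρ x + (i z + i (sg k d)) - i ((((y : ℕ) : ZMod P) + 1) ^ 2) + ((y : ℕ) + 1) • g := by abel
      rw [a1, a2]; ring
    simp only [mul_expect]
    rw [E_comm]
    exact congrArg _ (funext fun z => (this z).symm)
  rw [e4]
  refine key.trans ?_
  have e5 : 𝔼 p : G × ZMod P × Fin M, box k (T p) = 𝔼 d, 𝔼 d',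
      Sm M g (fun x => cp k (c x) d d' * ee (-(ap k (φ x) d d' * ζ x)) *
          cp k (fun e => f0 (x + i (sg k e))) d d') (fun x => cp k (fun e => f1 (x + i (sg k e))) d d')
          (fun x => -ap k (φ x) d d') := by
    simp_rw [box_eq_cp]
    rw [E_comm]
    refine congrArg _ (funext fun d => ?_)
    rw [E_comm]
    refine congrArg _ (funext fun d' => ?_)
    rw [E_prod3, Sm]
    refine Eq.trans ?_ (hF.avg _)
    refine congrArg _ (funext fun x => ?_)
    simp_rw [mul_expect]
    rw [E_comm]
    refine Eq.trans ?_ (E_comm _)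
    refine congrArg _ (funext fun y => ?_)
    rw [← E_shift _ (sq y)]
    refine congrArg _ (funext fun z => ?_)
    simp only [hF.inv hc, hF.inv hφ, hF.z0]
    simp only [T, cp_mul, add_sub_cancel_right]
    rw [cp_char k (fun u : ZMod P => ee (-(u * (z + sq y))))
      (fun x y => by rw [← ee_neg, ← ee_add]; congr 1; ring) (φ x) d d']
    have : ee (-(ap k (φ x) d d' * (z + sq y))) = ee (-(ap k (φ x) d d' * z)) *
      ee (-ap k (φ x) d d' * (((y : ℕ) : ZMod P) + 1) ^ 2) := by
      rw [← ee_add]; congr 1; simp only [sq]; ring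
    rw [this]; ring
  rw [e5]
  refine (E_norm_le _).trans (E_mono fun d => E_norm_le _)
end
end
section
open Classical in
theorem MALd : ∃ f : ℝ → ℝ, Mon f ∧ (∀ δ, f δ ≤ 1) ∧ ∀ {G : Type} [AddCommGroup G] [Fintype G] {P : ℕ} [NeZero P] {M q : ℕ} (_ : P = 8 * M ^ 2)
    {i : ZMod P →+ G} {g : G} {ρ : G → G} {ζ : G → ZMod P} (_ : Fib i g q ρ ζ)
    {G0 g1 : G → ℂ} (_ : ∀ x, ‖G0 x‖ ≤ 1) (_ : ∀ x, ‖g1 x‖ ≤ 1)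
    (a : G → ZMod P) (S : G → Prop) (_ : ∀ x, ¬ S x → G0 x = 0) (_ : ∀ x z, a (x + i z) = a x)
    (_ : ∀ x z, S (x + i z) ↔ S x) {ε : ℝ} (_ : 0 < ε) (_ : ε ≤ 1) (_ : q ≤ M * f ε),
    ‖Sm M g G0 g1 a‖ ≤ ε + 𝔼 x, if S x ∧ Maj (1 / f ε) (a x) then (1 : ℝ) else 0 := by
  obtain ⟨f, mf, hf⟩ := MALc
  refine ⟨fun δ => min (f δ) 1, mf.min (Mon.const one_pos), fun δ => min_le_right _ _, ?_⟩
  intro G _ _ P _ M q hP i g ρ ζ hF G0 g1 h0 h1 a S hs ha hS ε hε hε1 hq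
  have hp := mf.pos hε hε1
  refine (hf hP hF h0 h1 a S hs ha hS hε hε1 (hq.trans (by gcongr; exact min_le_left _ _))).trans ?_
  have : (𝔼 x, if S x ∧ Maj (1 / f ε) (a x) then (1 : ℝ) else 0) ≤
    𝔼 x, if S x ∧ Maj (1 / min (f ε) 1) (a x) then (1 : ℝ) else 0 := by
    refine E_mono fun x => ?_
    have hm : Maj (1 / f ε) (a x) → Maj (1 / min (f ε) 1) (a x) := fun h => h.mono (by
      apply one_div_le_one_div_of_le (lt_min hp one_pos) (min_le_left _ _))
    split_ifs with h1 h2 h2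
    · exact le_rfl
    · exact absurd ⟨h1.1, hm h1.2⟩ h2
    · exact zero_le_one
    · exact le_rfl
  gcongr
open Classical in
theorem thmB {k : ℕ} (hk : 1 ≤ k) : ∃ f : ℝ → ℝ, Mon f ∧ ∀ {G : Type} [AddCommGroup G] [Fintype G] {P : ℕ} [NeZero P] {M q : ℕ} (_ : P = 8 * M ^ 2)
    {i : ZMod P →+ G} {g : G} {ρ : G → G} {ζ : G → ZMod P} (_ : Fib i g q ρ ζ)
    {f0 f1 : G → ℂ} (_ : ∀ x, ‖f0 x‖ ≤ 1) (_ : ∀ x, ‖f1 x‖ ≤ 1) {η : ℝ} (_ : 0 < η) (_ : η ≤ 1)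
    (_ : q ≤ M * f η) (_ : η ≤ V i (k + 1) (dual M i g f0 f1)), f η ≤ V i k (dual M i g f0 f1) := by
  obtain ⟨fM, mM, M1, hM⟩ := MALd
  let κ : ℝ → ℝ := fun η => (η / 2) ^ (2 ^ k) / 2
  let lam : ℝ → ℝ := fun η => η / 2 * (κ η * fM (κ η) ^ 3 / 3)
  have hκ1 : ∀ η : ℝ, 0 < η → η ≤ 1 → κ η ≤ 1 := by
    intro η h h1
    have : (η / 2) ^ (2 ^ k) ≤ 1 := pow_le_one₀ (by positivity) (by linarith)
    simp only [κ]; linarith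
  have mκ : Mon κ := ((Mon.id.div (by norm_num)).pow _).div (by norm_num)
  have mMκ : Mon (fun η => fM (κ η)) := mM.comp mκ hκ1
  have ml : Mon lam := (Mon.id.div (by norm_num)).mul ((mκ.mul (mMκ.pow 3)).div (by norm_num))
  refine ⟨fun η => min (fM (κ η)) (lam η ^ (2 ^ k)), mMκ.min (ml.pow _), ?_⟩
  intro G _ _ P _ M q hP i g ρ ζ hF f0 f1 h0 h1 η hη hη1 hq hV
  refine (min_le_right _ _).trans ?_
  have pκ := mκ.pos hη hη1
  have pM := mMκ.pos hη hη1
  have pM1 : fM (κ η) ≤ 1 := M1 _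
  have pκ1 := hκ1 η hη hη1
  set F := dual M i g f0 f1 with hFd
  have hFb : ∀ x, ‖F x‖ ≤ 1 := dual_bdd h0 h1
  have e1 : ∀ r d, ∃ φ : ZMod P, V (AddMonoidHom.id (ZMod P)) 1 (mD k d (fun w => F (r + i w)))
      ≤ ‖𝔼 z, mD k d (fun w => F (r + i w)) z * ee (-(φ * z))‖ ^ 2 :=
    fun r d => U2_inv (mD_bdd k d fun w => hFb _)
  choose φ0 hφ0 using e1
  let φ : G → DD (ZMod P) k → ZMod P := fun x => φ0 (ρ x)
  let w : G → DD (ZMod P) k → ℂ := fun x d => 𝔼 z, mD k d (fun w => F (ρ x + i w)) z * ee (-(φ x d * z))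
  let c : G → DD (ZMod P) k → ℂ := fun x d => if η / 2 ≤ ‖w x d‖ ^ 2 then conj (w x d) else 0
  have hw1 : ∀ x d, ‖w x d‖ ≤ 1 := fun x d => E_norm_le_one fun z => norm_mul_le_one
    (mD_bdd k d (fun w => hFb _) z) (ee_norm _).le
  have hφi : ∀ x z, φ (x + i z) = φ x := fun x z => by simp only [φ, hF.hρ]
  have hwi : ∀ x z, w (x + i z) = w x := fun x z => by simp only [w, hφi, hF.hρ]
  have hci : ∀ x z, c (x + i z) = c x := fun x z => by simp only [c, hwi]
  have hc1 : ∀ x d, ‖c x d‖ ≤ 1 := by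
    intro x d; simp only [c]; split_ifs
    · rw [RCLike.norm_conj]; exact hw1 x d
    · simp
  have s1 : η / 2 ≤ ‖𝔼 x, 𝔼 d, c x d * w x d‖ := by
    have e : ∀ x d, c x d * w x d = ((if η / 2 ≤ ‖w x d‖ ^ 2 then ‖w x d‖ ^ 2 else 0 : ℝ) : ℂ) := by
      intro x d; simp only [c]; split_ifs
      · rw [mul_comm, ← normsq_eq]
      · simp
    simp_rw [e, ← E_ofReal]
    rw [Complex.norm_real, Real.norm_eq_abs]
    refine le_trans ?_ (le_abs_self _)
    have h2 : η ≤ 𝔼 x, 𝔼 d, ((if η / 2 ≤ ‖w x d‖ ^ 2 then ‖w x d‖ ^ 2 else 0) + η / 2) := by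
      refine hV.trans ?_
      rw [hF.V_eq, add_comm k 1]
      refine E_mono fun x => ?_
      rw [V_eq_mD]
      refine E_mono fun d => (hφ0 _ _).trans ?_
      change ‖w x d‖ ^ 2 ≤ _
      split_ifs with h
      · linarith
      · linarith [not_le.1 h]
    simp_rw [expect_add_distrib, E_const] at h2
    linarith
  have s2 := degB2 (M := M) (k := k) hF h0 h1 c φ hci hφi
  have s3 : 2 * κ η ≤ ‖𝔼 x, 𝔼 d, c x d * w x d‖ ^ (2 ^ k) := by
    have : (η / 2) ^ (2 ^ k) ≤ ‖𝔼 x, 𝔼 d, c x d * w x d‖ ^ (2 ^ k) := by gcongr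
    simp only [κ]; linarith
  have s4 := s3.trans s2
  have hqM : (q : ℝ) ≤ M * fM (κ η) := hq.trans (by gcongr; exact min_le_left _ _)
  set B := 1 / fM (κ η) with hB
  have hB1 : 1 ≤ B := by rw [hB, le_div_iff₀ pM]; linarith
  have s5 : κ η ≤ 𝔼 d' : DD (ZMod P) k, 𝔼 p : G × DD (ZMod P) k,
      if η / 2 ≤ ‖w p.1 p.2‖ ^ 2 ∧ Maj B (-ap k (φ p.1) p.2 d') then (1 : ℝ) else 0 := by
    have h3 : 2 * κ η ≤ 𝔼 d : DD (ZMod P) k, 𝔼 d' : DD (ZMod P) k, (κ η + 𝔼 x : G,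
        if η / 2 ≤ ‖w x d‖ ^ 2 ∧ Maj B (-ap k (φ x) d d') then (1 : ℝ) else 0) := by
      refine s4.trans (E_mono fun d => E_mono fun d' => ?_)
      refine (hM hP hF (fun x => ?_) (fun x => cp_bdd k (fun e => h1 _) d d') _
        (fun x => cp k (c x) d d' ≠ 0) (fun x hx => ?_) (fun x z => by rw [hφi]) (fun x z => by rw [hci])
        pκ pκ1 hqM).trans ?_
      · exact norm_mul_le_one (norm_mul_le_one (cp_bdd k (hc1 x) d d') (ee_norm _).le)
          (cp_bdd k (fun e => h0 _) d d')
      · rw [not_not.1 hx]; ring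
      · refine add_le_add le_rfl (E_mono fun x => ?_)
        have hm : cp k (c x) d d' ≠ 0 → η / 2 ≤ ‖w x d‖ ^ 2 := by
          intro h
          have := cp_ne_zero k h
          by_contra h5
          exact this (by simp only [c]; rw [if_neg h5])
        split_ifs with h1 h2 h2
        · exact le_rfl
        · exact absurd ⟨hm h1.1, h1.2⟩ h2
        · exact zero_le_one
        · exact le_rfl
    simp_rw [expect_add_distrib, E_const] at h3
    rw [E_comm] at h3
    have : ∀ d' : DD (ZMod P) k, 𝔼 p : G × DD (ZMod P) k,
      (if η / 2 ≤ ‖w p.1 p.2‖ ^ 2 ∧ Maj B (-ap k (φ p.1) p.2 d') then (1 : ℝ) else 0)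
      = 𝔼 d : DD (ZMod P) k, 𝔼 x : G,
        if η / 2 ≤ ‖w x d‖ ^ 2 ∧ Maj B (-ap k (φ x) d d') then (1 : ℝ) else 0 := by
      intro d'
      rw [E_prod, E_comm]
    simp_rw [this]
    linarith only [h3]
  obtain ⟨d0, s6⟩ := E_exists s5
  obtain ⟨ξ, -, s7⟩ := pig (fun p : G × DD (ZMod P) k => η / 2 ≤ ‖w p.1 p.2‖ ^ 2)
    (fun p => -ap k (φ p.1) p.2 d0) hB1 pκ s6
  have s8 := degB1 hk (K := fun (x : G) w => F (ρ x + i w)) (fun x w => hFb _) φ d0 ξ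
  rw [hF.V_eq]
  refine le_trans ?_ s8
  have plam := ml.pos hη hη1
  have hl : lam η = η / 2 * (κ η / (3 * B ^ 3)) := by
    simp only [lam, hB]; field_simp
  refine pow_le_pow_left₀ plam.le ?_ _
  rw [hl]
  refine (mul_le_mul_of_nonneg_left s7 (by positivity)).trans ?_
  rw [← E_prod (ι := G) (κ := DD (ZMod P) k) (fun p => ‖𝔼 z, mD k p.2 (fun w => F (ρ p.1 + i w)) z * ee (-((φ p.1 p.2 - ap k (φ p.1) p.2 d0 - ξ) * z))‖ ^ 2)]
  refine E_ge_of_ind (p := fun p : G × DD (ZMod P) k => η / 2 ≤ ‖w p.1 p.2‖ ^ 2 ∧ -ap k (φ p.1) p.2 d0 = ξ) (fun p => by positivity) (fun p hp => ?_)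
  have : φ p.1 p.2 - ap k (φ p.1) p.2 d0 - ξ = φ p.1 p.2 := by rw [← hp.2]; ring
  rw [this]
  exact hp.1
lemma dualize {P : ℕ} [NeZero P] {G : Type} [AddCommGroup G] [Fintype G] {M : ℕ} (i : ZMod P →+ G) (g : G)
    (f0 f1 F : G → ℂ) : 𝔼 x, 𝔼 y : Fin M, f0 x * f1 (x + ((y : ℕ) + 1) • g) * F (x + i ((((y : ℕ) : ZMod P) + 1) ^ 2))
      = 𝔼 x, F x * dual M i g f0 f1 x := by
  simp only [dual, mul_expect]
  rw [E_comm]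
  refine Eq.trans ?_ (E_comm _)
  refine congrArg _ (funext fun y => ?_)
  refine Eq.trans ?_ (E_shift _ (i ((((y : ℕ) : ZMod P) + 1) ^ 2)))
  refine congrArg _ (funext fun x => ?_)
  rw [add_sub_cancel_right]; ring
theorem thmAB : ∃ f : ℝ → ℝ, Mon f ∧ ∀ {G : Type} [AddCommGroup G] [Fintype G] {P : ℕ} [NeZero P] {M q : ℕ} (_ : P = 8 * M ^ 2)
    {i : ZMod P →+ G} {g : G} {ρ : G → G} {ζ : G → ZMod P} (_ : Fib i g q ρ ζ)
    {f0 f1 f2 : G → ℂ} (_ : ∀ x, ‖f0 x‖ ≤ 1) (_ : ∀ x, ‖f1 x‖ ≤ 1) (_ : ∀ x, ‖f2 x‖ ≤ 1) {δ : ℝ} (_ : 0 < δ) (_ : δ ≤ 1)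
    (_ : q ≤ M * f δ)
    (_ : δ ≤ ‖𝔼 x, 𝔼 y : Fin M, f0 x * f1 (x + ((y : ℕ) + 1) • g) * f2 (x + i ((((y : ℕ) : ZMod P) + 1) ^ 2))‖),
    f δ ≤ V i 1 (dual M i g f0 f1) := by
  obtain ⟨fA, mA, hA⟩ := thmA
  have step : ∀ k : ℕ, k ≤ 4 → ∃ f : ℝ → ℝ, Mon f ∧ (∀ η, f η ≤ 1) ∧ ∀ {G : Type} [AddCommGroup G] [Fintype G] {P : ℕ} [NeZero P] {M q : ℕ} (_ : P = 8 * M ^ 2)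
    {i : ZMod P →+ G} {g : G} {ρ : G → G} {ζ : G → ZMod P} (_ : Fib i g q ρ ζ)
    {f0 f1 : G → ℂ} (_ : ∀ x, ‖f0 x‖ ≤ 1) (_ : ∀ x, ‖f1 x‖ ≤ 1) {η : ℝ} (_ : 0 < η) (_ : η ≤ 1)
    (_ : q ≤ M * f η) (_ : η ≤ V i 5 (dual M i g f0 f1)), f η ≤ V i (5 - k) (dual M i g f0 f1) := by
    intro k
    induction k with
    | zero =>
      intro _
      refine ⟨fun η => min η 1, Mon.id.min (Mon.const one_pos), fun η => min_le_right _ _, ?_⟩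
      intro G _ _ P _ M q _ i g ρ ζ _ f0 f1 _ _ η _ _ _ h
      exact (min_le_left _ _).trans h
    | succ k ih =>
      intro hk
      obtain ⟨f, mf, f1, hf⟩ := ih (by omega)
      obtain ⟨fB, mB, hB⟩ := thmB (k := 5 - (k + 1)) (by omega)
      have hk2 : 5 - (k + 1) + 1 = 5 - k := by omega
      refine ⟨fun η => min (f η) (fB (f η)), mf.min (mB.comp mf fun _ _ _ => f1 _),
        fun η => (min_le_left _ _).trans (f1 η), ?_⟩
      intro G _ _ P _ M q hP i g ρ ζ hF f0 f1' h0 h1 η hη hη1 hq h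
      refine (min_le_right _ _).trans ?_
      refine hB hP hF h0 h1 (mf.pos hη hη1) (f1 η) (hq.trans (by gcongr; exact min_le_right _ _)) ?_
      rw [hk2]
      exact hf hP hF h0 h1 hη hη1 (hq.trans (by gcongr; exact min_le_left _ _)) h
  obtain ⟨f, mf, f1, hf⟩ := step 4 le_rfl
  let a : ℝ → ℝ := fun δ => min (fA (δ ^ 2)) 1
  have hd : ∀ δ : ℝ, 0 < δ → δ ≤ 1 → δ ^ 2 ≤ 1 := fun δ h h1 => pow_le_one₀ h.le h1
  have ma : Mon a := (mA.comp (Mon.id.pow 2) hd).min (Mon.const one_pos)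
  refine ⟨fun δ => min (a δ) (f (a δ)), ma.min (mf.comp ma fun _ _ _ => min_le_right _ _), ?_⟩
  intro G _ _ P _ M q hP i g ρ ζ hF f0 f1' f2 h0 h1 h2 δ hδ hδ1 hq h
  refine (min_le_right _ _).trans ?_
  have hq1 : (1 : ℝ) ≤ q := by exact_mod_cast hF.hq
  refine hf hP hF h0 h1 (ma.pos hδ hδ1) (min_le_right _ _) (hq.trans (by gcongr; exact min_le_right _ _)) ?_
  refine (min_le_left _ _).trans ?_
  rw [← V_conj]
  have hDb : ∀ x, ‖dual M i g f0 f1' x‖ ≤ 1 := dual_bdd h0 h1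
  refine hA i g hP h0 h1 (fun x => by rw [RCLike.norm_conj]; exact hDb x) (by positivity) (hd δ hδ hδ1)
    (hq1.trans (hq.trans (by gcongr; exact (min_le_left _ _).trans (min_le_left _ _)))) ?_
  rw [dualize] at h
  have e2 := dualize (M := M) i g f0 f1' (fun x => conj (dual M i g f0 f1' x))
  rw [e2]
  have e3 : 𝔼 x, conj (dual M i g f0 f1' x) * dual M i g f0 f1' x = ((𝔼 x, ‖dual M i g f0 f1' x‖ ^ 2 : ℝ) : ℂ) := by
    rw [E_ofReal]; refine congrArg _ (funext fun x => ?_); rw [normsq_eq, mul_comm]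
  rw [e3, Complex.norm_real, Real.norm_eq_abs]
  refine le_trans ?_ (le_abs_self _)
  calc δ ^ 2 ≤ ‖𝔼 x, f2 x * dual M i g f0 f1' x‖ ^ 2 := by gcongr
    _ ≤ 𝔼 x, ‖f2 x * dual M i g f0 f1' x‖ ^ 2 := E_normsq_le _
    _ ≤ _ := E_mono fun x => by
      rw [norm_mul]
      exact pow_le_pow_left₀ (by positivity) (mul_le_of_le_one_left (norm_nonneg _) (h2 x)) 2
end
section
section
variable {P : ℕ} [NeZero P] {G : Type} [AddCommGroup G] [Fintype G]
lemma degB2_0 {M q : ℕ} {i : ZMod P →+ G} {g : G} {ρ : G → G} {ζ : G → ZMod P} (hF : Fib i g q ρ ζ)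
    {f0 f1 : G → ℂ} (h0 : ∀ x, ‖f0 x‖ ≤ 1) (h1 : ∀ x, ‖f1 x‖ ≤ 1)
    (c : G → ℂ) (φ : G → ZMod P)
    (hc : ∀ x z, c (x + i z) = c x) (hφ : ∀ x z, φ (x + i z) = φ x) :
    ‖𝔼 x, c x * 𝔼 z, dual M i g f0 f1 (ρ x + i z) * ee (-(φ x * z))‖
      ≤ ‖Sm M g (fun x => c x * ee (-(φ x * ζ x)) * f0 x) f1 (fun x => -φ x)‖ := by
  have := degB2 (M := M) (k := 0) hF h0 h1 (fun x _ => c x) (fun x _ => φ x)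
    (fun x z => by rw [hc]) (fun x z => by rw [hφ])
  simpa only [E_DD_zero, cp, ap, sg, mD, map_zero, add_zero, pow_zero, pow_one] using this
lemma nrm_natmul (m : ℕ) (x : ZMod P) : nrm ((m : ZMod P) * x) ≤ m * nrm x := by
  have h : (m : ZMod P) * x = (((m : ℤ) * x.valMinAbs : ℤ) : ZMod P) := by
    rw [Int.cast_mul, ZMod.coe_valMinAbs]; simp
  rw [h]
  refine (nrm_le _).trans ?_
  rw [Int.natAbs_mul]; simp [nrm]
lemma shiftR {M q b T : ℕ} {i : ZMod P →+ G} {g : G} (hg : q • g = i 1) (hP : P = 8 * M ^ 2)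
    {A f1 : G → ℂ} (hA : ∀ x, ‖A x‖ ≤ 1) (h1 : ∀ x, ‖f1 x‖ ≤ 1) {ξ : ZMod P} {B τ : ℝ}
    (hbB : (b : ℝ) ≤ B) (hB1 : 1 ≤ B) (hξ : (nrm ((b : ZMod P) * ξ) : ℝ) ≤ B) (hM : 0 < M)
    (hT : (T : ℝ) * q ≤ τ * M) (hτ : 0 ≤ τ) (hτB : τ * B ≤ 1) (t : ℕ) (ht : t < T) :
    ‖Sm M g A f1 (fun _ => ξ) - 𝔼 x, A x * 𝔼 y : Fin M, f1 (x + i ((b : ZMod P) * (t : ZMod P)) + ((y : ℕ) + 1) • g) *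
      ee (ξ * (((y : ℕ) : ZMod P) + 1) ^ 2)‖ ≤ 5 * B * τ := by
  have hMr : (0 : ℝ) < M := by exact_mod_cast hM
  have htq : (t : ℝ) * q ≤ τ * M := by
    refine le_trans ?_ hT
    gcongr
  have hb0 : (0 : ℝ) ≤ b := Nat.cast_nonneg _
  rw [Sm, ← expect_sub_distrib]
  refine E_norm_le_const (by positivity) fun x => ?_
  rw [← mul_sub, norm_mul]
  refine (mul_le_of_le_one_left (norm_nonneg _) (hA x)).trans ?_
  have a1 := E_interval_shift (M := M) (fun y : ℕ => f1 (x + (y + 1) • g) * ee (ξ * ((y : ZMod P) + 1) ^ 2))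
    (fun y => norm_mul_le_one (h1 _) (ee_norm _).le) (q * b * t)
  have a2 : ‖𝔼 y : Fin M, f1 (x + (((y : ℕ) + q * b * t) + 1) • g) * ee (ξ * ((((y : ℕ) + q * b * t : ℕ) : ZMod P) + 1) ^ 2)
     - 𝔼 y : Fin M, f1 (x + i ((b : ZMod P) * (t : ZMod P)) + ((y : ℕ) + 1) • g) *
      ee (ξ * (((y : ℕ) : ZMod P) + 1) ^ 2)‖ ≤ 3 * B * τ := by
    rw [← expect_sub_distrib]
    refine E_norm_le_const (by positivity) fun y => ?_
    have e1 : x + (((y : ℕ) + q * b * t) + 1) • g = x + i ((b : ZMod P) * (t : ZMod P)) + ((y : ℕ) + 1) • g := by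
      have : i ((b : ZMod P) * (t : ZMod P)) = (q * b * t) • g := by
        have h : (b : ZMod P) * (t : ZMod P) = (b * t) • (1 : ZMod P) := by simp
        rw [h, map_nsmul, ← hg, ← mul_nsmul']
        congr 1; ring
      rw [this, add_assoc x, ← add_nsmul]
      congr 2; ring
    rw [e1, ← mul_sub, norm_mul]
    refine (mul_le_of_le_one_left (norm_nonneg _) (h1 _)).trans ?_
    set m : ℕ := t * (2 * q * ((y : ℕ) + 1) + q * q * b * t) with hm
    have e2 : ξ * ((((y : ℕ) + q * b * t : ℕ) : ZMod P) + 1) ^ 2 = ξ * (((y : ℕ) : ZMod P) + 1) ^ 2 + (m : ZMod P) * ((b : ZMod P) * ξ) := by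
      rw [hm]; push_cast; ring
    rw [e2, ee_add]
    have e3 : ∀ u v : ℂ, u * v - u = u * (v - 1) := fun u v => by ring
    rw [e3, norm_mul, ee_norm, one_mul]
    refine (ee_sub_one_nrm _).trans ?_
    have hPr : (P : ℝ) = 8 * M ^ 2 := by rw [hP]; push_cast; ring
    rw [hPr, div_le_iff₀ (by positivity)]
    have n1 : (nrm ((m : ZMod P) * ((b : ZMod P) * ξ)) : ℝ) ≤ m * B := by
      have : (nrm ((m : ZMod P) * ((b : ZMod P) * ξ)) : ℝ) ≤ m * nrm ((b : ZMod P) * ξ) := by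
        exact_mod_cast nrm_natmul m _
      exact this.trans (by gcongr)
    have n2 : (m : ℝ) ≤ 3 * τ * M ^ 2 := by
      have hy : ((y : ℕ) : ℝ) + 1 ≤ M := by exact_mod_cast y.2
      have : (m : ℝ) = (t * q) * (2 * ((y : ℕ) + 1) + (t * q) * b) := by rw [hm]; push_cast; ring
      rw [this]
      have h3 : (t * q : ℝ) * b ≤ M := by
        calc (t * q : ℝ) * b ≤ (τ * M) * B := by gcongr
          _ = τ * B * M := by ring
          _ ≤ 1 * M := by gcongr
          _ = M := one_mul _
      calc (t * q : ℝ) * (2 * ((y : ℕ) + 1) + (t * q) * b) ≤ (τ * M) * (2 * M + M) := by gcongr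
        _ = _ := by ring
    have n3 : (m : ℝ) * B ≤ 3 * τ * M ^ 2 * B := by gcongr
    have n4 : 0 ≤ τ * M ^ 2 * B := by positivity
    linarith only [n1, n3, n4]
  have a3 : 2 * ((q * b * t : ℕ) : ℝ) / M ≤ 2 * B * τ := by
    rw [div_le_iff₀ hMr]
    have : ((q * b * t : ℕ) : ℝ) = (t * q) * b := by push_cast; ring
    rw [this]
    calc 2 * ((t * q : ℝ) * b) ≤ 2 * ((τ * M) * B) := by gcongr
      _ = _ := by ring
  have a4 := a1.trans a3
  refine (norm_sub_le_norm_sub_add_norm_sub _ _ _).trans ((add_le_add a4 a2).trans ?_)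
  linarith
lemma fin1 {M q b T : ℕ} {i : ZMod P →+ G} {g : G} (hg : q • g = i 1) (hP : P = 8 * M ^ 2)
    {A f1 : G → ℂ} (hA : ∀ x, ‖A x‖ ≤ 1) (h1 : ∀ x, ‖f1 x‖ ≤ 1) {ξ : ZMod P} {B τ : ℝ}
    (hbB : (b : ℝ) ≤ B) (hB1 : 1 ≤ B) (hξ : (nrm ((b : ZMod P) * ξ) : ℝ) ≤ B) (hM : 0 < M)
    (hT0 : 0 < T) (hT : (T : ℝ) * q ≤ τ * M) (hτ : 0 ≤ τ) (hτB : τ * B ≤ 1) :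
    ‖Sm M g A f1 (fun _ => ξ)‖ ≤ (𝔼 x, ‖𝔼 t : Fin T, f1 (x + i ((b : ZMod P) * ((t : ℕ) : ZMod P)))‖) + 5 * B * τ := by
  haveI : NeZero T := ⟨hT0.ne'⟩
  haveI : NeZero M := ⟨hM.ne'⟩
  have h2 : ‖Sm M g A f1 (fun _ => ξ) - 𝔼 t : Fin T, 𝔼 x, A x * 𝔼 y : Fin M, f1 (x + i ((b : ZMod P) * ((t : ℕ) : ZMod P)) + ((y : ℕ) + 1) • g) *
      ee (ξ * (((y : ℕ) : ZMod P) + 1) ^ 2)‖ ≤ 5 * B * τ := by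
    rw [← E_const (ι := Fin T) (Sm M g A f1 (fun _ => ξ)), ← expect_sub_distrib]
    exact E_norm_le_const (by positivity) fun t => shiftR hg hP hA h1 hbB hB1 hξ hM hT hτ hτB t t.2
  have h3 := norm_le_norm_add_norm_sub' (Sm M g A f1 (fun _ => ξ)) (𝔼 t : Fin T, 𝔼 x, A x * 𝔼 y : Fin M, f1 (x + i ((b : ZMod P) * ((t : ℕ) : ZMod P)) + ((y : ℕ) + 1) • g) *
      ee (ξ * (((y : ℕ) : ZMod P) + 1) ^ 2))
  refine h3.trans (add_le_add ?_ h2)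
  rw [E_comm]
  have e : ∀ x, 𝔼 t : Fin T, A x * 𝔼 y : Fin M, f1 (x + i ((b : ZMod P) * ((t : ℕ) : ZMod P)) + ((y : ℕ) + 1) • g) *
      ee (ξ * (((y : ℕ) : ZMod P) + 1) ^ 2) = A x * 𝔼 y : Fin M, ee (ξ * (((y : ℕ) : ZMod P) + 1) ^ 2) *
      𝔼 t : Fin T, f1 ((x + ((y : ℕ) + 1) • g) + i ((b : ZMod P) * ((t : ℕ) : ZMod P))) := by
    intro x
    rw [← mul_expect, E_comm]
    congr 1
    refine congrArg _ (funext fun y => ?_)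
    rw [mul_expect]
    refine congrArg _ (funext fun t => ?_)
    rw [add_right_comm, mul_comm]
  simp_rw [e]
  calc _ ≤ 𝔼 x, 𝔼 y : Fin M, ‖𝔼 t : Fin T, f1 ((x + ((y : ℕ) + 1) • g) + i ((b : ZMod P) * ((t : ℕ) : ZMod P)))‖ := by
        refine (E_norm_le _).trans (E_mono fun x => ?_)
        rw [norm_mul]
        refine (mul_le_of_le_one_left (norm_nonneg _) (hA x)).trans ((E_norm_le _).trans (E_mono fun y => ?_))
        rw [norm_mul, ee_norm, one_mul]
    _ = _ := by
        rw [E_comm]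
        have : ∀ y : Fin M, 𝔼 x, ‖𝔼 t : Fin T, f1 ((x + ((y : ℕ) + 1) • g) + i ((b : ZMod P) * ((t : ℕ) : ZMod P)))‖
          = 𝔼 x, ‖𝔼 t : Fin T, f1 (x + i ((b : ZMod P) * ((t : ℕ) : ZMod P)))‖ := fun y =>
            E_shift (fun x => ‖𝔼 t : Fin T, f1 (x + i ((b : ZMod P) * ((t : ℕ) : ZMod P)))‖) _
        simp_rw [this]; rw [E_const]
lemma fin0 {M q b T : ℕ} {i : ZMod P →+ G} {g : G} {ρ : G → G} {ζ : G → ZMod P} (hF : Fib i g q ρ ζ)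
    (hg : q • g = i 1) (hP : P = 8 * M ^ 2)
    {c f0 f1 : G → ℂ} (hc1 : ∀ x, ‖c x‖ ≤ 1) (h0 : ∀ x, ‖f0 x‖ ≤ 1) (h1 : ∀ x, ‖f1 x‖ ≤ 1) {ξ : ZMod P} {B τ : ℝ}
    (hc : ∀ x z, c (x + i z) = c x)
    (hbB : (b : ℝ) ≤ B) (hB1 : 1 ≤ B) (hξ : (nrm ((b : ZMod P) * ξ) : ℝ) ≤ B) (hM : 0 < M)
    (hT0 : 0 < T) (hT : (T : ℝ) * q ≤ τ * M) (hτ : 0 ≤ τ) (hτB : τ * B ≤ 1) :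
    ‖Sm M g (fun x => c x * ee (ξ * ζ x) * f0 x) f1 (fun _ => ξ)‖ ≤
      (𝔼 x, ‖𝔼 t : Fin T, f0 (x + i ((b : ZMod P) * ((t : ℕ) : ZMod P)))‖) + 6 * B * τ := by
  haveI : NeZero T := ⟨hT0.ne'⟩
  haveI : NeZero M := ⟨hM.ne'⟩
  have hMr : (1 : ℝ) ≤ M := by exact_mod_cast hM
  have hq1 : (1 : ℝ) ≤ q := by exact_mod_cast hF.hq
  set S := Sm M g (fun x => c x * ee (ξ * ζ x) * f0 x) f1 (fun _ => ξ) with hS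
  set Q : G → ℂ := fun x => 𝔼 y : Fin M, f1 (x + ((y : ℕ) + 1) • g) * ee (ξ * (((y : ℕ) : ZMod P) + 1) ^ 2) with hQ
  have hQ1 : ∀ x, ‖Q x‖ ≤ 1 := fun x => E_norm_le_one fun y => norm_mul_le_one (h1 _) (ee_norm _).le
  have hA : ∀ x, ‖c x * ee (ξ * ζ x) * f0 x‖ ≤ 1 := fun x => norm_mul_le_one (norm_mul_le_one (hc1 x) (ee_norm _).le) (h0 x)
  have h2 : ∀ t : Fin T, ‖S - 𝔼 x, (c x * ee (ξ * ζ x) * Q x) * f0 (x - i ((b : ZMod P) * ((t : ℕ) : ZMod P)))‖ ≤ 6 * B * τ := by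
    intro t
    have a1 := shiftR hg hP hA h1 hbB hB1 hξ hM hT hτ hτB t t.2
    rw [← hS] at a1
    set z := (b : ZMod P) * ((t : ℕ) : ZMod P) with hz
    have a2 : 𝔼 x, (c x * ee (ξ * ζ x) * f0 x) * 𝔼 y : Fin M, f1 (x + i z + ((y : ℕ) + 1) • g) *
      ee (ξ * (((y : ℕ) : ZMod P) + 1) ^ 2) = 𝔼 x, (c x * ee (ξ * ζ x - ξ * z) * f0 (x - i z)) * Q x := by
      refine Eq.trans ?_ (E_shift (fun x => (c x * ee (ξ * ζ x - ξ * z) * f0 (x - i z)) * Q x) (i z))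
      refine congrArg _ (funext fun x => ?_)
      simp only [hc, hF.hζ, add_sub_cancel_right, hQ]
      rw [mul_add, add_sub_cancel_right]
    rw [a2] at a1
    have a3 : ‖𝔼 x, (c x * ee (ξ * ζ x - ξ * z) * f0 (x - i z)) * Q x - 𝔼 x, (c x * ee (ξ * ζ x) * Q x) * f0 (x - i z)‖ ≤ B * τ := by
      rw [← expect_sub_distrib]
      refine E_norm_le_const (by positivity) fun x => ?_
      have : (c x * ee (ξ * ζ x - ξ * z) * f0 (x - i z)) * Q x - (c x * ee (ξ * ζ x) * Q x) * f0 (x - i z)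
         = (c x * ee (ξ * ζ x) * f0 (x - i z)) * Q x * (ee (-(ξ * z)) - 1) := by
        rw [ee_sub, ee_neg]; ring
      rw [this, norm_mul]
      refine (mul_le_of_le_one_left (norm_nonneg _) (norm_mul_le_one (norm_mul_le_one (norm_mul_le_one (hc1 x) (ee_norm _).le) (h0 _)) (hQ1 x))).trans ?_
      refine (ee_sub_one_nrm _).trans ?_
      rw [nrm_neg]
      have hPr : (P : ℝ) = 8 * M ^ 2 := by rw [hP]; push_cast; ring
      rw [hPr, div_le_iff₀ (by positivity)]
      have ez : ξ * z = ((t : ℕ) : ZMod P) * ((b : ZMod P) * ξ) := by rw [hz]; ring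
      rw [ez]
      have n1 : (nrm (((t : ℕ) : ZMod P) * ((b : ZMod P) * ξ)) : ℝ) ≤ (t : ℕ) * nrm ((b : ZMod P) * ξ) := by
        exact_mod_cast nrm_natmul _ _
      have n2 : ((t : ℕ) : ℝ) * nrm ((b : ZMod P) * ξ) ≤ T * q * B := by
        calc ((t : ℕ) : ℝ) * nrm ((b : ZMod P) * ξ) ≤ T * B := by
              gcongr; exact t.2.le
          _ = T * 1 * B := by ring
          _ ≤ T * q * B := by gcongr
      have n3 : (T : ℝ) * q * B ≤ τ * M * B := by gcongr
      have n4 : τ * M * B ≤ τ * (M ^ 2) * B := by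
        gcongr; nlinarith
      have n5 : 0 ≤ τ * (M : ℝ) ^ 2 * B := by positivity
      linarith only [n1, n2, n3, n4, n5]
    refine (norm_sub_le_norm_sub_add_norm_sub _ _ _).trans ((add_le_add a1 a3).trans ?_)
    linarith
  have h3 : ‖S - 𝔼 t : Fin T, 𝔼 x, (c x * ee (ξ * ζ x) * Q x) * f0 (x - i ((b : ZMod P) * ((t : ℕ) : ZMod P)))‖ ≤ 6 * B * τ := by
    rw [← E_const (ι := Fin T) S, ← expect_sub_distrib]
    exact E_norm_le_const (by positivity) h2
  refine (norm_le_norm_add_norm_sub' S _).trans (add_le_add ?_ h3)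
  rw [E_comm]
  simp_rw [← mul_expect]
  refine (E_norm_le _).trans ?_
  rw [← E_shift_sub (fun x => ‖𝔼 t : Fin T, f0 (x + i ((b : ZMod P) * ((t : ℕ) : ZMod P)))‖) (i ((b : ZMod P) * ((T - 1 : ℕ) : ZMod P)))]
  refine E_mono fun x => ?_
  rw [norm_mul]
  refine (mul_le_of_le_one_left (norm_nonneg _) (norm_mul_le_one (norm_mul_le_one (hc1 x) (ee_norm _).le) (hQ1 x))).trans ?_
  have : 𝔼 t : Fin T, f0 (x - i ((b : ZMod P) * ((t : ℕ) : ZMod P))) =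
    𝔼 t : Fin T, f0 (x - i ((b : ZMod P) * ((T - 1 : ℕ) : ZMod P)) + i ((b : ZMod P) * ((t : ℕ) : ZMod P))) := by
    rw [Fintype.expect_eq_sum_div_card, Fintype.expect_eq_sum_div_card]
    congr 1
    rw [← Equiv.sum_comp Fin.revPerm]
    refine sum_congr rfl fun t _ => ?_
    congr 1
    have ht : ((Fin.revPerm t : Fin T) : ℕ) = T - 1 - (t : ℕ) := by
      simp only [Fin.revPerm_apply, Fin.val_rev]; omega
    rw [ht, Nat.cast_sub (by have := t.2; omega), mul_sub, map_sub]
    abel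
  rw [this]
end
end
section
open Classical in
theorem thmC : ∃ f : ℝ → ℝ, Mon f ∧ ∀ {G : Type} [AddCommGroup G] [Fintype G] {P : ℕ} [NeZero P] {M q : ℕ} (_ : P = 8 * M ^ 2)
    {i : ZMod P →+ G} {g : G} {ρ : G → G} {ζ : G → ZMod P} (_ : Fib i g q ρ ζ) (_ : q • g = i 1)
    {f0 f1 f2 : G → ℂ} (_ : ∀ x, ‖f0 x‖ ≤ 1) (_ : ∀ x, ‖f1 x‖ ≤ 1) (_ : ∀ x, ‖f2 x‖ ≤ 1) {δ : ℝ} (_ : 0 < δ) (_ : δ ≤ 1)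
    (_ : q ≤ M * f δ)
    (_ : δ ≤ ‖𝔼 x, 𝔼 y : Fin M, f0 x * f1 (x + ((y : ℕ) + 1) • g) * f2 (x + i ((((y : ℕ) : ZMod P) + 1) ^ 2))‖),
    ∃ b : ℕ, 0 < b ∧ (b : ℝ) ≤ 1 / f δ ∧ ∀ T : ℕ, 0 < T → (T : ℝ) * q ≤ f δ * M →
      f δ ≤ (𝔼 x, ‖𝔼 t : Fin T, f0 (x + i ((b : ZMod P) * ((t : ℕ) : ZMod P)))‖) ∧
      f δ ≤ (𝔼 x, ‖𝔼 t : Fin T, f1 (x + i ((b : ZMod P) * ((t : ℕ) : ZMod P)))‖) := by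
  obtain ⟨fA, mA, hA⟩ := thmAB
  obtain ⟨fM, mM, M1, hM⟩ := MALd
  let η : ℝ → ℝ := fun δ => min (fA δ) 1
  let κ : ℝ → ℝ := fun δ => η δ / 4
  let lam : ℝ → ℝ := fun δ => η δ / 2 * (κ δ * fM (κ δ) ^ 3 / 3)
  let τ : ℝ → ℝ := fun δ => lam δ * fM (κ δ) / 12
  have mη : Mon η := mA.min (Mon.const one_pos)
  have hη1' : ∀ δ, η δ ≤ 1 := fun δ => min_le_right _ _
  have hκ1 : ∀ δ : ℝ, κ δ ≤ 1 := by
    intro δ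
    have := hη1' δ
    simp only [κ]; linarith
  have mκ : Mon κ := mη.div (by norm_num)
  have mMκ : Mon (fun η => fM (κ η)) := mM.comp mκ fun δ _ _ => hκ1 δ
  have ml : Mon lam := (mη.div (by norm_num)).mul ((mκ.mul (mMκ.pow 3)).div (by norm_num))
  have mτ : Mon τ := (ml.mul mMκ).div (by norm_num)
  refine ⟨fun δ => min (fA δ) (min (fM (κ δ)) (τ δ)), mA.min (mMκ.min mτ), ?_⟩
  intro G _ _ P _ M q hP i g ρ ζ hF hg f0 f1 f2 h0 h1 h2 δ hδ hδ1 hq h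
  have hf1 : min (fA δ) (min (fM (κ δ)) (τ δ)) ≤ fA δ := min_le_left _ _
  have hf2 : min (fA δ) (min (fM (κ δ)) (τ δ)) ≤ fM (κ δ) := (min_le_right _ _).trans (min_le_left _ _)
  have hf3 : min (fA δ) (min (fM (κ δ)) (τ δ)) ≤ τ δ := (min_le_right _ _).trans (min_le_right _ _)
  have hf0 : 0 < min (fA δ) (min (fM (κ δ)) (τ δ)) := (mA.min (mMκ.min mτ)).pos hδ hδ1
  have hV := hA hP hF h0 h1 h2 hδ hδ1 (hq.trans (by gcongr)) h
  have hq1 : (1 : ℝ) ≤ q := by exact_mod_cast hF.hq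
  simp only [] at hq ⊢
  set fδ := min (fA δ) (min (fM (κ δ)) (τ δ)) with hfδ
  have hMr : (0 : ℝ) < M := by
    by_contra hc
    have : (M : ℝ) = 0 := le_antisymm (not_lt.1 hc) (Nat.cast_nonneg _)
    rw [this] at hq; linarith
  have hM0 : 0 < M := by exact_mod_cast hMr
  have pκ := mκ.pos hδ hδ1
  have pM := mMκ.pos hδ hδ1
  have pη := mη.pos hδ hδ1
  have pl := ml.pos hδ hδ1
  have pτ := mτ.pos hδ hδ1
  have pM1 : fM (κ δ) ≤ 1 := M1 _
  have pη1 := hη1' δ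
  have pκ1 := hκ1 δ
  have hV' : η δ ≤ V i 1 (dual M i g f0 f1) := (min_le_left _ _).trans hV
  have hqM : (q : ℝ) ≤ M * fM (κ δ) := hq.trans (by gcongr)
  have ekd : κ δ = η δ / 4 := rfl
  have eld : lam δ = η δ / 2 * (κ δ * fM (κ δ) ^ 3 / 3) := rfl
  have etd : τ δ = lam δ * fM (κ δ) / 12 := rfl
  clear_value η κ lam τ fδ
  set F := dual M i g f0 f1 with hFd
  have hFb : ∀ x, ‖F x‖ ≤ 1 := dual_bdd h0 h1
  have e1 : ∀ r, ∃ φ : ZMod P, V (AddMonoidHom.id (ZMod P)) 1 (fun w => F (r + i w))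
      ≤ ‖𝔼 z, F (r + i z) * ee (-(φ * z))‖ ^ 2 :=
    fun r => U2_inv (fun w => hFb _)
  choose φ0 hφ0 using e1
  let φ : G → ZMod P := fun x => φ0 (ρ x)
  let w : G → ℂ := fun x => 𝔼 z, F (ρ x + i z) * ee (-(φ x * z))
  have hw1 : ∀ x, ‖w x‖ ≤ 1 := fun x => E_norm_le_one fun z => norm_mul_le_one (hFb _) (ee_norm _).le
  have hφi : ∀ x z, φ (x + i z) = φ x := fun x z => by simp only [φ, hF.hρ]
  have hwi : ∀ x z, w (x + i z) = w x := fun x z => by simp only [w, hφi, hF.hρ]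
  have gen : ∀ p : G → Prop, (∀ x z, p (x + i z) ↔ p x) →
      (𝔼 x, if p x then ‖w x‖ ^ 2 else 0) ≤ ‖Sm M g (fun x => (if p x then conj (w x) else 0) * ee (-(φ x * ζ x)) * f0 x) f1 (fun x => -φ x)‖ := by
    intro p hp
    have h3 := degB2_0 (M := M) hF h0 h1 (fun x => if p x then conj (w x) else 0) φ
      (fun x z => by simp only [hp, hwi]) hφi
    refine le_trans ?_ h3
    have : 𝔼 x, (if p x then conj (w x) else 0) * 𝔼 z, dual M i g f0 f1 (ρ x + i z) * ee (-(φ x * z))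
        = ((𝔼 x, (if p x then ‖w x‖ ^ 2 else 0) : ℝ) : ℂ) := by
      rw [E_ofReal]
      refine congrArg _ (funext fun x => ?_)
      change (if p x then conj (w x) else 0) * w x = _
      split_ifs
      · rw [mul_comm, normsq_eq]
      · simp
    rw [this, Complex.norm_real, Real.norm_eq_abs]
    exact le_abs_self _
  have hG0 : ∀ p : G → Prop, ∀ x, ‖(if p x then conj (w x) else 0) * ee (-(φ x * ζ x)) * f0 x‖ ≤ 1 := by
    intro p x
    refine norm_mul_le_one (norm_mul_le_one ?_ (ee_norm _).le) (h0 x)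
    split_ifs
    · rw [RCLike.norm_conj]; exact hw1 x
    · simp
  have s1 : η δ / 2 ≤ 𝔼 x, if η δ / 2 ≤ ‖w x‖ ^ 2 then ‖w x‖ ^ 2 else 0 := by
    have h2 : η δ ≤ 𝔼 x, ((if η δ / 2 ≤ ‖w x‖ ^ 2 then ‖w x‖ ^ 2 else 0) + η δ / 2) := by
      refine hV'.trans ?_
      rw [hF.V_eq]
      refine E_mono fun x => (hφ0 _).trans ?_
      change ‖w x‖ ^ 2 ≤ _
      split_ifs with h
      · linarith
      · linarith [not_le.1 h]
    simp_rw [expect_add_distrib, E_const] at h2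
    linarith
  have s2 := hM hP hF (hG0 (fun x => η δ / 2 ≤ ‖w x‖ ^ 2)) h1 (fun x => -φ x) (fun x => η δ / 2 ≤ ‖w x‖ ^ 2)
    (fun x hx => by simp only [if_neg hx]; ring) (fun x z => by rw [hφi]) (fun x z => by rw [hwi]) pκ pκ1 hqM
  have s3 := (s1.trans (gen (fun x => η δ / 2 ≤ ‖w x‖ ^ 2) (fun x z => by rw [hwi]))).trans s2
  set B := 1 / fM (κ δ) with hB
  have hB1 : 1 ≤ B := by rw [hB, le_div_iff₀ pM]; linarith
  have s4 : κ δ ≤ 𝔼 x, if η δ / 2 ≤ ‖w x‖ ^ 2 ∧ Maj B (-φ x) then (1 : ℝ) else 0 := by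
    linarith only [s3, ekd]
  obtain ⟨ξ, ⟨b, hb0, hbB, hbξ⟩, s5⟩ := pig (fun x => η δ / 2 ≤ ‖w x‖ ^ 2) (fun x => -φ x) hB1 pκ s4
  obtain ⟨p, hp⟩ : ∃ p : G → Prop, ∀ x, p x ↔ (η δ / 2 ≤ ‖w x‖ ^ 2 ∧ -φ x = ξ) := ⟨_, fun x => Iff.rfl⟩
  have hpp : ∀ x z, p (x + i z) = p x := fun x z => by rw [eq_iff_iff, hp, hp, hwi, hφi]
  have s6 := gen p (fun x z => iff_of_eq (hpp x z))
  have s7 : lam δ ≤ 𝔼 x, if p x then ‖w x‖ ^ 2 else 0 := by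
    have : lam δ = η δ / 2 * (κ δ / (3 * B ^ 3)) := by
      rw [eld, hB]; field_simp
    rw [this]
    refine (mul_le_mul_of_nonneg_left s5 (by positivity)).trans ?_
    refine E_ge_of_ind (fun x => ?_) (fun x hx => ?_)
    · split_ifs <;> positivity
    · rw [if_pos ((hp x).2 hx)]; exact hx.1
  let c : G → ℂ := fun x => if p x then conj (w x) else 0
  have hc1 : ∀ x, ‖c x‖ ≤ 1 := by
    intro x; simp only [c]; split_ifs
    · rw [RCLike.norm_conj]; exact hw1 x
    · simp
  have hci : ∀ x z, c (x + i z) = c x := fun x z => by simp only [c, hwi, hpp]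
  have s8 : Sm M g (fun x => (if p x then conj (w x) else 0) * ee (-(φ x * ζ x)) * f0 x) f1 (fun x => -φ x)
      = Sm M g (fun x => c x * ee (ξ * ζ x) * f0 x) f1 (fun _ => ξ) := by
    simp only [Sm]
    refine congrArg _ (funext fun x => ?_)
    simp only [c]
    split_ifs with hx
    · rw [← neg_mul, ((hp x).1 hx).2]
    · simp
  have s9 := s7.trans s6
  rw [s8] at s9
  have hBf : B * τ δ = lam δ / 12 := by rw [etd, hB]; field_simp
  have hl1 : lam δ ≤ 1 := by
    refine s9.trans (E_norm_le_one fun x => norm_mul_le_one (norm_mul_le_one (norm_mul_le_one (hc1 x) (ee_norm _).le) (h0 x)) (E_norm_le_one fun y => norm_mul_le_one (h1 _) (ee_norm _).le))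
  have hτl : τ δ ≤ lam δ / 2 := by
    rw [etd]
    have : lam δ * fM (κ δ) ≤ lam δ := mul_le_of_le_one_right pl.le pM1
    linarith
  refine ⟨b, hb0, hbB.trans (one_div_le_one_div_of_le hf0 hf2), fun T hT0 hT => ?_⟩
  have hT' : (T : ℝ) * q ≤ τ δ * M := hT.trans (by gcongr)
  have r0 := fin0 (T := T) hF hg hP hc1 h0 h1 hci hbB hB1 hbξ hM0 hT0 hT' pτ.le (by linarith)
  have r1 := fin1 (T := T) hg hP (A := fun x => c x * ee (ξ * ζ x) * f0 x)
    (fun x => norm_mul_le_one (norm_mul_le_one (hc1 x) (ee_norm _).le) (h0 x)) h1 hbB hB1 hbξ hM0 hT0 hT' pτ.le (by linarith)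
  constructor
  · linarith only [s9, r0, hBf, hτl, hf3]
  · linarith only [s9, r1, hBf, hτl, hf3, pl]
end
section
def iH (q P : ℕ) [NeZero P] : ZMod P →+ ZMod (q * P) :=
  AddMonoidHom.mk' (fun z => ((q * z.val : ℕ) : ZMod (q * P))) (fun a b => by
    rw [← Nat.cast_add, ZMod.natCast_eq_natCast_iff, ← mul_add, ZMod.val_add, Nat.ModEq,
      Nat.mul_mod_mul_left, Nat.mul_mod_mul_left, Nat.mod_mod])
lemma iH_nat (q P : ℕ) [NeZero P] (m : ℕ) : iH q P (m : ZMod P) = ((q * m : ℕ) : ZMod (q * P)) := by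
  change (((q * (m : ZMod P).val : ℕ) : ZMod (q * P))) = _
  rw [ZMod.natCast_eq_natCast_iff, ZMod.val_natCast, Nat.ModEq, Nat.mul_mod_mul_left,
    Nat.mul_mod_mul_left, Nat.mod_mod]
lemma iH_one (q P : ℕ) [NeZero P] : q • (1 : ZMod (q * P)) = iH q P 1 := by
  have := iH_nat q P 1
  rw [Nat.cast_one, mul_one] at this
  rw [this, nsmul_eq_mul, mul_one]
lemma iH_val (q P : ℕ) [NeZero P] (x : ZMod (q * P)) (z : ZMod P) (hq : 0 < q) :
    ∃ k : ℕ, (x + iH q P z).val + q * P * k = x.val + q * z.val := by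
  haveI : NeZero (q * P) := ⟨(Nat.mul_pos hq (NeZero.pos P)).ne'⟩
  have : x + iH q P z = ((x.val + q * z.val : ℕ) : ZMod (q * P)) := by
    rw [Nat.cast_add, ZMod.natCast_zmod_val]; rfl
  rw [this, ZMod.val_natCast]
  exact ⟨_, Nat.mod_add_div _ _⟩
lemma E_step {n q : ℕ} [NeZero n] (hq : 0 < q) (φ : ZMod n → ℝ) (h : ∀ x, φ (x + q) = φ x) (x : ZMod n) :
    (𝔼 k : Fin q, φ (x - (k : ℕ) • 1)) = 𝔼 x, φ x := by
  have key : ∀ x : ZMod n, (𝔼 k : Fin q, φ (x + 1 - (k : ℕ) • 1)) = 𝔼 k : Fin q, φ (x - (k : ℕ) • 1) := by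
    intro x
    rw [Fintype.expect_eq_sum_div_card, Fintype.expect_eq_sum_div_card]
    congr 1
    rw [Fin.sum_univ_eq_sum_range (fun k => φ (x + 1 - k • 1)) q, Fin.sum_univ_eq_sum_range (fun k => φ (x - k • 1)) q]
    have h1 := Finset.sum_range_succ (fun k : ℕ => φ (x + 1 - k • 1)) q
    have h2 := Finset.sum_range_succ' (fun k : ℕ => φ (x + 1 - k • 1)) q
    have h3 : φ (x + 1 - q • 1) = φ (x + 1 - 0 • 1) := by
      rw [← h (x + 1 - q • 1)]; congr 1; simp
    have h4 : ∀ k : ℕ, x + 1 - (k + 1) • 1 = x - k • 1 := fun k => by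
      rw [add_smul, one_smul]; abel
    simp only [h4] at h2
    linarith
  have all : ∀ m : ℕ, (𝔼 k : Fin q, φ ((m : ZMod n) - (k : ℕ) • 1)) = 𝔼 k : Fin q, φ (((0 : ℕ) : ZMod n) - (k : ℕ) • 1) := by
    intro m
    induction m with
    | zero => rfl
    | succ m ih => rw [← ih, Nat.cast_succ, key]
  have all' : ∀ y : ZMod n, (𝔼 k : Fin q, φ (y - (k : ℕ) • 1)) = 𝔼 k : Fin q, φ (((0 : ℕ) : ZMod n) - (k : ℕ) • 1) := by
    intro y
    have := all y.val
    rwa [ZMod.natCast_zmod_val] at this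
  haveI : Nonempty (Fin q) := ⟨⟨0, hq⟩⟩
  have h5 : (𝔼 y : ZMod n, 𝔼 k : Fin q, φ (y - (k : ℕ) • 1)) = 𝔼 x, φ x := by
    rw [E_comm]
    simp_rw [E_shift_sub]
    exact E_const _
  rw [all', ← h5]
  simp_rw [all']
  exact (E_const _).symm
lemma fibInst (q P : ℕ) [NeZero P] [NeZero (q * P)] (hq : 0 < q) :
    Fib (iH q P) (1 : ZMod (q * P)) q (fun x => ((x.val % q : ℕ) : ZMod (q * P)))
      (fun x => ((x.val / q : ℕ) : ZMod P)) := by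
  refine ⟨fun x => ?_, fun x z => ?_, fun x z => ?_, hq, fun φ h x => ?_⟩
  · rw [iH_nat, ← Nat.cast_add, Nat.mod_add_div, ZMod.natCast_zmod_val]
  · obtain ⟨k, hk⟩ := iH_val q P x z hq
    congr 1
    have := congrArg (· % q) hk
    simp only [mul_assoc, Nat.add_mul_mod_self_left] at this
    exact this
  · obtain ⟨k, hk⟩ := iH_val q P x z hq
    have := congrArg (· / q) hk
    simp only [mul_assoc, Nat.add_mul_div_left _ _ hq] at this
    have := congrArg (Nat.cast : ℕ → ZMod P) this
    simpa using this
  · refine E_step hq φ (fun x => ?_) x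
    have := h x 1
    rw [← iH_one] at this
    rwa [nsmul_eq_mul, mul_one] at this
end
section
lemma tau_lt {κ T : ℕ} (hκ : 0 < κ) (hT : 0 < T) (a : ℤ) : 0 ≤ (a % (κ * T : ℤ)) / κ ∧ (a % (κ * T : ℤ)) / κ < T := by
  have hD : (0 : ℤ) < κ * T := by positivity
  have hk : (0 : ℤ) < κ := by positivity
  exact ⟨Int.ediv_nonneg (Int.emod_nonneg _ hD.ne') hk.le,
    Int.ediv_lt_of_lt_mul hk (by rw [mul_comm (T : ℤ)]; exact Int.emod_lt_of_pos _ hD)⟩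
lemma tau_add {κ T : ℕ} (hκ : 0 < κ) (hT : 0 < T) (a t : ℤ) (ht : 0 ≤ t) (htT : t < T)
    (h : (a % (κ * T : ℤ)) / κ = 0) : ((a + κ * t) % (κ * T : ℤ)) / κ = t := by
  have hD : (0 : ℤ) < κ * T := by positivity
  have hk : (0 : ℤ) < κ := by positivity
  have h0 := Int.emod_nonneg a hD.ne'
  have h1 : a % (κ * T : ℤ) < κ := by
    have := Int.lt_ediv_add_one_mul_self (a % (κ * T : ℤ)) hk
    rw [h] at this; linarith
  have h2 : (a + κ * t) % (κ * T : ℤ) = a % (κ * T : ℤ) + κ * t := by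
    rw [← Int.emod_add_emod]
    refine Int.emod_eq_of_lt (by positivity) ?_
    nlinarith
  rw [h2, Int.add_mul_ediv_left _ _ hk.ne', h, zero_add]
lemma tau_sub {κ T : ℕ} (hκ : 0 < κ) (hT : 0 < T) (a : ℤ) :
    ((a - κ * ((a % (κ * T : ℤ)) / κ)) % (κ * T : ℤ)) / κ = 0 := by
  have hD : (0 : ℤ) < κ * T := by positivity
  have hk : (0 : ℤ) < κ := by positivity
  have h2 : (a - κ * ((a % (κ * T : ℤ)) / κ)) % (κ * T : ℤ) = (a % (κ * T : ℤ)) % κ := by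
    rw [← Int.emod_sub_emod, ← Int.emod_def]
    refine Int.emod_eq_of_lt (Int.emod_nonneg _ hk.ne') ?_
    have := Int.emod_lt_of_pos (a % (κ * T : ℤ)) hk
    have : (1 : ℤ) ≤ T := by exact_mod_cast hT
    nlinarith
  rw [h2]
  exact Int.ediv_eq_zero_of_lt (Int.emod_nonneg _ hk.ne') (Int.emod_lt_of_pos _ hk)
noncomputable def sgnc (z : ℂ) : ℂ := conj z / (‖z‖ : ℂ)
lemma sgnc_norm (z : ℂ) : ‖sgnc z‖ ≤ 1 := by
  rw [sgnc, norm_div, RCLike.norm_conj, Complex.norm_real, norm_norm]; exact div_self_le_one _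
lemma sgnc_mul (z : ℂ) : z * sgnc z = (‖z‖ : ℂ) := by
  rw [sgnc, mul_div_assoc', Complex.mul_conj']
  rcases eq_or_ne z 0 with rfl | h
  · simp
  · have : (‖z‖ : ℂ) ≠ 0 := by simpa using h
    field_simp
lemma locfun {κ T N n : ℕ} (hκ : 0 < κ) (hT : 0 < T) (hn : N + κ * T < n) {f : ℤ → ℂ}
    (hs : ∀ x, f x ≠ 0 → x ∈ Icc (1 : ℤ) (N : ℤ)) {η : ℝ}
    (h : η * T ≤ ∑ v ∈ Ico (-(κ * T : ℤ)) (n - κ * T), ‖∑ t ∈ range T, f (v + κ * t)‖) :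
    ∃ φ : ℤ → ℂ, (∀ x, ‖φ x‖ ≤ 1) ∧ (∃ r : ℝ, ∀ x y : ℤ,
      ⌊((x : ℝ) - r) / ((κ * T : ℕ) : ℝ)⌋ = ⌊((y : ℝ) - r) / ((κ * T : ℕ) : ℝ)⌋ → x % (κ : ℤ) = y % (κ : ℤ) → φ x = φ y) ∧
      η ≤ (∑ x ∈ Icc (1 : ℤ) (N : ℤ), f x * φ x).re := by
  have hD : (0 : ℤ) < κ * T := by positivity
  have hk : (0 : ℤ) < κ := by positivity
  have hT' : (0 : ℝ) < T := by exact_mod_cast hT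
  set S : ℤ → ℂ := fun v => ∑ t ∈ range T, f (v + κ * t) with hS
  obtain ⟨j, hjT, hj⟩ := exists_le_sum_fiber_of_maps_to_of_nsmul_le_sum
    (s := Ico (-(κ * T : ℤ)) (n - κ * T)) (t := Ico (0 : ℤ) T) (f := fun v => (v % (κ * T : ℤ)) / κ)
    (w := fun v => ‖S v‖) (b := η) (fun v _ => mem_Ico.2 (tau_lt hκ hT v)) ⟨0, by simp [hT]⟩
    (by simpa [mul_comm] using h)
  let τ : ℤ → ℤ := fun x => ((x - κ * j) % (κ * T : ℤ)) / κ
  let s : ℤ → ℤ := fun x => x - κ * τ x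
  have hτ : ∀ x, 0 ≤ τ x ∧ τ x < T := fun x => tau_lt hκ hT _
  have hτ0 : ∀ v, (v % (κ * T : ℤ)) / κ = j → τ v = 0 := by
    intro v hv
    have := tau_sub hκ hT v
    rw [hv] at this; exact this
  have hτa : ∀ v t : ℤ, τ v = 0 → 0 ≤ t → t < T → τ (v + κ * t) = t := by
    intro v t h0 h1 h2
    have := tau_add hκ hT (v - κ * j) t h1 h2 h0
    rw [sub_add_eq_add_sub] at this; exact this
  refine ⟨fun x => sgnc (S (s x)), fun x => sgnc_norm _, ⟨((κ * j : ℤ) : ℝ), fun x y hxy hxy' => ?_⟩, ?_⟩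
  · have e : ∀ z : ℤ, ⌊((z : ℝ) - ((κ * j : ℤ) : ℝ)) / ((κ * T : ℕ) : ℝ)⌋ = (z - κ * j) / (κ * T : ℤ) := by
      intro z
      rw [Int.floor_div_natCast, ← Int.cast_sub, Int.floor_intCast, Nat.cast_mul]
    have e2 : ∀ z : ℤ, s z = κ * j + κ * T * ((z - κ * j) / (κ * T : ℤ)) + (z % κ) := by
      intro z
      have h1 := Int.emod_add_mul_ediv (z - κ * j) (κ * T)
      have h2 := Int.emod_add_mul_ediv ((z - κ * j) % (κ * T)) κ
      have h3 : (z - κ * j) % (κ * T) % κ = z % κ := by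
        rw [Int.emod_emod_of_dvd _ (dvd_mul_right _ _), Int.sub_mul_emod_self_left]
      simp only [s, τ]
      linarith
    rw [e, e] at hxy
    simp only
    rw [e2, e2, hxy, hxy']
  have hj' : η ≤ ∑ v ∈ Ico (-(κ * T : ℤ)) (n - κ * T) with (v % (κ * T : ℤ)) / κ = j, ‖S v‖ := hj
  rw [mem_Ico] at hjT
  have hτ1 : ∀ v, τ v = 0 → (v % (κ * T : ℤ)) / κ = j := by
    intro v hv
    have := tau_add hκ hT (v - κ * j) j hjT.1 hjT.2 hv
    rwa [sub_add_cancel] at this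
  have hss : ∀ x, τ (s x) = 0 := by
    intro x
    have := tau_sub hκ hT (x - κ * j)
    simp only [s, τ]
    rw [← this]
    congr 2; ring
  set V := (Ico (-(κ * T : ℤ)) (n - κ * T)).filter (fun v => (v % (κ * T : ℤ)) / κ = j) with hV
  have key : ∑ x ∈ Icc (1 : ℤ) (N : ℤ), f x * sgnc (S (s x))
      = ∑ p ∈ V ×ˢ range T, f (p.1 + κ * p.2) * sgnc (S p.1) := by
    refine sum_of_injOn (fun x => (s x, (τ x).toNat)) (fun x _ y _ hxy => ?_) (fun x hx => ?_) (fun p hp hp' => ?_) (fun x hx => ?_)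
    · simp only [Prod.mk.injEq] at hxy
      have h1 : τ x = τ y := by have := hτ x; have := hτ y; omega
      have h2 := hxy.1
      simp only [s] at h2
      rw [h1] at h2; linarith
    · rw [mem_coe, mem_Icc] at hx
      rw [mem_coe, mem_product, hV, mem_filter, mem_Ico, mem_range]
      have h1 := hτ x
      refine ⟨⟨⟨?_, ?_⟩, hτ1 _ (hss x)⟩, by dsimp only; omega⟩
      · simp only [s]; nlinarith
      · simp only [s]
        have : (N : ℤ) + κ * T < n := by exact_mod_cast hn
        nlinarith
    · rw [mem_product, hV, mem_filter, mem_range] at hp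
      by_contra hne
      apply hp'
      have h0 : f (p.1 + κ * p.2) ≠ 0 := fun h => hne (by rw [h, zero_mul])
      have h1 := hτa p.1 p.2 (hτ0 _ hp.1.2) (by positivity) (by exact_mod_cast hp.2)
      refine ⟨p.1 + κ * p.2, mem_coe.2 (hs _ h0), ?_⟩
      simp only [s, h1]
      ext <;> simp
    · have h1 := hτ x
      have h2 : (((τ x).toNat : ℕ) : ℤ) = τ x := Int.toNat_of_nonneg h1.1
      simp only [h2, s]
      rw [sub_add_cancel]
  rw [key, sum_product]
  have : ∀ v, ∑ t ∈ range T, f (v + κ * t) * sgnc (S v) = ((‖S v‖ : ℝ) : ℂ) := by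
    intro v
    rw [← sum_mul]; exact sgnc_mul _
  simp only [this]
  rw [← Complex.ofReal_sum, Complex.ofReal_re]
  exact hj'
end
section
lemma zval {n : ℕ} [NeZero n] {u : ℤ} (h0 : 0 ≤ u) (h1 : u < n) : (((u : ZMod n).val : ℕ) : ℤ) = u := by
  rw [ZMod.val_intCast, Int.emod_eq_of_lt h0 h1]
lemma tr_out {q P b T N : ℕ} [NeZero P] [NeZero (q * P)] (hT : 0 < T)
    (hn : N + q * b * T < q * P) {f : ℤ → ℂ} (hs : ∀ x, f x ≠ 0 → x ∈ Icc (1 : ℤ) (N : ℤ)) :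
    ∑ v ∈ Ico (-((q * b : ℕ) * T : ℤ)) ((q * P : ℕ) - (q * b : ℕ) * T), ‖∑ t ∈ range T, f (v + (q * b : ℕ) * t)‖ =
    (𝔼 x : ZMod (q * P), ‖𝔼 t : Fin T, f ((x + iH q P ((b : ZMod P) * ((t : ℕ) : ZMod P))).val : ℕ)‖) * (q * P : ℕ) * T := by
  have hT' : (T : ℝ) ≠ 0 := by exact_mod_cast hT.ne'
  have hTc : (T : ℂ) ≠ 0 := by exact_mod_cast hT.ne'
  have hn0 : ((q * P : ℕ) : ℝ) ≠ 0 := by exact_mod_cast (NeZero.ne (q * P))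
  rw [Fintype.expect_eq_sum_div_card, ZMod.card, div_mul_cancel₀ _ hn0, sum_mul]
  have hn' : (N : ℤ) + (q * b : ℕ) * T < (q * P : ℕ) := by exact_mod_cast hn
  generalize hκ : q * b = κ at *
  refine sum_of_injOn (fun v : ℤ => (v : ZMod (q * P))) (fun x hx y hy hxy => ?_) (fun x _ => mem_coe.2 (mem_univ _)) (fun x _ hx => ?_) (fun v hv => ?_)
  · rw [mem_coe, mem_Ico] at hx hy
    simp only at hxy
    rw [ZMod.intCast_eq_intCast_iff] at hxy
    have := Int.ModEq.dvd hxy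
    obtain ⟨k, hk⟩ := this
    have hp : (0 : ℤ) < (q * P : ℕ) := by exact_mod_cast NeZero.pos (q * P)
    have h1 : k < 1 := by
      by_contra h; push Not at h; nlinarith
    have h2 : -1 < k := by
      by_contra h; push Not at h; nlinarith
    obtain rfl : k = 0 := by omega
    linarith
  · exfalso
    apply hx
    have hv := ZMod.val_lt x
    have hv' : (x.val : ℤ) < (q * P : ℕ) := by exact_mod_cast hv
    by_cases h : (x.val : ℤ) < (q * P : ℕ) - κ * T
    · refine ⟨x.val, ?_, by simp⟩
      rw [mem_coe, mem_Ico]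
      exact ⟨by have : (0 : ℤ) ≤ κ * T := by positivity
                linarith [Int.natCast_nonneg x.val], h⟩
    · refine ⟨x.val - (q * P : ℕ), ?_, ?_⟩
      · rw [mem_coe, mem_Ico]; constructor <;> linarith
      · simp only [Int.cast_sub, Int.cast_natCast, ZMod.natCast_self, sub_zero, ZMod.natCast_zmod_val]
  · rw [mem_Ico] at hv
    have key : ∀ t : Fin T, f ((((v : ZMod (q * P)) + iH q P ((b : ZMod P) * ((t : ℕ) : ZMod P))).val : ℕ) : ℤ) = f (v + κ * (t : ℕ)) := by
      intro t
      have e : (v : ZMod (q * P)) + iH q P ((b : ZMod P) * ((t : ℕ) : ZMod P)) = ((v + κ * (t : ℕ) : ℤ) : ZMod (q * P)) := by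
        rw [← Nat.cast_mul, iH_nat, ← hκ]; push_cast; ring
      rw [e]
      have ht : ((t : ℕ) : ℤ) < T := by exact_mod_cast t.2
      have ht0 : (0 : ℤ) ≤ ((t : ℕ) : ℤ) := by positivity
      have hk0 : (0 : ℤ) ≤ κ := by positivity
      have hlt : (κ : ℤ) * (t : ℕ) ≤ κ * T := by gcongr
      have hlt0 : 0 ≤ (κ : ℤ) * (t : ℕ) := by positivity
      generalize hu : v + κ * ((t : ℕ) : ℤ) = u
      by_cases h0 : 0 ≤ u
      · rw [zval h0 (by linarith)]
      · have z1 : f u = 0 := by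
          by_contra h; have := mem_Icc.1 (hs _ h); linarith
        rw [z1]
        have e2 : ((u : ℤ) : ZMod (q * P)) = ((u + (q * P : ℕ) : ℤ) : ZMod (q * P)) := by
          rw [Int.cast_add, Int.cast_natCast, ZMod.natCast_self, add_zero]
        rw [e2, zval (by linarith) (by linarith)]
        by_contra h; have := mem_Icc.1 (hs _ h); linarith
    simp only [key]
    rw [Fintype.expect_eq_sum_div_card, Fintype.card_fin, norm_div, Complex.norm_natCast, div_mul_cancel₀ _ hT',
      Fin.sum_univ_eq_sum_range (fun t => f (v + κ * t)) T]
lemma tr_in {q P M N : ℕ} [NeZero P] [NeZero (q * P)] (hM : 0 < M) (hN : 0 < N) (hMN : M ≤ N) (hqM : q * M ^ 2 ≤ N)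
    (hn : 2 * N < q * P) {f0 f1 f2 : ℤ → ℂ} (hs : ∀ x, f0 x ≠ 0 → x ∈ Icc (1 : ℤ) (N : ℤ)) :
    (𝔼 x : ZMod (q * P), 𝔼 y : Fin M, f0 (x.val : ℕ) * f1 ((x + ((y : ℕ) + 1) • 1).val : ℕ) *
      f2 ((x + iH q P ((((y : ℕ) : ZMod P) + 1) ^ 2)).val : ℕ)) =
    (∑ x ∈ Icc (1 : ℤ) (N : ℤ), ∑ y ∈ Icc (1 : ℤ) (M : ℤ),
      f0 x * f1 (x + y) * f2 (x + (q : ℤ) * y ^ 2)) / ((N : ℂ) * (M : ℂ)) * ((N : ℂ) / (q * P : ℕ)) := by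
  have hMc : (M : ℂ) ≠ 0 := by exact_mod_cast hM.ne'
  have hNc : (N : ℂ) ≠ 0 := by exact_mod_cast hN.ne'
  have hn0 : ((q * P : ℕ) : ℂ) ≠ 0 := by exact_mod_cast (NeZero.ne (q * P))
  have hn' : 2 * (N : ℤ) < (q * P : ℕ) := by exact_mod_cast hn
  have hqM' : (q : ℤ) * M ^ 2 ≤ N := by exact_mod_cast hqM
  have hMN' : (M : ℤ) ≤ N := by exact_mod_cast hMN
  have key : (∑ x ∈ Icc (1 : ℤ) (N : ℤ), ∑ y ∈ Icc (1 : ℤ) (M : ℤ), f0 x * f1 (x + y) * f2 (x + (q : ℤ) * y ^ 2))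
    = ∑ x : ZMod (q * P), ∑ y : Fin M, f0 (x.val : ℕ) * f1 ((x + ((y : ℕ) + 1) • 1).val : ℕ) *
      f2 ((x + iH q P ((((y : ℕ) : ZMod P) + 1) ^ 2)).val : ℕ) := by
    refine sum_of_injOn (fun v : ℤ => (v : ZMod (q * P))) (fun x hx y hy hxy => ?_) (fun x _ => mem_coe.2 (mem_univ _)) (fun x _ hx => ?_) (fun v hv => ?_)
    · rw [mem_coe, mem_Icc] at hx hy
      simp only at hxy
      rw [← zval (n := q * P) (u := x) (by linarith) (by linarith), hxy, zval (by linarith) (by linarith)]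
    · refine sum_eq_zero fun y _ => ?_
      have : f0 (x.val : ℕ) = 0 := by
        by_contra h
        exact hx ⟨x.val, mem_coe.2 (hs _ h), by simp⟩
      rw [this, zero_mul, zero_mul]
    · rw [mem_Icc] at hv
      refine (sum_of_injOn (fun y : Fin M => ((y : ℕ) : ℤ) + 1) (fun x _ y _ hxy => ?_) (fun x _ => ?_) (fun x hx hx' => ?_) (fun y _ => ?_)).symm
      · ext; simpa using hxy
      · rw [mem_coe, mem_Icc]; have := x.2; constructor <;> dsimp only <;> omega
      · exfalso
        rw [mem_Icc] at hx
        exact hx' ⟨⟨(x - 1).toNat, by omega⟩, by simp, by simp only; omega⟩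
      · have hy1 : ((y : ℕ) : ℤ) + 1 ≤ M := by have := y.2; omega
        have hy0 : (0 : ℤ) ≤ (y : ℕ) := by positivity
        have hy2 : (q : ℤ) * (((y : ℕ) : ℤ) + 1) ^ 2 ≤ q * M ^ 2 := by gcongr
        have hy3 : 0 ≤ (q : ℤ) * (((y : ℕ) : ℤ) + 1) ^ 2 := by positivity
        have e1 : (v : ZMod (q * P)) + ((y : ℕ) + 1) • 1 = ((v + ((y : ℕ) + 1) : ℤ) : ZMod (q * P)) := by
          rw [nsmul_eq_mul]; push_cast; ring
        have e2 : (v : ZMod (q * P)) + iH q P ((((y : ℕ) : ZMod P) + 1) ^ 2) = ((v + q * (((y : ℕ) : ℤ) + 1) ^ 2 : ℤ) : ZMod (q * P)) := by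
          have : (((y : ℕ) : ZMod P) + 1) ^ 2 = ((((y : ℕ) + 1) ^ 2 : ℕ) : ZMod P) := by push_cast; ring
          rw [this, iH_nat]; push_cast; ring
        rw [e1, e2, zval (by linarith) (by linarith), zval (by linarith) (by linarith), zval (by linarith) (by linarith)]
  rw [key, Fintype.expect_eq_sum_div_card, ZMod.card]
  simp_rw [Fintype.expect_eq_sum_div_card, Fintype.card_fin]
  rw [← sum_div]
  field_simp
end
section
lemma sqrt_facts {q N : ℕ} (hq : 0 < q) (hqN : q ≤ N) : 0 < Nat.sqrt (N / q) ∧ q * Nat.sqrt (N / q) ^ 2 ≤ N ∧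
    N < 4 * (q * Nat.sqrt (N / q) ^ 2) ∧ Nat.sqrt (N / q) ≤ N := by
  have h1 : 0 < N / q := Nat.div_pos hqN hq
  have hM : 0 < Nat.sqrt (N / q) := Nat.sqrt_pos.2 h1
  have h2 : q * Nat.sqrt (N / q) ^ 2 ≤ N := (Nat.mul_le_mul_left _ (Nat.sqrt_le' _)).trans (Nat.mul_div_le _ _)
  refine ⟨hM, h2, ?_, (Nat.sqrt_le_self _).trans (Nat.div_le_self _ _)⟩
  have h3 := Nat.lt_succ_sqrt' (N / q)
  generalize Nat.sqrt (N / q) = M at *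
  have h4 : N < q * (N / q + 1) := Nat.lt_mul_div_succ _ hq
  have h5 : N / q + 1 ≤ 4 * M ^ 2 := by
    have : (M + 1) ^ 2 ≤ 4 * M ^ 2 := by nlinarith
    have : N / q < (M + 1) ^ 2 := h3
    omega
  calc N < q * (N / q + 1) := h4
    _ ≤ q * (4 * M ^ 2) := Nat.mul_le_mul_left _ h5
    _ = _ := by ring
lemma cnt_le {q N M : ℕ} {f0 f1 f2 : ℤ → ℂ} (h0 : ∀ x, ‖f0 x‖ ≤ 1) (h1 : ∀ x, ‖f1 x‖ ≤ 1) (h2 : ∀ x, ‖f2 x‖ ≤ 1) :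
    ‖(∑ x ∈ Icc (1 : ℤ) (N : ℤ), ∑ y ∈ Icc (1 : ℤ) (M : ℤ),
      f0 x * f1 (x + y) * f2 (x + (q : ℤ) * y ^ 2)) / ((N : ℂ) * (M : ℂ))‖ ≤ 1 := by
  rw [norm_div, norm_mul, Complex.norm_natCast, Complex.norm_natCast]
  refine div_le_one_of_le₀ ?_ (by positivity)
  have h : ∀ x ∈ Icc (1 : ℤ) (N : ℤ), ‖∑ y ∈ Icc (1 : ℤ) (M : ℤ), f0 x * f1 (x + y) * f2 (x + (q : ℤ) * y ^ 2)‖ ≤ (M : ℝ) := by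
    intro x _
    refine (norm_sum_le_of_le (n := fun _ => (1 : ℝ)) _ fun y _ => ?_).trans (by simp)
    exact norm_mul_le_one (norm_mul_le_one (h0 _) (h1 _)) (h2 _)
  exact (norm_sum_le_of_le _ h).trans (by simp)
lemma core : ∃ a : ℕ, ∃ B : ℝ, 1 ≤ B ∧ ∀ (q N : ℕ), 0 < q → q ≤ N → ∀ δ : ℝ, 0 < δ → δ ≤ 1 →
    ∀ f0 f1 f2 : ℤ → ℂ, (∀ x, ‖f0 x‖ ≤ 1) → (∀ x, ‖f1 x‖ ≤ 1) → (∀ x, ‖f2 x‖ ≤ 1) →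
    (∀ x, f0 x ≠ 0 → x ∈ Icc (1 : ℤ) (N : ℤ)) → ∀ M : ℕ, M = Nat.sqrt (N / q) → (q : ℝ) ≤ M * (δ ^ a / B) →
    δ / 2 ≤ ‖(∑ x ∈ Icc (1 : ℤ) (N : ℤ), ∑ y ∈ Icc (1 : ℤ) (M : ℤ),
      f0 x * f1 (x + y) * f2 (x + (q : ℤ) * y ^ 2)) / ((N : ℂ) * (M : ℂ))‖ →
    ∀ (P : ℕ) [NeZero P] [NeZero (q * P)], P = 8 * M ^ 2 →
    ∃ b : ℕ, 0 < b ∧ (b : ℝ) ≤ 1 / (δ ^ a / B) ∧ ∀ T : ℕ, 0 < T → (T : ℝ) * q ≤ (δ ^ a / B) * M →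
    δ ^ a / B ≤ (𝔼 x : ZMod (q * P), ‖𝔼 t : Fin T, f0 ((x + iH q P ((b : ZMod P) * ((t : ℕ) : ZMod P))).val : ℕ)‖) ∧
    δ ^ a / B ≤ (𝔼 x : ZMod (q * P), ‖𝔼 t : Fin T, f1 ((x + iH q P ((b : ZMod P) * ((t : ℕ) : ZMod P))).val : ℕ)‖) := by
  obtain ⟨F, ⟨a, B, hB, hF⟩, hC⟩ := thmC
  refine ⟨a, 16 ^ a * B, by nlinarith [one_le_pow₀ (M₀ := ℝ) (a := 16) (by norm_num) (n := a)], ?_⟩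
  intro q N hq hqN δ hδ hδ1 f0 f1 f2 h0 h1 h2 hs M hM hqM hcnt P _ _ hP
  obtain ⟨hM0, hM1, hM2, hM3⟩ := sqrt_facts hq hqN
  rw [← hM] at hM0 hM1 hM2 hM3
  have hη : δ ^ a / (16 ^ a * B) ≤ F (δ / 16) := by
    have := hF (δ / 16) (by positivity) (by linarith)
    rwa [div_pow, div_div] at this
  have hη0 : 0 < δ ^ a / (16 ^ a * B) := by positivity
  generalize δ ^ a / (16 ^ a * B) = η at *
  have hn : 2 * N < q * P := by rw [hP]; linarith
  have hn8 : ((q * P : ℕ) : ℝ) ≤ 8 * N := by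
    have : q * P ≤ 8 * N := by rw [hP]; linarith
    exact_mod_cast this
  have hN0 : 0 < N := by omega
  have hNr : (0 : ℝ) < N := by exact_mod_cast hN0
  have hnr : (0 : ℝ) < (q * P : ℕ) := by exact_mod_cast (by omega : 0 < q * P)
  have key := tr_in (q := q) (P := P) hM0 hN0 hM3 hM1 hn (f0 := f0) (f1 := f1) (f2 := f2) hs
  have hbig : δ / 16 ≤ ‖𝔼 x : ZMod (q * P), 𝔼 y : Fin M, f0 (x.val : ℕ) * f1 ((x + ((y : ℕ) + 1) • 1).val : ℕ) *
      f2 ((x + iH q P ((((y : ℕ) : ZMod P) + 1) ^ 2)).val : ℕ)‖ := by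
    rw [key, norm_mul, norm_div (N : ℂ), Complex.norm_natCast, Complex.norm_natCast]
    have : (1 : ℝ) / 8 ≤ N / (q * P : ℕ) := by
      rw [div_le_div_iff₀ (by norm_num) hnr]; linarith
    calc δ / 16 = δ / 2 * (1 / 8) := by ring
      _ ≤ _ := mul_le_mul hcnt this (by norm_num) (norm_nonneg _)
  obtain ⟨b, hb0, hb1, hb⟩ := hC (M := M) hP (fibInst q P hq) (iH_one q P) (f0 := fun x => f0 (x.val : ℕ))
    (f1 := fun x => f1 (x.val : ℕ)) (f2 := fun x => f2 (x.val : ℕ)) (fun x => h0 _) (fun x => h1 _) (fun x => h2 _)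
    (δ := δ / 16) (by positivity) (by linarith) (hqM.trans (by gcongr)) hbig
  refine ⟨b, hb0, hb1.trans (one_div_le_one_div_of_le hη0 hη), fun T hT hT' => ?_⟩
  obtain ⟨r0, r1⟩ := hb T hT (hT'.trans (by gcongr))
  exact ⟨hη.trans r0, hη.trans r1⟩
lemma finish {q N b M P : ℕ} [NeZero P] [NeZero (q * P)] (hq : 0 < q) (hqN : q ≤ N) (hM : M = Nat.sqrt (N / q))
    (hP : P = 8 * M ^ 2) {f : ℤ → ℂ} {η : ℝ} (hη : 0 < η) (hqM : (q : ℝ) ≤ M * η) (hb0 : 0 < b) (hb : (b : ℝ) ≤ 1 / η)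
    (hs : ∀ x, f x ≠ 0 → x ∈ Icc (1 : ℤ) (N : ℤ))
    (h : ∀ T : ℕ, 0 < T → (T : ℝ) * q ≤ η * M →
      η ≤ (𝔼 x : ZMod (q * P), ‖𝔼 t : Fin T, f ((x + iH q P ((b : ZMod P) * ((t : ℕ) : ZMod P))).val : ℕ)‖)) :
    ∃ (φ : ℤ → ℂ) (R : ℝ), (∀ x, ‖φ x‖ ≤ 1) ∧ (∃ r : ℝ, ∀ x y : ℤ,
      ⌊((x : ℝ) - r) / R⌋ = ⌊((y : ℝ) - r) / R⌋ → x % ((q * b : ℕ) : ℤ) = y % ((q * b : ℕ) : ℤ) → φ x = φ y) ∧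
      η * M / 2 ≤ R ∧ η * N ≤ (∑ x ∈ Icc (1 : ℤ) (N : ℤ), f x * φ x).re := by
  obtain ⟨hM0, hM1, hM2, hM3⟩ := sqrt_facts hq hqN
  rw [← hM] at hM0 hM1 hM2 hM3
  have hqr : (0 : ℝ) < q := by exact_mod_cast hq
  have hbr : (1 : ℝ) ≤ b := by exact_mod_cast hb0
  set T := ⌊M * η / q⌋₊ with hT
  have h1 : 1 ≤ M * η / q := by rwa [le_div_iff₀ hqr, one_mul]
  have hT0 : 0 < T := Nat.floor_pos.2 h1
  have hT1 : (T : ℝ) * q ≤ η * M := by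
    have := Nat.floor_le (zero_le_one.trans h1)
    rw [← hT, le_div_iff₀ hqr] at this; linarith
  have hT2 : η * M / 2 ≤ T * q := by
    have := Nat.lt_floor_add_one (M * η / q)
    rw [← hT, div_lt_iff₀ hqr] at this
    have : (1 : ℝ) ≤ T := by exact_mod_cast hT0
    nlinarith
  have hn : 2 * N < q * P := by rw [hP]; linarith
  have hD : q * b * T ≤ N := by
    refine le_trans ?_ hM3
    have h3 : (b : ℝ) * η ≤ 1 := by rwa [le_div_iff₀ hη] at hb
    have : ((q * b * T : ℕ) : ℝ) ≤ M := by
      push_cast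
      calc (q : ℝ) * b * T = b * (T * q) := by ring
        _ ≤ b * (η * M) := by gcongr
        _ = (b * η) * M := by ring
        _ ≤ 1 * M := by gcongr
        _ = M := one_mul _
    exact_mod_cast this
  have hlt : N + q * b * T < q * P := by omega
  have e := tr_out (q := q) (P := P) (b := b) hT0 hlt hs
  have h2 := h T hT0 hT1
  have h3 : (η * (q * P : ℕ)) * T ≤ ∑ v ∈ Ico (-((q * b : ℕ) * T : ℤ)) ((q * P : ℕ) - (q * b : ℕ) * T), ‖∑ t ∈ range T, f (v + (q * b : ℕ) * t)‖ := by
    rw [e]; gcongr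
  obtain ⟨φ, p1, p2, p3⟩ := locfun (Nat.mul_pos hq hb0) hT0 hlt hs h3
  refine ⟨φ, _, p1, p2, ?_, le_trans ?_ p3⟩
  · refine hT2.trans ?_
    push_cast
    nlinarith [mul_nonneg (Nat.cast_nonneg (α := ℝ) T) hqr.le]
  · have : (N : ℝ) ≤ (q * P : ℕ) := by exact_mod_cast (by omega : N ≤ q * P)
    gcongr
end
end PCN
open PCN in
/-- **Partial cut norm inverse theorem.** -/
theorem partial_cut_norm_inverse :
    ∃ C c : ℝ, 0 < C ∧ 0 < c ∧
      ∀ (q N : ℕ), 0 < q → q ≤ N → ∀ (δ : ℝ) (f : ℤ → ℂ), 0 < δ →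
        (∀ x, ‖f x‖ ≤ 1) →
        (∀ x, f x ≠ 0 → x ∈ Finset.Icc (1 : ℤ) (N : ℤ)) →
        δ ≤ partialCutNorm q N f →
        ((N : ℝ) ≤ C * ((q : ℝ) / δ) ^ C ∨
          ∃ (φ : ℤ → ℂ) (M : ℝ) (q' : ℕ), (∀ x, ‖φ x‖ ≤ 1) ∧ 0 < q' ∧
            IsLocalFunction φ M (q * q') ∧
            c * (δ / (q : ℝ)) ^ C * Real.sqrt N ≤ M ∧
            (q' : ℝ) ≤ C * δ ^ (-C) ∧
            c * δ ^ C * N ≤ (∑ x ∈ Finset.Icc (1 : ℤ) (N : ℤ), f x * φ x).re) := by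
  obtain ⟨a, B, hB, hcore⟩ := core
  have hB0 : (0 : ℝ) < B := by linarith
  refine ⟨4 * B ^ 2 + 3 + 2 * a, 1 / (4 * B), by positivity, by positivity, ?_⟩
  intro q N hq hqN δ f hδ hf hfs hnorm
  set C : ℝ := 4 * B ^ 2 + 3 + 2 * a with hC
  have hB2 : (0 : ℝ) ≤ B ^ 2 := by positivity
  have ha0 : (0 : ℝ) ≤ a := by positivity
  have hCa : ((3 + 2 * a : ℕ) : ℝ) ≤ C := by push_cast; linarith
  have hCa1 : ((a + 1 : ℕ) : ℝ) ≤ C := by push_cast; linarith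
  have hCa0 : ((a : ℕ) : ℝ) ≤ C := by linarith
  by_cases hsmall : (N : ℝ) ≤ C * ((q : ℝ) / δ) ^ C
  · exact Or.inl hsmall
  right
  push Not at hsmall
  have hδ1 : δ ≤ 1 := by
    refine hnorm.trans (csSup_le ⟨_, 0, 0, by simp, by simp, by simp, by simp, Or.inl rfl⟩ ?_)
    rintro r ⟨g₁, g₂, h1, h2, -, -, rfl | rfl⟩
    · exact cnt_le hf h1 h2
    · exact cnt_le h1 hf h2
  have hex : ∃ g₁ g₂ : ℤ → ℂ, (∀ x, ‖g₁ x‖ ≤ 1) ∧ (∀ x, ‖g₂ x‖ ≤ 1) ∧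
      (∀ x, g₁ x ≠ 0 → x ∈ Finset.Icc (1 : ℤ) (N : ℤ)) ∧
      (δ / 2 ≤ ‖cntOp q N f g₁ g₂‖ ∨ δ / 2 ≤ ‖cntOp q N g₁ f g₂‖) := by
    have hlt := lt_of_lt_of_le (half_lt_self hδ) hnorm
    rw [partialCutNorm] at hlt
    obtain ⟨r, ⟨g₁, g₂, h1, h2, h3, h4, h5⟩, hr⟩ := exists_lt_of_lt_csSup
      (by exact ⟨_, 0, 0, by simp, by simp, by simp, by simp, Or.inl rfl⟩) hlt
    refine ⟨g₁, g₂, h1, h2, h3, ?_⟩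
    rcases h5 with rfl | rfl
    · exact Or.inl hr.le
    · exact Or.inr hr.le
  obtain ⟨g₁, g₂, h1, h2, h3, h4⟩ := hex
  obtain ⟨hM0, hM1, hM2, hM3⟩ := sqrt_facts hq hqN
  unfold cntOp at h4
  generalize hM : Nat.sqrt (N / q) = M at *
  have hqr : (1 : ℝ) ≤ q := by exact_mod_cast hq
  have hMr : (0 : ℝ) < M := by exact_mod_cast hM0
  have hN4 : (N : ℝ) < 4 * (q * M ^ 2) := by exact_mod_cast hM2
  have hqδ : 1 ≤ (q : ℝ) / δ := by rw [le_div_iff₀ hδ]; linarith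
  have hη : 0 < δ ^ a / B := by positivity
  have hqM : (q : ℝ) ≤ M * (δ ^ a / B) := by
    have e1 : ((q : ℝ) / δ) ^ (3 + 2 * a) ≤ ((q : ℝ) / δ) ^ C := by
      rw [← Real.rpow_natCast]; exact Real.rpow_le_rpow_of_exponent_le hqδ hCa
    have e2 : 4 * B ^ 2 * ((q : ℝ) / δ) ^ (3 + 2 * a) < 4 * (q * M ^ 2) := by
      refine lt_of_le_of_lt ?_ (hsmall.trans hN4)
      refine mul_le_mul (by linarith) e1 (by positivity) (by linarith)
    have e3 : (q : ℝ) ^ 3 / (δ ^ a) ^ 2 ≤ ((q : ℝ) / δ) ^ (3 + 2 * a) := by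
      rw [div_pow, ← pow_mul]
      have : (q : ℝ) ^ 3 ≤ q ^ (3 + 2 * a) := pow_le_pow_right₀ hqr (by omega)
      have : δ ^ (3 + 2 * a) ≤ δ ^ (a * 2) := pow_le_pow_of_le_one hδ.le hδ1 (by omega)
      gcongr
    have e4 : B ^ 2 * ((q : ℝ) ^ 3 / (δ ^ a) ^ 2) < q * M ^ 2 := by
      have := mul_le_mul_of_nonneg_left e3 hB2
      linarith
    have hd : 0 < δ ^ a := by positivity
    have e5 : (q : ℝ) ^ 2 ≤ (M * (δ ^ a / B)) ^ 2 := by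
      have h5 : B ^ 2 * (q : ℝ) ^ 3 < q * M ^ 2 * (δ ^ a) ^ 2 := by
        rwa [mul_div_assoc', div_lt_iff₀ (by positivity)] at e4
      have h6 : B ^ 2 * (q : ℝ) ^ 2 < M ^ 2 * (δ ^ a) ^ 2 := by
        refine lt_of_mul_lt_mul_left ?_ (zero_le_one.trans hqr)
        calc _ = B ^ 2 * (q : ℝ) ^ 3 := by ring
          _ < _ := h5
          _ = _ := by ring
      rw [mul_pow, div_pow, mul_div_assoc', le_div_iff₀ (by positivity)]
      linarith
    exact (sq_le_sq₀ (by positivity) (by positivity)).1 e5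
  haveI : NeZero (8 * M ^ 2) := ⟨by positivity⟩
  haveI : NeZero (q * (8 * M ^ 2)) := ⟨by positivity⟩
  have hfin : ∃ b : ℕ, 0 < b ∧ (b : ℝ) ≤ 1 / (δ ^ a / B) ∧ ∃ (φ : ℤ → ℂ) (R : ℝ), (∀ x, ‖φ x‖ ≤ 1) ∧ (∃ r : ℝ, ∀ x y : ℤ,
      ⌊((x : ℝ) - r) / R⌋ = ⌊((y : ℝ) - r) / R⌋ → x % ((q * b : ℕ) : ℤ) = y % ((q * b : ℕ) : ℤ) → φ x = φ y) ∧
      (δ ^ a / B) * M / 2 ≤ R ∧ (δ ^ a / B) * N ≤ (∑ x ∈ Finset.Icc (1 : ℤ) (N : ℤ), f x * φ x).re := by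
    rcases h4 with h4 | h4
    · obtain ⟨b, hb0, hb1, hb⟩ := hcore q N hq hqN δ hδ hδ1 f g₁ g₂ hf h1 h2 hfs M hM.symm hqM h4 _ rfl
      exact ⟨b, hb0, hb1, finish hq hqN hM.symm rfl hη hqM hb0 hb1 hfs fun T hT hT' => (hb T hT hT').1⟩
    · obtain ⟨b, hb0, hb1, hb⟩ := hcore q N hq hqN δ hδ hδ1 g₁ f g₂ h1 hf h2 h3 M hM.symm hqM h4 _ rfl
      exact ⟨b, hb0, hb1, finish hq hqN hM.symm rfl hη hqM hb0 hb1 hfs fun T hT hT' => (hb T hT hT').2⟩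
  obtain ⟨b, hb0, hb1, φ, R, p1, p2, p3, p4⟩ := hfin
  refine ⟨φ, R, b, p1, hb0, p2, ?_, ?_, ?_⟩
  · refine le_trans ?_ p3
    have hx0 : 0 < δ / (q : ℝ) := by positivity
    have hx1 : δ / (q : ℝ) ≤ 1 := by rw [div_le_one (by linarith)]; linarith
    have e1 : (δ / (q : ℝ)) ^ C ≤ (δ / (q : ℝ)) ^ (a + 1) := by
      rw [← Real.rpow_natCast]; exact Real.rpow_le_rpow_of_exponent_ge hx0 hx1 hCa1
    have e2 : (δ / (q : ℝ)) ^ (a + 1) ≤ δ ^ a / q := by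
      rw [div_pow]
      have : (q : ℝ) ≤ q ^ (a + 1) := le_self_pow₀ hqr (by omega)
      have : δ ^ (a + 1) ≤ δ ^ a := pow_le_pow_of_le_one hδ.le hδ1 (by omega)
      gcongr
    have e3 : Real.sqrt N ≤ 2 * (q * M) := by
      refine Real.sqrt_le_iff.2 ⟨by positivity, hN4.le.trans ?_⟩
      have : (q : ℝ) * M ^ 2 ≤ q * (q * M ^ 2) := le_mul_of_one_le_left (by positivity) hqr
      nlinarith
    calc 1 / (4 * B) * (δ / (q : ℝ)) ^ C * Real.sqrt N ≤ 1 / (4 * B) * (δ ^ a / q) * (2 * (q * M)) := by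
          gcongr; exact e1.trans e2
      _ = δ ^ a / B * M / 2 := by field_simp; ring
  · refine hb1.trans ?_
    rw [one_div_div, Real.rpow_neg hδ.le, ← div_eq_mul_inv]
    have e1 : δ ^ C ≤ δ ^ a := by
      rw [← Real.rpow_natCast]; exact Real.rpow_le_rpow_of_exponent_ge hδ hδ1 hCa0
    have : 0 < δ ^ C := Real.rpow_pos_of_pos hδ _
    have : B ≤ C := by nlinarith
    gcongr
  · refine le_trans ?_ p4
    have e1 : δ ^ C ≤ δ ^ a := by
      rw [← Real.rpow_natCast]; exact Real.rpow_le_rpow_of_exponent_ge hδ hδ1 hCa0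
    have e2 : 1 / (4 * B) ≤ 1 / B := by
      apply one_div_le_one_div_of_le hB0; linarith
    calc 1 / (4 * B) * δ ^ C * N ≤ 1 / B * δ ^ a * N := by gcongr
      _ = _ := by ring
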